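/- Let T and U be computable consistent extensions of PA and n ≥ 1. The following are equivalent: (1) (T,U) is a C^B_n-pair, i.e., T + Th_{B(Σ_n)}(U) is consistent; (2) there is a Δ_{n+1}(PA) sentence in HCons(B(Σ_n),T) ∩ HCons(B(Σ_n),U) \ (Th(T) ∪ Th(U)); (3) there is a sentence which is simultaneously exactly hereditarily B(Σ_n)-conservative over T and U, i.e., a sentence φ ∈ HCons(B(Σ_n),T) ∩ HCons(B(Σ_n),U) together with a Δ_{n+1}(PA) sentence ψ such that PA + φ ⊢ ψ, T ⊬ ψ, and U ⊬ ψ; (4) there is a sentence in HCons(B(Σ_n),T) ∩ HCons(B(Σ_n),U) \ (Th(T) ∪ Th(U)); (5) HCons(B(Σ_n),U) \ Th(T) ≠ ∅. -/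

import Mathlib

open FirstOrder Language
open scoped FirstOrder

namespace Guaspari

/-- The first-order language of arithmetic: a constant `0`, a unary function `S`,
binary functions `+` (coded `false`) and `·` (coded `true`), and a binary relation `≤`. -/
def LA : FirstOrder.Language :=
  ⟨fun n => match n with | 0 => Unit | 1 => Unit | 2 => Bool | _ => Empty,
   fun n => match n with | 2 => Unit | _ => Empty⟩

/-- Sentences of the language of arithmetic. -/
abbrev Snt : Type := LA.Sentence

/-- Theories (sets of sentences) in the language of arithmetic. -/
abbrev Thy : Type := LA.Theory

/-- The term `0`. -/
def zeroT {α : Type} {n : ℕ} : LA.Term (α ⊕ Fin n) :=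
  Constants.term (show LA.Constants from Unit.unit)

/-- The term `S t`. -/
def succT {α : Type} {n : ℕ} (t : LA.Term (α ⊕ Fin n)) : LA.Term (α ⊕ Fin n) :=
  Functions.apply₁ (show LA.Functions 1 from Unit.unit) t

/-- The term `t + u`. -/
def addT {α : Type} {n : ℕ} (t u : LA.Term (α ⊕ Fin n)) : LA.Term (α ⊕ Fin n) :=
  Functions.apply₂ (show LA.Functions 2 from false) t u

/-- The term `t * u`. -/
def mulT {α : Type} {n : ℕ} (t u : LA.Term (α ⊕ Fin n)) : LA.Term (α ⊕ Fin n) :=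
  Functions.apply₂ (show LA.Functions 2 from true) t u

/-- The atomic formula `t ≤ u`. -/
def leF {α : Type} {n : ℕ} (t u : LA.Term (α ⊕ Fin n)) : LA.BoundedFormula α n :=
  Relations.boundedFormula₂ (show LA.Relations 2 from Unit.unit) t u

/-- The `i`-th (de Bruijn-indexed) bound variable as a term. -/
def vT {m : ℕ} (i : Fin m) : LA.Term (Empty ⊕ Fin m) := Term.var (Sum.inr i)

/-- The induction axiom for the formula `φ(x₀,…,x_{k-1}, x_k)` with induction on `x_k`,
universally closed over the parameters `x₀,…,x_{k-1}`. -/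
def indAxiom {k : ℕ} (φ : LA.BoundedFormula Empty (k + 1)) : Snt :=
  let base := ∀' ((vT (Fin.last k) =' zeroT) ⟹ φ)
  let step := ∀' (φ ⟹
    ∀' ((vT (Fin.last (k + 1)) =' succT (vT (Fin.castSucc (Fin.last k)))) ⟹ φ.liftAt 1 k))
  ((base ⊓ step) ⟹ ∀' φ).alls

/-- The axioms of Peano arithmetic `PA`: the basic axioms for `0`, `S`, `+`, `·`, `≤`,
together with the full induction scheme. -/
def PAAx : Thy :=
  {∀' ∼(succT (vT 0) =' zeroT),
   ∀' ∀' ((succT (vT 0) =' succT (vT 1)) ⟹ (vT 0 =' vT 1)),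
   ∀' (addT (vT 0) zeroT =' vT 0),
   ∀' ∀' (addT (vT 0) (succT (vT 1)) =' succT (addT (vT 0) (vT 1))),
   ∀' (mulT (vT 0) zeroT =' zeroT),
   ∀' ∀' (mulT (vT 0) (succT (vT 1)) =' addT (mulT (vT 0) (vT 1)) (vT 0)),
   ∀' ∀' (leF (vT 0) (vT 1) ⇔ ∃' (addT (vT 2) (vT 0) =' vT 1))} ∪
  {φ | ∃ (k : ℕ) (ψ : LA.BoundedFormula Empty (k + 1)), φ = indAxiom ψ}

/-- `Prv T φ`: the sentence `φ` is provable from the theory `T` (equivalently, by the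
Gödel completeness theorem, `φ` holds in every model of `T`). -/
def Prv (T : Thy) (φ : Snt) : Prop := T ⊨ᵇ φ

/-- `Th T`: the set of sentences provable from `T`. -/
def Th (T : Thy) : Set Snt := {φ | Prv T φ}

/-- `Con T`: the theory `T` is consistent. -/
def Con (T : Thy) : Prop := ¬ Prv T ⊥

/-- The theory `T + φ`. -/
def add (T : Thy) (φ : Snt) : Thy := insert φ T

/-- `T` is an extension of `PA`. -/
def ExtPA (T : Thy) : Prop := ∀ φ ∈ PAAx, Prv T φ

/-- `V` is a subtheory of `T` (containing `PA`, as assumed throughout the paper). -/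
def SubThy (V T : Thy) : Prop := ExtPA V ∧ ∀ φ, Prv V φ → Prv T φ

/-- Δ₀ (bounded) formulas. -/
inductive IsDelta0 : ∀ {m : ℕ}, LA.BoundedFormula Empty m → Prop
  | falsum {m : ℕ} : IsDelta0 (⊥ : LA.BoundedFormula Empty m)
  | equal {m : ℕ} (t u : LA.Term (Empty ⊕ Fin m)) : IsDelta0 (t =' u)
  | le {m : ℕ} (t u : LA.Term (Empty ⊕ Fin m)) : IsDelta0 (leF t u)
  | imp {m : ℕ} {φ ψ : LA.BoundedFormula Empty m} :
      IsDelta0 φ → IsDelta0 ψ → IsDelta0 (φ ⟹ ψ)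
  | ball {m : ℕ} (t : LA.Term (Empty ⊕ Fin m)) {φ : LA.BoundedFormula Empty (m + 1)} :
      IsDelta0 φ →
      IsDelta0 (∀' (leF (vT (Fin.last m)) (t.relabel (Sum.map id Fin.castSucc)) ⟹ φ))
  | bex {m : ℕ} (t : LA.Term (Empty ⊕ Fin m)) {φ : LA.BoundedFormula Empty (m + 1)} :
      IsDelta0 φ →
      IsDelta0 (∃' (leF (vT (Fin.last m)) (t.relabel (Sum.map id Fin.castSucc)) ⊓ φ))

mutual
  /-- `Σ_k` formulas (cumulatively: every `Π_k` formula is `Σ_{k+1}`). -/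
  inductive IsSigmaFml : ℕ → ∀ {m : ℕ}, LA.BoundedFormula Empty m → Prop
    | ofDelta0 {m : ℕ} {φ : LA.BoundedFormula Empty m} : IsDelta0 φ → IsSigmaFml 0 φ
    | ofPi {k : ℕ} {m : ℕ} {φ : LA.BoundedFormula Empty m} :
        IsPiFml k φ → IsSigmaFml (k + 1) φ
    | ex {k : ℕ} {m : ℕ} {φ : LA.BoundedFormula Empty (m + 1)} :
        IsSigmaFml (k + 1) φ → IsSigmaFml (k + 1) (∃' φ)
  /-- `Π_k` formulas (cumulatively: every `Σ_k` formula is `Π_{k+1}`). -/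
  inductive IsPiFml : ℕ → ∀ {m : ℕ}, LA.BoundedFormula Empty m → Prop
    | ofDelta0 {m : ℕ} {φ : LA.BoundedFormula Empty m} : IsDelta0 φ → IsPiFml 0 φ
    | ofSigma {k : ℕ} {m : ℕ} {φ : LA.BoundedFormula Empty m} :
        IsSigmaFml k φ → IsPiFml (k + 1) φ
    | all {k : ℕ} {m : ℕ} {φ : LA.BoundedFormula Empty (m + 1)} :
        IsPiFml (k + 1) φ → IsPiFml (k + 1) (∀' φ)
end

/-- The set of `Σ_k` sentences. -/
def SigmaS (k : ℕ) : Set Snt := {φ | IsSigmaFml k φ}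

/-- The set of `Π_k` sentences. -/
def PiS (k : ℕ) : Set Snt := {φ | IsPiFml k φ}

/-- The set of `Σ_k ∧ Π_k` sentences, i.e. sentences of the form `σ ∧ π` with
`σ` a `Σ_k` sentence and `π` a `Π_k` sentence. -/
def SigAndPiS (k : ℕ) : Set Snt :=
  {φ | ∃ σ ∈ SigmaS k, ∃ π ∈ PiS k, φ = σ ⊓ π}

/-- `B(Σ_k)` sentences: Boolean combinations of `Σ_k` sentences. -/
inductive IsBoolSigma (k : ℕ) : Snt → Prop
  | base {φ : Snt} : φ ∈ SigmaS k → IsBoolSigma k φ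
  | not {φ : Snt} : IsBoolSigma k φ → IsBoolSigma k (∼φ)
  | imp {φ ψ : Snt} : IsBoolSigma k φ → IsBoolSigma k ψ → IsBoolSigma k (φ ⟹ ψ)
  | inf {φ ψ : Snt} : IsBoolSigma k φ → IsBoolSigma k ψ → IsBoolSigma k (φ ⊓ ψ)
  | sup {φ ψ : Snt} : IsBoolSigma k φ → IsBoolSigma k ψ → IsBoolSigma k (φ ⊔ ψ)

/-- The set of `B(Σ_k)` sentences. -/
def BSigmaS (k : ℕ) : Set Snt := {φ | IsBoolSigma k φ}

/-- The set of `Γ` sentences provable in `T`, `Th_Γ(T)`. -/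
def ThIn (Γ : Set Snt) (T : Thy) : Set Snt := Γ ∩ Th T

instance (i : ℕ) : Encodable (LA.Functions i) :=
  match i with
  | 0 => inferInstanceAs (Encodable Unit)
  | 1 => inferInstanceAs (Encodable Unit)
  | 2 => inferInstanceAs (Encodable Bool)
  | (_ + 3) => inferInstanceAs (Encodable Empty)

instance (i : ℕ) : Encodable (LA.Relations i) :=
  match i with
  | 0 => inferInstanceAs (Encodable Empty)
  | 1 => inferInstanceAs (Encodable Empty)
  | 2 => inferInstanceAs (Encodable Unit)
  | (_ + 3) => inferInstanceAs (Encodable Empty)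

/-- A Gödel numbering of sentences, via Mathlib's encoding of bounded formulas. -/
def gnum (φ : Snt) : ℕ :=
  Encodable.encode
    (show List ((Σ k, LA.Term (Empty ⊕ Fin k)) ⊕ ((Σ n, LA.Relations n) ⊕ ℕ)) from
      BoundedFormula.encoding.encode (⟨0, φ⟩ : Σ n, LA.BoundedFormula Empty n))

/-- The (axiom set of the) theory `T` is computable. -/
def CompThy (T : Thy) : Prop :=
  ComputablePred (fun m : ℕ => ∃ φ ∈ T, gnum φ = m)

/-- `T` is a computable consistent extension of `PA`. -/
def GoodThy (T : Thy) : Prop := CompThy T ∧ Con T ∧ ExtPA T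

/-- `φ` is `Γ`-conservative over `T` for a class of sentences `Γ`:
every `Γ` sentence provable in `T + φ` is provable in `T`. -/
def ConsIn (Γ : Set Snt) (T : Thy) (φ : Snt) : Prop :=
  ∀ γ ∈ Γ, Prv (add T φ) γ → Prv T γ

/-- `φ` is hereditarily `Γ`-conservative over `T`: `Γ`-conservative over every
subtheory of `T` (containing `PA`). -/
def HConsIn (Γ : Set Snt) (T : Thy) (φ : Snt) : Prop :=
  ∀ V : Thy, SubThy V T → ConsIn Γ V φ

/-- `φ` is `Σ_k↓Π_k`-conservative over `V`. -/
def SPCons (k : ℕ) (V : Thy) (φ : Snt) : Prop :=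
  ∀ σ ∈ SigmaS k, ∀ π ∈ PiS k, Prv (add V φ) (σ ⊓ π) → Prv V (σ ⊔ π)

/-- `φ` is hereditarily `Σ_k↓Π_k`-conservative over `T`. -/
def HSPCons (k : ℕ) (T : Thy) (φ : Snt) : Prop :=
  ∀ V : Thy, SubThy V T → SPCons k V φ

/-- The theory `S` is `Σ_k↓Π_k`-conservative over `PA`. -/
def ThySPConsPA (k : ℕ) (S : Thy) : Prop :=
  ∀ σ ∈ SigmaS k, ∀ π ∈ PiS k, Prv S (σ ⊓ π) → Prv PAAx (σ ⊔ π)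

/-- `δ` is a `Δ_k(S)` sentence: `S`-provably equivalent to both a `Σ_k` sentence
and a `Π_k` sentence. -/
def IsDeltaIn (k : ℕ) (S : Thy) (δ : Snt) : Prop :=
  (∃ σ ∈ SigmaS k, Prv S (δ ⇔ σ)) ∧ ∃ π ∈ PiS k, Prv S (δ ⇔ π)

/-- `φ` is `Δ_k(S)`-conservative over `V`. -/
def DeltaConsRel (k : ℕ) (S V : Thy) (φ : Snt) : Prop :=
  ∀ δ : Snt, IsDeltaIn k S δ → Prv (add V φ) δ → Prv V δ

/-- `φ` is `Δ_k`-conservative over `T`, i.e. `Δ_k(Th(T))`-conservative over `T`. -/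
def DeltaCons (k : ℕ) (T : Thy) (φ : Snt) : Prop := DeltaConsRel k (Th T) T φ

/-- `φ` is hereditarily `Δ_k`-conservative over `T`. -/
def HDeltaCons (k : ℕ) (T : Thy) (φ : Snt) : Prop :=
  ∀ V : Thy, SubThy V T → DeltaConsRel k (Th V) V φ

/-- `φ` is doubly `Π_k`-conservative over `T`: `φ` is `Π_k`-conservative and `¬φ` is
`Σ_k`-conservative over `T`. -/
def DCons (k : ℕ) (T : Thy) (φ : Snt) : Prop :=
  ConsIn (PiS k) T φ ∧ ConsIn (SigmaS k) T (∼φ)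

/-- `φ` is hereditarily doubly `Π_k`-conservative over `T`. -/
def HDCons (k : ℕ) (T : Thy) (φ : Snt) : Prop :=
  ∀ V : Thy, SubThy V T → DCons k V φ

/-- `(T,U)` is a `B_n`-pair. -/
def Bpair (n : ℕ) (T U : Thy) : Prop :=
  (¬ ThIn (PiS n) T ⊆ Th U ∨ Con (T ∪ ThIn (PiS n) U)) ∧
  (¬ ThIn (PiS n) U ⊆ Th T ∨ Con (U ∪ ThIn (PiS n) T))

/-- `(T,U)` is a `C_n`-pair. -/
def Cpair (n : ℕ) (T U : Thy) : Prop :=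
  Con (T ∪ ThIn (PiS n) U) ∧ Con (U ∪ ThIn (PiS n) T)

/-- `(T,U)` is a `C⁻_n`-pair. -/
def Cmpair (n : ℕ) (T U : Thy) : Prop :=
  Con (T ∪ ThIn (PiS n) U) ∨ Con (U ∪ ThIn (PiS n) T)

/-- `(T,U)` is a `C^∧_n`-pair. -/
def Capair (n : ℕ) (T U : Thy) : Prop :=
  Con (T ∪ ThIn (SigAndPiS n) U) ∧ Con (U ∪ ThIn (SigAndPiS n) T)

/-- `(T,U)` is a `C^B_n`-pair. -/
def CBpair (n : ℕ) (T U : Thy) : Prop :=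
  Con (T ∪ ThIn (BSigmaS n) U)

set_option linter.all false

/-! ### Part A: models of PA -/

/-- A bundled model of PA. -/
structure PAM where
  carrier : Type
  str : LA.Structure carrier
  mod : carrier ⊨ PAAx

instance : CoeSort PAM Type := ⟨PAM.carrier⟩
instance (M : PAM) : LA.Structure M := M.str

section ops
variable (M : PAM)
instance : Zero M := ⟨Structure.funMap (L := LA) (n := 0) Unit.unit ![]⟩
/-- successor -/
def sc {M : PAM} (x : M) : M := Structure.funMap (L := LA) (n := 1) Unit.unit ![x]
instance : Add M := ⟨fun x y => Structure.funMap (L := LA) (n := 2) false ![x, y]⟩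
instance : Mul M := ⟨fun x y => Structure.funMap (L := LA) (n := 2) true ![x, y]⟩
instance : LE M := ⟨fun x y => Structure.RelMap (L := LA) (n := 2) Unit.unit ![x, y]⟩
instance : One M := ⟨sc 0⟩
end ops

section realize
variable {M : PAM} {α : Type} {m : ℕ}
@[simp] theorem realize_zeroT (v : α ⊕ Fin m → M) :
    (zeroT : LA.Term (α ⊕ Fin m)).realize v = 0 := by
  simp only [zeroT, Constants.term, Term.realize]
  show Structure.funMap _ _ = Structure.funMap _ _
  congr 1; exact Subsingleton.elim _ _
@[simp] theorem realize_succT (v : α ⊕ Fin m → M) (t : LA.Term (α ⊕ Fin m)) :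
    (succT t).realize v = sc (t.realize v) := Term.realize_functions_apply₁
@[simp] theorem realize_addT (v : α ⊕ Fin m → M) (t u : LA.Term (α ⊕ Fin m)) :
    (addT t u).realize v = t.realize v + u.realize v := Term.realize_functions_apply₂
@[simp] theorem realize_mulT (v : α ⊕ Fin m → M) (t u : LA.Term (α ⊕ Fin m)) :
    (mulT t u).realize v = t.realize v * u.realize v := Term.realize_functions_apply₂
@[simp] theorem realize_leF (v : α → M) (xs : Fin m → M) (t u : LA.Term (α ⊕ Fin m)) :
    (leF t u).Realize v xs ↔ t.realize (Sum.elim v xs) ≤ u.realize (Sum.elim v xs) :=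
  BoundedFormula.realize_rel₂
@[simp] theorem realize_vT (v : Empty → M) (xs : Fin m → M) (i : Fin m) :
    (vT i).realize (Sum.elim v xs) = xs i := rfl
end realize

/-- Realization of a formula, with the newest variable first. -/
def Rz {m : ℕ} (φ : LA.BoundedFormula Empty m) (M : PAM) (v : Fin m → M) : Prop :=
  φ.Realize (default : Empty → M) (fun i => v i.rev)
/-- Realization of a term, with the newest variable first. -/
def Tz {m : ℕ} (t : LA.Term (Empty ⊕ Fin m)) (M : PAM) (v : Fin m → M) : M :=
  t.realize (Sum.elim (default : Empty → M) (fun i => v i.rev))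

theorem snoc_rev {A : Type} {m : ℕ} (v : Fin m → A) (x : A) :
    (Fin.snoc (fun i => v i.rev) x : Fin (m+1) → A) = fun i => (Fin.cons x v : Fin (m+1) → A) i.rev := by
  funext i
  refine Fin.lastCases ?_ (fun j => ?_) i
  · simp
  · simp [Fin.rev_castSucc]

theorem Rz_all {m : ℕ} (φ : LA.BoundedFormula Empty (m+1)) (M : PAM) (v : Fin m → M) :
    Rz (∀' φ) M v ↔ ∀ x, Rz φ M (Fin.cons x v) := by
  simp [Rz, BoundedFormula.realize_all, snoc_rev]
theorem Rz_ex {m : ℕ} (φ : LA.BoundedFormula Empty (m+1)) (M : PAM) (v : Fin m → M) :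
    Rz (∃' φ) M v ↔ ∃ x, Rz φ M (Fin.cons x v) := by
  simp [Rz, BoundedFormula.realize_ex, snoc_rev]
theorem Rz_imp {m : ℕ} (φ ψ : LA.BoundedFormula Empty m) (M : PAM) (v : Fin m → M) :
    Rz (φ ⟹ ψ) M v ↔ (Rz φ M v → Rz ψ M v) := by
  simp [Rz]
theorem Rz_inf {m : ℕ} (φ ψ : LA.BoundedFormula Empty m) (M : PAM) (v : Fin m → M) :
    Rz (φ ⊓ ψ) M v ↔ (Rz φ M v ∧ Rz ψ M v) := by
  simp [Rz]
theorem Rz_not {m : ℕ} (φ : LA.BoundedFormula Empty m) (M : PAM) (v : Fin m → M) :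
    Rz (∼φ) M v ↔ ¬ Rz φ M v := by
  simp [Rz]
theorem Rz_bot {m : ℕ} (M : PAM) (v : Fin m → M) :
    Rz (⊥ : LA.BoundedFormula Empty m) M v ↔ False := by
  simp [Rz]
theorem Rz_eq {m : ℕ} (t u : LA.Term (Empty ⊕ Fin m)) (M : PAM) (v : Fin m → M) :
    Rz (t =' u) M v ↔ Tz t M v = Tz u M v := by
  simp [Rz, Tz]
theorem Rz_le {m : ℕ} (t u : LA.Term (Empty ⊕ Fin m)) (M : PAM) (v : Fin m → M) :
    Rz (leF t u) M v ↔ Tz t M v ≤ Tz u M v := by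
  simp [Rz, Tz]
theorem Tz_var {m : ℕ} (j : Fin m) (M : PAM) (v : Fin m → M) : Tz (vT j) M v = v j.rev := rfl
theorem Tz_last {m : ℕ} (M : PAM) (v : Fin m → M) (x : M) :
    Tz (vT (Fin.last m)) M (Fin.cons x v : Fin (m+1) → M) = x := by
  simp [Tz]
theorem Tz_lift {m : ℕ} (t : LA.Term (Empty ⊕ Fin m)) (M : PAM) (v : Fin m → M) (x : M) :
    Tz (t.relabel (Sum.map id Fin.castSucc)) M (Fin.cons x v : Fin (m+1) → M) = Tz t M v := by
  simp only [Tz, Term.realize_relabel]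
  congr 1
  funext i
  rcases i with i | i
  · exact i.elim
  · simp [Fin.rev_castSucc]

theorem PAM.ax (M : PAM) {φ : Snt} (h : φ ∈ PAAx) : M ⊨ φ := by
  have := M.mod
  exact this.realize_of_mem φ h

theorem Rz_sentence (φ : Snt) (M : PAM) (v : Fin 0 → M) : Rz φ M v ↔ M ⊨ φ := by
  unfold Rz Sentence.Realize Formula.Realize
  rw [show (fun i : Fin 0 => v i.rev) = default from Subsingleton.elim _ _]

theorem sc_ne_zero {M : PAM} (x : M) : sc x ≠ 0 := by
  have := M.ax (φ := ∀' ∼(succT (vT 0) =' zeroT)) (by simp [PAAx])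
  simp [Sentence.Realize, Formula.Realize, BoundedFormula.realize_all, Fin.snoc] at this
  exact this x
theorem sc_inj {M : PAM} {x y : M} (h : sc x = sc y) : x = y := by
  have := M.ax (φ := ∀' ∀' ((succT (vT 0) =' succT (vT 1)) ⟹ (vT 0 =' vT 1))) (by simp [PAAx])
  simp [Sentence.Realize, Formula.Realize, BoundedFormula.realize_all, Fin.snoc] at this
  exact this x y h
theorem add_zero' {M : PAM} (x : M) : x + 0 = x := by
  have := M.ax (φ := ∀' (addT (vT 0) zeroT =' vT 0)) (by simp [PAAx])
  simp [Sentence.Realize, Formula.Realize, BoundedFormula.realize_all, Fin.snoc] at this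
  exact this x
theorem add_sc {M : PAM} (x y : M) : x + sc y = sc (x + y) := by
  have := M.ax (φ := ∀' ∀' (addT (vT 0) (succT (vT 1)) =' succT (addT (vT 0) (vT 1)))) (by simp [PAAx])
  simp [Sentence.Realize, Formula.Realize, BoundedFormula.realize_all, Fin.snoc] at this
  exact this x y
theorem mul_zero' {M : PAM} (x : M) : x * 0 = 0 := by
  have := M.ax (φ := ∀' (mulT (vT 0) zeroT =' zeroT)) (by simp [PAAx])
  simp [Sentence.Realize, Formula.Realize, BoundedFormula.realize_all, Fin.snoc] at this
  exact this x
theorem mul_sc {M : PAM} (x y : M) : x * sc y = x * y + x := by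
  have := M.ax (φ := ∀' ∀' (mulT (vT 0) (succT (vT 1)) =' addT (mulT (vT 0) (vT 1)) (vT 0))) (by simp [PAAx])
  simp [Sentence.Realize, Formula.Realize, BoundedFormula.realize_all, Fin.snoc] at this
  exact this x y
theorem le_iff' {M : PAM} (x y : M) : x ≤ y ↔ ∃ z, z + x = y := by
  have := M.ax (φ := ∀' ∀' (leF (vT 0) (vT 1) ⇔ ∃' (addT (vT 2) (vT 0) =' vT 1))) (by simp [PAAx])
  simp [Sentence.Realize, Formula.Realize, BoundedFormula.realize_all, BoundedFormula.realize_ex, Fin.snoc] at this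
  exact this x y

theorem ind_fml {m : ℕ} (φ : LA.BoundedFormula Empty (m+1)) (M : PAM) (v : Fin m → M)
    (h0 : Rz φ M (Fin.cons 0 v)) (hs : ∀ x, Rz φ M (Fin.cons x v) → Rz φ M (Fin.cons (sc x) v))
    (x : M) : Rz φ M (Fin.cons x v) := by
  have := M.ax (φ := indAxiom φ) (Or.inr ⟨m, φ, rfl⟩)
  rw [indAxiom] at this
  simp only [Sentence.Realize, BoundedFormula.realize_alls] at this
  have h := this (fun i => v i.rev)
  simp only [BoundedFormula.realize_imp, BoundedFormula.realize_inf, BoundedFormula.realize_all,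
    BoundedFormula.realize_bdEqual] at h
  have e : ∀ x, φ.Realize default (Fin.snoc (fun i => v i.rev) x : Fin (m+1) → M) ↔ Rz φ M (Fin.cons x v) := by
    intro x; rw [Rz, snoc_rev]
  have h' := h ⟨?_, ?_⟩ x
  · exact (e x).1 h'
  · intro a ha
    simp at ha
    subst ha
    exact (e _).2 h0
  · intro a ha b hb
    rw [BoundedFormula.realize_liftAt (by omega)]
    simp [-Function.comp_apply] at hb
    subst hb
    have := (e _).2 (hs a ((e a).1 ha))
    convert this using 1
    funext i
    refine Fin.lastCases ?_ (fun j => ?_) i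
    · simp
    · simp
      rw [show (Fin.castAdd 1 (Fin.castSucc j)) = Fin.castSucc (Fin.castSucc j) from rfl]
      simp only [Fin.snoc_castSucc]

/-- Uniform relations over all PA models. -/
abbrev Rel (m : ℕ) := ∀ M : PAM, (Fin m → M) → Prop
/-- Uniform functions over all PA models. -/
abbrev Fnc (m : ℕ) := ∀ M : PAM, (Fin m → M) → M

/-- `t` is given by a term. -/
class TD {m : ℕ} (t : Fnc m) : Prop where
  out : ∃ τ : LA.Term (Empty ⊕ Fin m), ∀ M v, Tz τ M v = t M v
/-- `R` is given by a bounded formula. -/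
class D0 {m : ℕ} (R : Rel m) : Prop where
  out : ∃ φ : LA.BoundedFormula Empty m, IsDelta0 φ ∧ ∀ M v, Rz φ M v ↔ R M v
/-- `R` is given by a formula. -/
class Df {m : ℕ} (R : Rel m) : Prop where
  out : ∃ φ : LA.BoundedFormula Empty m, ∀ M v, Rz φ M v ↔ R M v

instance TD.var {m : ℕ} (j : Fin m) : TD (fun M v => v j) :=
  ⟨vT j.rev, fun M v => by simp [Tz_var]⟩
instance TD.zero {m : ℕ} : TD (m := m) (fun M v => 0) := ⟨zeroT, fun M v => by simp [Tz]⟩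
instance TD.sc {m : ℕ} (t : Fnc m) [h : TD t] : TD (fun M v => sc (t M v)) := by
  obtain ⟨τ, h⟩ := h
  exact ⟨succT τ, fun M v => by rw [← h]; simp [Tz]⟩
instance TD.one {m : ℕ} : TD (m := m) (fun M v => 1) := TD.sc _
instance TD.add {m : ℕ} (t u : Fnc m) [h : TD t] [h' : TD u] : TD (fun M v => t M v + u M v) := by
  obtain ⟨τ, h⟩ := h
  obtain ⟨τ', h'⟩ := h'
  exact ⟨addT τ τ', fun M v => by rw [← h, ← h']; simp [Tz]⟩
instance TD.mul {m : ℕ} (t u : Fnc m) [h : TD t] [h' : TD u] : TD (fun M v => t M v * u M v) := by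
  obtain ⟨τ, h⟩ := h
  obtain ⟨τ', h'⟩ := h'
  exact ⟨mulT τ τ', fun M v => by rw [← h, ← h']; simp [Tz]⟩

theorem Tz_subst {m m' : ℕ} (τ : LA.Term (Empty ⊕ Fin m)) (ts : Fin m → LA.Term (Empty ⊕ Fin m'))
    (M : PAM) (v : Fin m' → M) :
    Tz (τ.subst (Sum.elim (fun e => e.elim) (fun i => ts i.rev))) M v = Tz τ M (fun i => Tz (ts i) M v) := by
  simp only [Tz, Term.realize_subst]
  congr 1
  funext i
  rcases i with i | i
  · exact i.elim
  · rfl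

theorem TD.subst {m m' : ℕ} (t : Fnc m) [h : TD t] (ts : Fin m → Fnc m') (hs : ∀ i, TD (ts i)) :
    TD (fun M v => t M (fun i => ts i M v)) := by
  obtain ⟨τ, h⟩ := h
  choose τs hs using fun i => (hs i).out
  exact ⟨_, fun M v => by rw [Tz_subst τ τs, h]; simp only [hs]⟩

instance TD.weak {m m' : ℕ} (t : Fnc m) [h : TD t] (ρ : Fin m → Fin m') :
    TD (fun M v => t M (fun i => v (ρ i))) :=
  TD.subst t (fun i M v => v (ρ i)) (fun i => inferInstance)

/-- substitution into bounded formulas -/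
theorem delta0_subst {m : ℕ} {φ : LA.BoundedFormula Empty m} (hφ : IsDelta0 φ) :
    ∀ {m' : ℕ} (ts : Fin m → LA.Term (Empty ⊕ Fin m')),
    ∃ ψ : LA.BoundedFormula Empty m', IsDelta0 ψ ∧ ∀ M v, Rz ψ M v ↔ Rz φ M (fun i => Tz (ts i) M v) := by
  have key : ∀ {m m' : ℕ} (ts : Fin m → LA.Term (Empty ⊕ Fin m')) (M : PAM) (v : Fin m' → M) (x : M),
      (fun i => Tz ((Fin.cons (vT (Fin.last m')) (fun i => (ts i).relabel (Sum.map id Fin.castSucc)) :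
        Fin (m+1) → LA.Term (Empty ⊕ Fin (m'+1))) i) M (Fin.cons x v : Fin (m'+1) → M))
      = (Fin.cons x (fun i => Tz (ts i) M v) : Fin (m+1) → M) := by
    intro m m' ts M v x
    funext i
    refine Fin.cases ?_ (fun j => ?_) i
    · simp [Tz_last]
    · simp [Tz_lift]
  induction hφ with
  | falsum => intro m' ts; exact ⟨⊥, .falsum, fun M v => by simp [Rz_bot]⟩
  | equal t u => intro m' ts; exact ⟨_, .equal (t.subst (Sum.elim (fun e => e.elim) (fun i => ts i.rev))) (u.subst (Sum.elim (fun e => e.elim) (fun i => ts i.rev))), fun M v => by rw [Rz_eq, Rz_eq, Tz_subst _ ts, Tz_subst _ ts]⟩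
  | le t u => intro m' ts; exact ⟨_, .le (t.subst (Sum.elim (fun e => e.elim) (fun i => ts i.rev))) (u.subst (Sum.elim (fun e => e.elim) (fun i => ts i.rev))), fun M v => by rw [Rz_le, Rz_le, Tz_subst _ ts, Tz_subst _ ts]⟩
  | imp _ _ ih1 ih2 =>
    intro m' ts
    obtain ⟨a, ha, ha'⟩ := ih1 ts
    obtain ⟨b, hb, hb'⟩ := ih2 ts
    exact ⟨_, .imp ha hb, fun M v => by rw [Rz_imp, Rz_imp, ha', hb']⟩
  | ball t _ ih =>
    intro m' ts
    obtain ⟨a, ha, ha'⟩ := ih (Fin.cons (vT (Fin.last m')) (fun i => (ts i).relabel (Sum.map id Fin.castSucc)))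
    refine ⟨_, .ball (t.subst (Sum.elim (fun e => e.elim) (fun i => ts i.rev))) ha, fun M v => ?_⟩
    simp only [Rz_all, Rz_imp, Rz_le, Tz_last, Tz_lift, Tz_subst _ ts, ha', key]
  | bex t _ ih =>
    intro m' ts
    obtain ⟨a, ha, ha'⟩ := ih (Fin.cons (vT (Fin.last m')) (fun i => (ts i).relabel (Sum.map id Fin.castSucc)))
    refine ⟨_, .bex (t.subst (Sum.elim (fun e => e.elim) (fun i => ts i.rev))) ha, fun M v => ?_⟩
    simp only [Rz_ex, Rz_inf, Rz_le, Tz_last, Tz_lift, Tz_subst _ ts, ha', key]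

/-- substitution into formulas: only via graph -/
theorem Df.subst {m : ℕ} (R : Rel m) [h : Df R] {m' : ℕ} (ts : Fin m → Fnc m') (hs : ∀ i, TD (ts i)) :
    Df (fun M v => R M (fun i => ts i M v)) := by
  obtain ⟨φ, h⟩ := h
  choose τs hs using fun i => (hs i).out
  -- substitute using `Formula` substitution on free variables
  refine ⟨((φ.toFormula.subst (Sum.elim (fun e => e.elim) (fun i => τs i.rev))).relabel (n := m') id), fun M v => ?_⟩
  rw [← h]
  unfold Rz
  have hx : ∀ (w : Empty ⊕ Fin m → M) (xs : Fin 0 → M),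
      BoundedFormula.Realize φ.toFormula w xs ↔ φ.toFormula.Realize w := by
    intro w xs
    rw [Subsingleton.elim xs default]; rfl
  rw [BoundedFormula.realize_relabel, BoundedFormula.realize_subst, hx]
  rw [BoundedFormula.realize_toFormula]
  apply iff_of_eq
  congr 1
  · exact Subsingleton.elim _ _
  · funext i
    simp only [Function.comp, Sum.elim_inr]
    rw [← hs]
    unfold Tz
    congr 1

theorem D0.subst {m : ℕ} (R : Rel m) [h : D0 R] {m' : ℕ} (ts : Fin m → Fnc m') (hs : ∀ i, TD (ts i)) :
    D0 (fun M v => R M (fun i => ts i M v)) := by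
  obtain ⟨φ, h0, h⟩ := h
  choose τs hs using fun i => (hs i).out
  obtain ⟨ψ, h1, h2⟩ := delta0_subst h0 τs
  exact ⟨ψ, h1, fun M v => by rw [h2, h]; simp only [hs]⟩

instance D0.weak {m m' : ℕ} (R : Rel m) [h : D0 R] (ρ : Fin m → Fin m') :
    D0 (fun M v => R M (fun i => v (ρ i))) :=
  D0.subst R (fun i M v => v (ρ i)) (fun i => inferInstance)
instance Df.weak {m m' : ℕ} (R : Rel m) [h : Df R] (ρ : Fin m → Fin m') :
    Df (fun M v => R M (fun i => v (ρ i))) :=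
  Df.subst R (fun i M v => v (ρ i)) (fun i => inferInstance)

theorem D0.congr {m : ℕ} {R S : Rel m} (h : D0 R) (e : ∀ M v, R M v ↔ S M v) : D0 S := by
  obtain ⟨φ, h0, h⟩ := h
  exact ⟨φ, h0, fun M v => (h M v).trans (e M v)⟩
theorem Df.congr {m : ℕ} {R S : Rel m} (h : Df R) (e : ∀ M v, R M v ↔ S M v) : Df S := by
  obtain ⟨φ, h⟩ := h
  exact ⟨φ, fun M v => (h M v).trans (e M v)⟩

instance (priority := low) Df.ofD0 {m : ℕ} (R : Rel m) [h : D0 R] : Df R := by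
  obtain ⟨φ, h0, h⟩ := h
  exact ⟨φ, h⟩

instance D0.false {m : ℕ} : D0 (m := m) (fun M v => False) := ⟨⊥, .falsum, fun M v => Rz_bot M v⟩
instance D0.eq {m : ℕ} (t u : Fnc m) [h : TD t] [h' : TD u] : D0 (fun M v => t M v = u M v) := by
  obtain ⟨τ, h⟩ := h
  obtain ⟨τ', h'⟩ := h'
  exact ⟨_, .equal τ τ', fun M v => by rw [Rz_eq, h, h']⟩
instance D0.le {m : ℕ} (t u : Fnc m) [h : TD t] [h' : TD u] : D0 (fun M v => t M v ≤ u M v) := by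
  obtain ⟨τ, h⟩ := h
  obtain ⟨τ', h'⟩ := h'
  exact ⟨_, .le τ τ', fun M v => by rw [Rz_le, h, h']⟩
instance D0.imp {m : ℕ} (P Q : Rel m) [h : D0 P] [h' : D0 Q] : D0 (fun M v => P M v → Q M v) := by
  obtain ⟨τ, h0, h⟩ := h
  obtain ⟨τ', h0', h'⟩ := h'
  exact ⟨_, .imp h0 h0', fun M v => by rw [Rz_imp, h, h']⟩
instance D0.not {m : ℕ} (P : Rel m) [h : D0 P] : D0 (fun M v => ¬ P M v) := D0.imp P _
instance D0.or {m : ℕ} (P Q : Rel m) [h : D0 P] [h' : D0 Q] : D0 (fun M v => P M v ∨ Q M v) :=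
  D0.congr (D0.imp (fun M v => ¬ P M v) Q) (fun M v => by tauto)
instance D0.and {m : ℕ} (P Q : Rel m) [h : D0 P] [h' : D0 Q] : D0 (fun M v => P M v ∧ Q M v) :=
  D0.congr (D0.not (fun M v => P M v → ¬ Q M v)) (fun M v => by tauto)
instance D0.iff {m : ℕ} (P Q : Rel m) [h : D0 P] [h' : D0 Q] : D0 (fun M v => P M v ↔ Q M v) :=
  D0.congr (D0.and (fun M v => P M v → Q M v) (fun M v => Q M v → P M v)) (fun M v => by tauto)
instance D0.ne {m : ℕ} (t u : Fnc m) [h : TD t] [h' : TD u] : D0 (fun M v => t M v ≠ u M v) :=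
  D0.not (fun M v => t M v = u M v)
instance D0.bex {m : ℕ} (t : Fnc m) [h : TD t] (P : ∀ M : PAM, (Fin m → M) → M → Prop)
    [h' : D0 (fun M (w : Fin (m+1) → M) => P M (fun i => w i.succ) (w 0))] :
    D0 (fun M v => ∃ x, x ≤ t M v ∧ P M v x) := by
  obtain ⟨τ, h⟩ := h
  obtain ⟨φ, h0, h'⟩ := h'
  exact ⟨_, .bex τ h0, fun M v => by
    simp only [Rz_ex, Rz_inf, Rz_le, Tz_last, Tz_lift, h', h, Fin.cons_succ, Fin.cons_zero]⟩
instance D0.ball {m : ℕ} (t : Fnc m) [h : TD t] (P : ∀ M : PAM, (Fin m → M) → M → Prop)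
    [h' : D0 (fun M (w : Fin (m+1) → M) => P M (fun i => w i.succ) (w 0))] :
    D0 (fun M v => ∀ x, x ≤ t M v → P M v x) := by
  obtain ⟨τ, h⟩ := h
  obtain ⟨φ, h0, h'⟩ := h'
  exact ⟨_, .ball τ h0, fun M v => by
    simp only [Rz_all, Rz_imp, Rz_le, Tz_last, Tz_lift, h', h, Fin.cons_succ, Fin.cons_zero]⟩

instance Df.imp {m : ℕ} (P Q : Rel m) [h : Df P] [h' : Df Q] : Df (fun M v => P M v → Q M v) := by
  obtain ⟨τ, h⟩ := h
  obtain ⟨τ', h'⟩ := h'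
  exact ⟨τ ⟹ τ', fun M v => by rw [Rz_imp, h, h']⟩
instance Df.not {m : ℕ} (P : Rel m) [h : Df P] : Df (fun M v => ¬ P M v) := Df.imp P (fun M v => False)
instance Df.or {m : ℕ} (P Q : Rel m) [h : Df P] [h' : Df Q] : Df (fun M v => P M v ∨ Q M v) :=
  Df.congr (Df.imp (fun M v => ¬ P M v) Q) (fun M v => by tauto)
instance Df.and {m : ℕ} (P Q : Rel m) [h : Df P] [h' : Df Q] : Df (fun M v => P M v ∧ Q M v) :=
  Df.congr (Df.not (fun M v => P M v → ¬ Q M v)) (fun M v => by tauto)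
instance Df.iff {m : ℕ} (P Q : Rel m) [h : Df P] [h' : Df Q] : Df (fun M v => P M v ↔ Q M v) :=
  Df.congr (Df.and (fun M v => P M v → Q M v) (fun M v => Q M v → P M v)) (fun M v => by tauto)
instance Df.all {m : ℕ} (P : ∀ M : PAM, (Fin m → M) → M → Prop)
    [h' : Df (fun M (w : Fin (m+1) → M) => P M (fun i => w i.succ) (w 0))] :
    Df (fun M v => ∀ x, P M v x) := by
  obtain ⟨φ, h'⟩ := h'
  exact ⟨∀' φ, fun M v => by simp only [Rz_all, h', Fin.cons_succ, Fin.cons_zero]⟩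
instance Df.ex {m : ℕ} (P : ∀ M : PAM, (Fin m → M) → M → Prop)
    [h' : Df (fun M (w : Fin (m+1) → M) => P M (fun i => w i.succ) (w 0))] :
    Df (fun M v => ∃ x, P M v x) := by
  obtain ⟨φ, h'⟩ := h'
  exact ⟨∃' φ, fun M v => by simp only [Rz_ex, h', Fin.cons_succ, Fin.cons_zero]⟩

theorem ind0 {m : ℕ} (R : Rel (m+1)) [h : Df R] (M : PAM) (v : Fin m → M)
    (h0 : R M (Fin.cons 0 v)) (hs : ∀ x, R M (Fin.cons x v) → R M (Fin.cons (sc x) v))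
    (x : M) : R M (Fin.cons x v) := by
  obtain ⟨φ, h⟩ := h
  simp only [← h] at *
  exact ind_fml φ M v h0 hs x

section arith
variable {M : PAM}
theorem sc_eq (x : M) : sc x = x + 1 := by
  show sc x = x + sc 0
  rw [add_sc, add_zero']
theorem zero_add' (x : M) : 0 + x = x := by
  refine ind0 (m := 0) (fun M w => 0 + w 0 = w 0) M ![] ?_ ?_ x
  · exact add_zero' _
  · intro x h
    have h : 0 + x = x := h
    show 0 + sc x = sc x
    rw [add_sc, h]
theorem sc_add (x y : M) : sc x + y = sc (x + y) := by
  refine ind0 (m := 1) (fun M w => sc (w 1) + w 0 = sc (w 1 + w 0)) M ![x] ?_ ?_ y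
  · show sc x + 0 = sc (x + 0)
    rw [add_zero', add_zero']
  · intro y h
    have h : sc x + y = sc (x + y) := h
    show sc x + sc y = sc (x + sc y)
    rw [add_sc, h, add_sc]
theorem add_comm' (x y : M) : x + y = y + x := by
  refine ind0 (m := 1) (fun M w => w 1 + w 0 = w 0 + w 1) M ![x] ?_ ?_ y
  · show x + 0 = 0 + x
    rw [add_zero', zero_add']
  · intro y h
    have h : x + y = y + x := h
    show x + sc y = sc y + x
    rw [add_sc, h, sc_add]
theorem add_assoc' (x y z : M) : x + y + z = x + (y + z) := by
  refine ind0 (m := 2) (fun M w => w 1 + w 2 + w 0 = w 1 + (w 2 + w 0)) M ![x,y] ?_ ?_ z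
  · show x + y + 0 = x + (y + 0)
    rw [add_zero', add_zero']
  · intro z h
    have h : x + y + z = x + (y + z) := h
    show x + y + sc z = x + (y + sc z)
    rw [add_sc, h, add_sc, add_sc]
theorem zero_mul' (x : M) : 0 * x = 0 := by
  refine ind0 (m := 0) (fun M w => 0 * w 0 = 0) M ![] ?_ ?_ x
  · exact mul_zero' _
  · intro x h
    have h : 0 * x = 0 := h
    show 0 * sc x = 0
    rw [mul_sc, h, add_zero']
theorem sc_mul (x y : M) : sc x * y = x * y + y := by
  refine ind0 (m := 1) (fun M w => sc (w 1) * w 0 = w 1 * w 0 + w 0) M ![x] ?_ ?_ y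
  · show sc x * 0 = x * 0 + 0
    rw [mul_zero', mul_zero', add_zero']
  · intro y h
    have h : sc x * y = x * y + y := h
    show sc x * sc y = x * sc y + sc y
    rw [mul_sc, h, mul_sc, add_sc, add_sc, add_assoc', add_comm' y x, add_assoc']
theorem mul_comm' (x y : M) : x * y = y * x := by
  refine ind0 (m := 1) (fun M w => w 1 * w 0 = w 0 * w 1) M ![x] ?_ ?_ y
  · show x * 0 = 0 * x
    rw [mul_zero', zero_mul']
  · intro y h
    have h : x * y = y * x := h
    show x * sc y = sc y * x
    rw [mul_sc, h, sc_mul]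
theorem left_distrib' (x y z : M) : x * (y + z) = x * y + x * z := by
  refine ind0 (m := 2) (fun M w => w 1 * (w 2 + w 0) = w 1 * w 2 + w 1 * w 0) M ![x,y] ?_ ?_ z
  · show x * (y + 0) = x * y + x * 0
    rw [mul_zero', add_zero', add_zero']
  · intro z h
    have h : x * (y + z) = x * y + x * z := h
    show x * (y + sc z) = x * y + x * sc z
    rw [add_sc, mul_sc, h, mul_sc, add_assoc']
theorem mul_assoc' (x y z : M) : x * y * z = x * (y * z) := by
  refine ind0 (m := 2) (fun M w => w 1 * w 2 * w 0 = w 1 * (w 2 * w 0)) M ![x,y] ?_ ?_ z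
  · show x * y * 0 = x * (y * 0)
    rw [mul_zero', mul_zero', mul_zero']
  · intro z h
    have h : x * y * z = x * (y * z) := h
    show x * y * sc z = x * (y * sc z)
    rw [mul_sc, h, mul_sc, left_distrib']
theorem mul_one' (x : M) : x * 1 = x := by
  show x * sc 0 = x
  rw [mul_sc, mul_zero', zero_add']

instance : CommSemiring M where
  add_assoc := add_assoc'
  zero_add := zero_add'
  add_zero := add_zero'
  add_comm := add_comm'
  left_distrib := left_distrib'
  right_distrib x y z := by rw [mul_comm', left_distrib', mul_comm' z, mul_comm' z]
  zero_mul := zero_mul'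
  mul_zero := mul_zero'
  mul_assoc := mul_assoc'
  one_mul x := by rw [mul_comm', mul_one']
  mul_one := mul_one'
  mul_comm := mul_comm'
  nsmul := nsmulRec

theorem add_one_ne (x : M) : x + 1 ≠ 0 := by rw [← sc_eq]; exact sc_ne_zero x
theorem add_one_inj' {x y : M} (h : x + 1 = y + 1) : x = y := by
  rw [← sc_eq, ← sc_eq] at h; exact sc_inj h

/-- Induction. -/
theorem ind {m : ℕ} (R : Rel (m+1)) [h : Df R] (v : Fin m → M)
    (h0 : R M (Fin.cons 0 v)) (hs : ∀ x, R M (Fin.cons x v) → R M (Fin.cons (x+1) v))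
    (x : M) : R M (Fin.cons x v) :=
  ind0 R M v h0 (fun x hx => by rw [sc_eq]; exact hs x hx) x

theorem zero_or_succ (x : M) : x = 0 ∨ ∃ y, x = y + 1 := by
  refine ind (m := 0) (fun M w => w 0 = 0 ∨ ∃ y, w 0 = y + 1) ![] ?_ ?_ x
  · exact Or.inl rfl
  · intro x _
    exact Or.inr ⟨x, rfl⟩
theorem add_right_cancel' {x y z : M} (h : x + z = y + z) : x = y := by
  refine ind (m := 2) (fun M w => w 1 + w 0 = w 2 + w 0 → w 1 = w 2) ![x,y] ?_ ?_ z h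
  · show x + 0 = y + 0 → x = y
    simp
  · intro z ih h
    have ih : x + z = y + z → x = y := ih
    have h : x + (z + 1) = y + (z + 1) := h
    apply ih
    rw [← add_assoc, ← add_assoc] at h
    exact add_one_inj' h
theorem add_eq_zero' {x y : M} (h : x + y = 0) : y = 0 := by
  rcases zero_or_succ y with rfl | ⟨z, rfl⟩
  · rfl
  · rw [← add_assoc] at h
    exact absurd h (add_one_ne _)
theorem le_total' (x y : M) : x ≤ y ∨ y ≤ x := by
  refine ind (m := 1) (fun M w => w 1 ≤ w 0 ∨ w 0 ≤ w 1) ![x] ?_ ?_ y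
  · show x ≤ 0 ∨ 0 ≤ x
    exact Or.inr ((le_iff' _ _).2 ⟨x, add_zero x⟩)
  · intro y ih
    have ih : x ≤ y ∨ y ≤ x := ih
    show x ≤ y + 1 ∨ y + 1 ≤ x
    simp only [le_iff'] at *
    rcases ih with ⟨z, rfl⟩ | ⟨z, rfl⟩
    · exact Or.inl ⟨z + 1, by ring⟩
    · rcases zero_or_succ z with rfl | ⟨z, rfl⟩
      · exact Or.inl ⟨1, by ring⟩
      · exact Or.inr ⟨z, by ring⟩

noncomputable instance : LinearOrder M where
  le_refl x := (le_iff' _ _).2 ⟨0, zero_add x⟩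
  le_trans x y z h1 h2 := by
    simp only [le_iff'] at *
    obtain ⟨a, rfl⟩ := h1
    obtain ⟨b, rfl⟩ := h2
    exact ⟨b + a, by ring⟩
  le_antisymm x y h1 h2 := by
    simp only [le_iff'] at *
    obtain ⟨a, rfl⟩ := h1
    obtain ⟨b, h⟩ := h2
    rw [← add_assoc] at h
    nth_rewrite 2 [← zero_add x] at h
    have := add_eq_zero' (add_right_cancel' h)
    rw [this, zero_add]
  le_total := le_total'
  toDecidableLE := Classical.decRel _
  toDecidableEq := Classical.decEq _
  toDecidableLT := Classical.decRel _

theorem zero_le' (x : M) : 0 ≤ x := (le_iff' _ _).2 ⟨x, add_zero x⟩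
theorem one_ne_zero' : (1 : M) ≠ 0 := by
  have := add_one_ne (0 : M); rwa [zero_add] at this

instance : CanonicallyOrderedAdd M where
  exists_add_of_le h := by
    obtain ⟨z, hz⟩ := (le_iff' _ _).1 h
    exact ⟨z, by rw [← hz, add_comm]⟩
  le_self_add x y := (le_iff' _ _).2 ⟨y, add_comm y x⟩
  le_add_self x y := (le_iff' _ _).2 ⟨y, rfl⟩
instance : Nontrivial M := ⟨⟨1, 0, one_ne_zero'⟩⟩
instance : IsOrderedCancelAddMonoid M where
  add_le_add_left x y h z := by
    simp only [le_iff'] at *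
    obtain ⟨a, rfl⟩ := h
    exact ⟨a, by ring⟩
  le_of_add_le_add_left x y z h := by
    simp only [le_iff'] at *
    obtain ⟨a, h⟩ := h
    refine ⟨a, add_right_cancel' (z := x) ?_⟩
    rw [add_assoc, add_comm y, h, add_comm]
theorem lt_iff_add_one_le' (x y : M) : x < y ↔ x + 1 ≤ y := by
  constructor
  · intro h
    obtain ⟨z, rfl⟩ := exists_add_of_le h.le
    rcases zero_or_succ z with rfl | ⟨z, rfl⟩
    · simp at h
    · rw [← add_assoc, add_right_comm]; exact le_self_add
  · intro h
    refine lt_of_lt_of_le ?_ h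
    refine lt_of_le_of_ne le_self_add ?_
    intro e
    nth_rewrite 1 [← add_zero x] at e
    exact one_ne_zero' (add_left_cancel e).symm
instance : IsStrictOrderedRing M where
  zero_le_one := zero_le' _
  mul_lt_mul_of_pos_left x hx y z h := by
    rw [lt_iff_add_one_le'] at h
    obtain ⟨c, rfl⟩ := exists_add_of_le h
    show x * y < x * (y + 1 + c)
    calc x * y < x * y + x := lt_add_of_pos_right _ hx
      _ ≤ x * y + x + x * c := le_self_add
      _ = _ := by ring
  mul_lt_mul_of_pos_right x hx y z h := by
    rw [lt_iff_add_one_le'] at h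
    obtain ⟨c, rfl⟩ := exists_add_of_le h
    show y * x < (y + 1 + c) * x
    calc y * x < y * x + x := lt_add_of_pos_right _ hx
      _ ≤ y * x + x + c * x := le_self_add
      _ = _ := by ring
instance : SuccAddOrder M where
  succ x := x + 1
  le_succ x := le_self_add
  max_of_succ_le {a} h := by
    exact absurd ((lt_iff_add_one_le' _ _).2 h) (lt_irrefl _)
  succ_le_of_lt h := (lt_iff_add_one_le' _ _).1 h
  succ_eq_add_one x := rfl
instance : NoZeroDivisors M := inferInstance
theorem lt_add_one_iff' (x y : M) : x < y + 1 ↔ x ≤ y := by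
  rw [lt_iff_add_one_le']; exact add_le_add_iff_right 1
end arith

instance D0.lt {m : ℕ} (t u : Fnc m) [h : TD t] [h' : TD u] : D0 (fun M v => t M v < u M v) :=
  D0.congr (D0.le (fun M v => t M v + 1) u) (fun M v => (lt_iff_add_one_le' _ _).symm)
instance TD.nat {m : ℕ} (n : ℕ) : TD (m := m) (fun M v => (n : M)) := by
  induction n with
  | zero => simpa using TD.zero
  | succ n ih => simpa using TD.add _ _
instance D0.bexlt {m : ℕ} (t : Fnc m) [h : TD t] (P : ∀ M : PAM, (Fin m → M) → M → Prop)
    [h' : D0 (fun M (w : Fin (m+1) → M) => P M (fun i => w i.succ) (w 0))] :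
    D0 (fun M v => ∃ x, x < t M v ∧ P M v x) :=
  D0.congr (R := fun M v => ∃ x, x ≤ t M v ∧ (x < t M v ∧ P M v x)) inferInstance
    (fun M v => exists_congr fun x => ⟨fun h => h.2, fun h => ⟨h.1.le, h⟩⟩)
instance D0.balllt {m : ℕ} (t : Fnc m) [h : TD t] (P : ∀ M : PAM, (Fin m → M) → M → Prop)
    [h' : D0 (fun M (w : Fin (m+1) → M) => P M (fun i => w i.succ) (w 0))] :
    D0 (fun M v => ∀ x, x < t M v → P M v x) :=
  D0.congr (R := fun M v => ∀ x, x ≤ t M v → (x < t M v → P M v x)) inferInstance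
    (fun M v => forall_congr' fun x => ⟨fun h h' => h h'.le h', fun h _ => h⟩)

section arith
variable {M : PAM}
/-- Least number principle. -/
theorem lnp {m : ℕ} (R : Rel (m+1)) [h : Df R] (v : Fin m → M) (x : M) (hx : R M (Fin.cons x v)) :
    ∃ y, R M (Fin.cons y v) ∧ ∀ z < y, ¬ R M (Fin.cons z v) := by
  by_contra hc
  push Not at hc
  have := ind (fun M (w : Fin (m+1) → M) => ∀ z, z < w 0 → ¬ R M (Fin.cons z (fun i => w i.succ))) (h := ?_) v ?_ ?_ (x+1)
  · exact this x (by simp [lt_add_one_iff']) hx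
  · have h2 : Df (fun M (w : Fin (m+2) → M) => R M (Fin.cons (w 0) (fun i => w i.succ.succ))) := by
      refine Df.congr (Df.subst R (fun i => (Fin.cons (fun M w => w 0) (fun i M w => w i.succ.succ) : Fin (m+1) → Fnc (m+2)) i) ?_) ?_
      · intro i
        refine Fin.cases ?_ (fun j => ?_) i
        · exact TD.var 0
        · exact TD.var _
      · intro M v
        apply iff_of_eq; congr 1
        funext i
        refine Fin.cases ?_ (fun j => ?_) i <;> simp
    infer_instance
  · intro z hz; exact absurd hz (not_lt.2 (zero_le' z))
  · intro y hy z hz hR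
    simp only [Fin.cons_zero, Fin.cons_succ, lt_add_one_iff'] at *
    rcases hz.lt_or_eq with h1 | rfl
    · exact hy z h1 hR
    · obtain ⟨z', h1, h2⟩ := hc z hR
      exact hy z' h1 h2
end arith

/-! ### Part B: the arithmetical hierarchy, semantically -/

theorem comp_cons' {A B : Type} {m : ℕ} (w : A → B) (a : A) (f : Fin m → A) :
    (fun i => w ((Fin.cons a f : Fin (m+1) → A) i)) = (Fin.cons (w a) (fun i => w (f i)) : Fin (m+1) → B) := by
  funext i
  refine Fin.cases ?_ (fun j => ?_) i <;> simp

theorem cons_sub_eq {m m' : ℕ} (t : Fnc m') (ts : Fin m → Fnc m') (M : PAM) (v : Fin m' → M) :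
    (fun i => (Fin.cons t ts : Fin (m+1) → Fnc m') i M v)
      = (Fin.cons (t M v) (fun i => ts i M v) : Fin (m+1) → M) := by
  funext i
  refine Fin.cases ?_ (fun j => ?_) i <;> simp

theorem cons_TD {m m' : ℕ} (t : Fnc m') (ts : Fin m → Fnc m') (h : TD t) (hs : ∀ i, TD (ts i)) (i : Fin (m+1)) :
    TD ((Fin.cons t ts : Fin (m+1) → Fnc m') i) := by
  refine Fin.cases ?_ (fun j => ?_) i
  · simpa using h
  · simpa using hs j

instance Df.sub1 {m m' : ℕ} (R : Rel (m+1)) [Df R] (t : Fnc m') [h : TD t] (ρ : Fin m → Fin m') :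
    Df (fun M v => R M (Fin.cons (t M v) (fun i => v (ρ i)))) := by
  have := Df.subst R (Fin.cons t (fun i M v => v (ρ i))) (cons_TD _ _ h (fun i => TD.var _))
  simpa only [cons_sub_eq] using this
instance Df.sub2 {m m' : ℕ} (R : Rel (m+2)) [Df R] (t u : Fnc m') [h : TD t] [h' : TD u] (ρ : Fin m → Fin m') :
    Df (fun M v => R M (Fin.cons (t M v) (Fin.cons (u M v) (fun i => v (ρ i))))) := by
  have := Df.subst R (Fin.cons t (Fin.cons u (fun i M v => v (ρ i))))
    (cons_TD _ _ h (cons_TD _ _ h' (fun i => TD.var _)))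
  simpa only [cons_sub_eq] using this

/-- Collection. -/
theorem collection {M : PAM} {m : ℕ} (Q : Rel (m+2)) [hQ : Df Q] (v : Fin m → M) (a : M)
    (h : ∀ x ≤ a, ∃ y, Q M (Fin.cons y (Fin.cons x v))) :
    ∃ w, ∀ x ≤ a, ∃ y, y ≤ w ∧ Q M (Fin.cons y (Fin.cons x v)) := by
  have := ind (fun M (z : Fin (m+1) → M) => z 0 ≤ z 0 → (∀ x, x ≤ z 0 → ∃ y, Q M (Fin.cons y (Fin.cons x (fun i => z i.succ)))) →
    ∃ w, ∀ x, x ≤ z 0 → ∃ y, y ≤ w ∧ Q M (Fin.cons y (Fin.cons x (fun i => z i.succ)))) v ?_ ?_ a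
  · simpa using this (le_refl _) (by simpa using h)
  · intro _ h
    simp only [Fin.cons_zero, Fin.cons_succ] at *
    obtain ⟨y, hy⟩ := h 0 le_rfl
    refine ⟨y, fun x hx => ?_⟩
    obtain rfl : x = 0 := le_antisymm hx (zero_le' x)
    exact ⟨y, le_rfl, hy⟩
  · intro a ih _ h
    simp only [Fin.cons_zero, Fin.cons_succ] at *
    obtain ⟨w, hw⟩ := ih le_rfl (fun x hx => h x (hx.trans le_self_add))
    obtain ⟨y, hy⟩ := h (a+1) le_rfl
    refine ⟨w + y, fun x hx => ?_⟩
    rcases hx.lt_or_eq with h1 | rfl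
    · obtain ⟨y', h1, h2⟩ := hw x ((lt_add_one_iff' _ _).1 h1)
      exact ⟨y', h1.trans le_self_add, h2⟩
    · exact ⟨y, le_add_self, hy⟩

/-- `Σ_k` relations, semantically. -/
def Sg : ℕ → ∀ {m : ℕ}, Rel m → Prop
  | 0, _, R => D0 R
  | k+1, m, R => ∃ P : Rel (m+1), Sg k P ∧ ∀ M v, R M v ↔ ∃ x, ¬ P M (Fin.cons x v)

theorem Sg.congr {k m : ℕ} {R S : Rel m} (h : Sg k R) (e : ∀ M v, R M v ↔ S M v) : Sg k S := by
  cases k with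
  | zero => exact D0.congr h e
  | succ k =>
    obtain ⟨P, h1, h2⟩ := h
    exact ⟨P, h1, fun M v => (e M v).symm.trans (h2 M v)⟩

theorem Sg.toDf {k : ℕ} : ∀ {m : ℕ} {R : Rel m}, Sg k R → Df R := by
  induction k with
  | zero => intro m R h; exact @Df.ofD0 _ _ h
  | succ k ih =>
    intro m R h
    obtain ⟨P, h1, h2⟩ := h
    have := ih h1
    exact Df.congr (R := fun M v => ∃ x, ¬ P M (Fin.cons x v)) inferInstance (fun M v => (h2 M v).symm)

theorem Sg.subst {k : ℕ} : ∀ {m : ℕ} {R : Rel m}, Sg k R → ∀ {m' : ℕ} (ts : Fin m → Fnc m'),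
    (∀ i, TD (ts i)) → Sg k (fun M v => R M (fun i => ts i M v)) := by
  induction k with
  | zero => intro m R h m' ts hs; exact @D0.subst _ _ h _ ts hs
  | succ k ih =>
    intro m R h m' ts hs
    obtain ⟨P, h1, h2⟩ := h
    refine ⟨_, ih h1 (Fin.cons (fun M w => w 0) (fun i M w => ts i M (fun j => w j.succ)))
      (cons_TD _ _ (TD.var 0) (fun i => inferInstance)), fun M v => ?_⟩
    simp only [cons_sub_eq, Fin.cons_zero, Fin.cons_succ]
    exact h2 _ _
theorem Sg.weak {k m m' : ℕ} {R : Rel m} (h : Sg k R) (ρ : Fin m → Fin m') :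
    Sg k (fun M v => R M (fun i => v (ρ i))) := Sg.subst h _ (fun i => TD.var _)
theorem Sg.sub1 {k m m' : ℕ} {R : Rel (m+1)} (hR : Sg k R) (t : Fnc m') [h : TD t] (ρ : Fin m → Fin m') :
    Sg k (fun M v => R M (Fin.cons (t M v) (fun i => v (ρ i)))) := by
  have := Sg.subst hR (Fin.cons t (fun i M v => v (ρ i))) (cons_TD _ _ h (fun i => TD.var _))
  simpa only [cons_sub_eq] using this
theorem Sg.sub2 {k m m' : ℕ} {R : Rel (m+2)} (hR : Sg k R) (t u : Fnc m') [h : TD t] [h' : TD u] (ρ : Fin m → Fin m') :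
    Sg k (fun M v => R M (Fin.cons (t M v) (Fin.cons (u M v) (fun i => v (ρ i))))) := by
  have := Sg.subst hR (Fin.cons t (Fin.cons u (fun i M v => v (ρ i))))
    (cons_TD _ _ h (cons_TD _ _ h' (fun i => TD.var _)))
  simpa only [cons_sub_eq] using this

/-- Closure package. -/
structure SgPkg (k : ℕ) : Prop where
  and : ∀ {m : ℕ} {P Q : Rel m}, Sg k P → Sg k Q → Sg k (fun M v => P M v ∧ Q M v)
  or : ∀ {m : ℕ} {P Q : Rel m}, Sg k P → Sg k Q → Sg k (fun M v => P M v ∨ Q M v)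
  ball : ∀ {m : ℕ} (t : Fnc m) [TD t] (P : Rel (m+1)), Sg k P →
    Sg k (fun M v => ∀ x, x ≤ t M v → P M (Fin.cons x v))
  bex : ∀ {m : ℕ} (t : Fnc m) [TD t] (P : Rel (m+1)), Sg k P →
    Sg k (fun M v => ∃ x, x ≤ t M v ∧ P M (Fin.cons x v))

theorem cons_eta {A : Type} {m : ℕ} (w : Fin (m+1) → A) : (Fin.cons (w 0) (fun i => w i.succ) : Fin (m+1) → A) = w :=
  Fin.cons_self_tail w

theorem sgPkg (k : ℕ) : SgPkg k := by
  induction k with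
  | zero =>
    refine ⟨fun h h' => @D0.and _ _ _ h h', fun h h' => @D0.or _ _ _ h h', ?_, ?_⟩
    · intro m t ht P hP
      have hP : D0 P := hP
      refine @D0.ball _ t ht (fun M v x => P M (Fin.cons x v)) ?_
      simpa only [cons_eta] using hP
    · intro m t ht P hP
      have hP : D0 P := hP
      refine @D0.bex _ t ht (fun M v x => P M (Fin.cons x v)) ?_
      simpa only [cons_eta] using hP
  | succ k ih =>
    refine ⟨?_, ?_, ?_, ?_⟩
    · rintro m P Q ⟨P1, h1, e1⟩ ⟨P2, h2, e2⟩
      refine ⟨fun M w => (∀ x, x ≤ w 0 → P1 M (Fin.cons x (fun i => w i.succ))) ∨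
        (∀ x, x ≤ w 0 → P2 M (Fin.cons x (fun i => w i.succ))), ?_, ?_⟩
      · have a1 := ih.ball (m := m+1) (fun M w => w 0) _ (h1.sub1 (m' := m+2) (fun M w => w 0) (fun i => i.succ.succ))
        have a2 := ih.ball (m := m+1) (fun M w => w 0) _ (h2.sub1 (m' := m+2) (fun M w => w 0) (fun i => i.succ.succ))
        exact ih.or a1 a2
      · intro M v
        simp only [e1, e2, Fin.cons_zero, Fin.cons_succ]
        constructor
        · rintro ⟨⟨x, hx⟩, y, hy⟩
          refine ⟨x + y, ?_⟩
          rintro (h | h)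
          · exact hx (h x le_self_add)
          · exact hy (h y le_add_self)
        · rintro ⟨x, hx⟩
          push Not at hx
          obtain ⟨⟨a, _, ha⟩, b, _, hb⟩ := hx
          exact ⟨⟨a, ha⟩, b, hb⟩
    · rintro m P Q ⟨P1, h1, e1⟩ ⟨P2, h2, e2⟩
      refine ⟨_, ih.and h1 h2, fun M v => ?_⟩
      simp only [e1, e2]
      constructor
      · rintro (⟨x, hx⟩ | ⟨x, hx⟩)
        · exact ⟨x, fun h => hx h.1⟩
        · exact ⟨x, fun h => hx h.2⟩
      · rintro ⟨x, hx⟩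
        by_cases h : P1 M (Fin.cons x v)
        · exact Or.inr ⟨x, fun h' => hx ⟨h, h'⟩⟩
        · exact Or.inl ⟨x, h⟩
    · rintro m t ht P ⟨P1, h1, e1⟩
      refine ⟨fun M w => ∃ x, x ≤ t M (fun i => w i.succ) ∧ ∀ y, y ≤ w 0 → P1 M (Fin.cons y (Fin.cons x (fun i => w i.succ))), ?_, ?_⟩
      · have a1 := ih.ball (m := m+2) (fun M w => w 1) _ (h1.sub2 (m' := m+3) (fun M w => w 0) (fun M w => w 1) (fun i => i.succ.succ.succ))
        exact ih.bex (m := m+1) (fun M w => t M (fun i => w i.succ)) _ a1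
      · intro M v
        simp only [e1, Fin.cons_zero, Fin.cons_succ]
        have := h1.toDf
        constructor
        · intro h
          obtain ⟨w, hw⟩ := collection (fun M v => ¬ P1 M v) v (t M v) h
          refine ⟨w, ?_⟩
          push Not
          exact hw
        · rintro ⟨w, hw⟩ x hx
          push Not at hw
          obtain ⟨y, _, hy⟩ := hw x hx
          exact ⟨y, hy⟩
    · rintro m t ht P ⟨P1, h1, e1⟩
      refine ⟨fun M w => ∀ x, x ≤ t M (fun i => w i.succ) → P1 M (Fin.cons (w 0) (Fin.cons x (fun i => w i.succ))), ?_, ?_⟩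
      · exact ih.ball (m := m+1) (fun M w => t M (fun i => w i.succ)) _
          (h1.sub2 (m' := m+2) (fun M w => w 1) (fun M w => w 0) (fun i => i.succ.succ))
      · intro M v
        simp only [e1, Fin.cons_zero, Fin.cons_succ]
        push Not
        constructor
        · rintro ⟨x, hx, y, hy⟩; exact ⟨y, x, hx, hy⟩
        · rintro ⟨y, x, hx, hy⟩; exact ⟨x, hx, y, hy⟩

theorem Sg.ex {k m : ℕ} {P : Rel (m+1)} (h : Sg (k+1) P) : Sg (k+1) (fun M v => ∃ x, P M (Fin.cons x v)) := by
  obtain ⟨P1, h1, e1⟩ := h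
  refine ⟨fun M w => ∀ x, x ≤ w 0 → ∀ y, y ≤ w 0 → P1 M (Fin.cons y (Fin.cons x (fun i => w i.succ))), ?_, ?_⟩
  · have a1 := (sgPkg k).ball (m := m+2) (fun M w => w 1) _ (h1.sub2 (m' := m+3) (fun M w => w 0) (fun M w => w 1) (fun i => i.succ.succ.succ))
    exact (sgPkg k).ball (m := m+1) (fun M w => w 0) _ a1
  · intro M v
    simp only [e1, Fin.cons_zero, Fin.cons_succ]
    push Not
    constructor
    · rintro ⟨x, y, hy⟩; exact ⟨x + y, x, le_self_add, y, le_add_self, hy⟩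
    · rintro ⟨_, x, _, y, _, hy⟩; exact ⟨x, y, hy⟩
theorem Sg.ofNeg {k m : ℕ} {R : Rel m} (h : Sg k (fun M v => ¬ R M v)) : Sg (k+1) R :=
  ⟨_, h.weak (m' := m+1) (fun i => i.succ), fun M v => by simp⟩
theorem Sg.neg {k m : ℕ} {R : Rel m} (h : Sg k R) : Sg (k+1) (fun M v => ¬ R M v) :=
  Sg.ofNeg (h.congr (fun M v => by simp))
theorem Sg.succ {k : ℕ} : ∀ {m : ℕ} {R : Rel m}, Sg k R → Sg (k+1) R := by
  induction k with
  | zero =>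
    intro m R h
    have h : D0 R := h
    exact Sg.ofNeg (k := 0) (D0.not R)
  | succ k ih =>
    rintro m R ⟨P, h1, e⟩
    exact ⟨P, ih h1, e⟩
theorem Sg.ofD0 {m : ℕ} {R : Rel m} [h : D0 R] (k : ℕ) : Sg k R := by
  induction k with
  | zero => exact h
  | succ k ih => exact ih.succ

theorem Sg.exH {k m : ℕ} {P : ∀ M : PAM, (Fin m → M) → M → Prop}
    (h : Sg (k+1) (fun M (w : Fin (m+1) → M) => P M (fun i => w i.succ) (w 0))) :
    Sg (k+1) (fun M v => ∃ x, P M v x) := by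
  simpa using Sg.ex h
theorem Sg.ballH {k m : ℕ} (t : Fnc m) [TD t] {P : ∀ M : PAM, (Fin m → M) → M → Prop}
    (h : Sg k (fun M (w : Fin (m+1) → M) => P M (fun i => w i.succ) (w 0))) :
    Sg k (fun M v => ∀ x, x ≤ t M v → P M v x) := by
  simpa using (sgPkg k).ball t _ h
theorem Sg.bexH {k m : ℕ} (t : Fnc m) [TD t] {P : ∀ M : PAM, (Fin m → M) → M → Prop}
    (h : Sg k (fun M (w : Fin (m+1) → M) => P M (fun i => w i.succ) (w 0))) :
    Sg k (fun M v => ∃ x, x ≤ t M v ∧ P M v x) := by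
  simpa using (sgPkg k).bex t _ h

theorem sigma_Sg {k m : ℕ} {φ : LA.BoundedFormula Empty m} (h : IsSigmaFml k φ) : Sg k (Rz φ) := by
  refine IsSigmaFml.rec (motive_1 := fun k m φ _ => Sg k (Rz φ))
    (motive_2 := fun k m φ _ => Sg k (fun M v => ¬ Rz φ M v)) ?_ ?_ ?_ ?_ ?_ ?_ h
  · intro m φ h
    exact D0.mk ⟨φ, h, fun M v => Iff.rfl⟩
  · intro k m φ _ h
    exact Sg.ofNeg h
  · intro k m φ _ h
    exact (Sg.ex h).congr (fun M v => (Rz_ex _ _ _).symm)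
  · intro m φ h
    exact @D0.not _ (Rz φ) ⟨φ, h, fun M v => Iff.rfl⟩
  · intro k m φ _ h
    exact Sg.neg h
  · intro k m φ _ h
    exact (Sg.ex h).congr (fun M v => by rw [Rz_all]; simp)

theorem Sg_fml {k : ℕ} : ∀ {m : ℕ} {R : Rel m}, Sg k R →
    (∃ σ : LA.BoundedFormula Empty m, IsSigmaFml k σ ∧ ∀ M v, Rz σ M v ↔ R M v) ∧
    (∃ π : LA.BoundedFormula Empty m, IsPiFml k π ∧ ∀ M v, Rz π M v ↔ ¬ R M v) := by
  induction k with
  | zero =>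
    intro m R h
    have h : D0 R := h
    obtain ⟨ψ, h3, h4⟩ := D0.not R
    obtain ⟨φ, h1, h2⟩ := h
    exact ⟨⟨φ, .ofDelta0 h1, h2⟩, ⟨ψ, .ofDelta0 h3, h4⟩⟩
  | succ k ih =>
    rintro m R ⟨P, h, e⟩
    obtain ⟨⟨σ, h1, h2⟩, ⟨π, h3, h4⟩⟩ := ih h
    refine ⟨⟨_, .ex (.ofPi h3), fun M v => ?_⟩, ⟨_, .all (.ofSigma h1), fun M v => ?_⟩⟩
    · simp [Rz_ex, h4, e]
    · simp [Rz_all, h2, e]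

/-! ### Part C: coding of finite sets -/

/-- A pairing function. -/
def J {A : Type} [Add A] [Mul A] [One A] (x y : A) : A := (x + y) * (x + y) + x + 1

instance TD.J {m : ℕ} (t u : Fnc m) [h : TD t] [h' : TD u] : TD (fun M v => J (t M v) (u M v)) := by
  unfold Guaspari.J; infer_instance

section J
variable {M : PAM}
theorem J_ne_zero (x y : M) : J x y ≠ 0 := add_one_ne _
theorem lt_J_left (x y : M) : x < J x y := by
  unfold J; rw [lt_add_one_iff']; exact le_add_self
theorem le_mul_self' (x : M) : x ≤ x * x := by
  rcases zero_or_succ x with rfl | ⟨y, rfl⟩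
  · simp
  · calc y + 1 ≤ (y + 1) + y * (y + 1) := le_self_add
      _ = _ := by ring
theorem lt_J_right (x y : M) : y < J x y := by
  unfold J; rw [lt_add_one_iff']
  calc y ≤ x + y := le_add_self
    _ ≤ (x+y)*(x+y) := le_mul_self' _
    _ ≤ _ := le_self_add
theorem J_inj {x y x' y' : M} (h : J x y = J x' y') : x = x' ∧ y = y' := by
  have key : ∀ {x y x' y' : M}, J x y = J x' y' → ¬ (x + y < x' + y') := by
    intro x y x' y' h hlt
    rw [lt_iff_add_one_le'] at hlt
    obtain ⟨c, hc⟩ := exists_add_of_le hlt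
    unfold J at h
    rw [hc] at h
    have h1 : (x + y) * (x + y) + x + 1 < (x + y + 1 + c) * (x + y + 1 + c) + x' + 1 := by
      calc (x + y) * (x + y) + x + 1 ≤ (x + y) * (x + y) + x + 1 + (x + y + y + 2 * c * (x + y + 1) + c * c + x') := le_self_add
        _ = (x + y + 1 + c) * (x + y + 1 + c) + x' := by ring
        _ < _ := by rw [lt_add_one_iff']
    exact h1.ne h
  have e : x + y = x' + y' := le_antisymm (not_lt.1 (key h.symm)) (not_lt.1 (key h))
  have h1 := h
  unfold J at h1
  rw [e] at h1
  have hx : x = x' := add_left_cancel (add_right_cancel h1)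
  subst hx
  exact ⟨rfl, add_left_cancel e⟩
@[simp] theorem J_eq_iff {x y x' y' : M} : J x y = J x' y' ↔ x = x' ∧ y = y' :=
  ⟨J_inj, by rintro ⟨rfl, rfl⟩; rfl⟩

theorem dvd_cancel {a x y : M} (h : a ∣ x + y) (h' : a ∣ x) : a ∣ y := by
  obtain ⟨p, rfl⟩ := h'
  obtain ⟨r, hr⟩ := h
  rcases le_total p r with h1 | h1
  · obtain ⟨t, rfl⟩ := exists_add_of_le h1
    rw [mul_add] at hr
    exact ⟨t, add_left_cancel hr⟩
  · obtain ⟨t, rfl⟩ := exists_add_of_le h1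
    rw [mul_add, add_assoc] at hr
    have : a * t + y = 0 := by
      have h2 : a * r + (a * t + y) = a * r + 0 := by rw [hr, add_zero]
      exact add_left_cancel h2
    rw [add_eq_zero' this]
    exact dvd_zero a

theorem coprime_step {d s e C k q : M} (hd : d = k * q) (h : 1 + (e+1)*d ∣ s * (k * d)) : 1 + (e+1)*d ∣ s := by
  have h2 : 1 + (e+1)*d ∣ s * (e+1) * d * d := by
    have : s * (e+1) * d * d = s * (k * d) * (q * (e+1)) := by
      nth_rewrite 1 [hd]; ring
    rw [this]; exact Dvd.dvd.mul_right h _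
  have h3 : 1 + (e+1)*d ∣ s * d := by
    refine dvd_cancel (x := s * (e+1) * d * d) ?_ h2
    exact ⟨s * d, by ring⟩
  refine dvd_cancel (x := s * d * (e+1)) ?_ (Dvd.dvd.mul_right h3 _)
  exact ⟨s, by ring⟩

theorem exists_mult (B : M) : ∃ d : M, d ≠ 0 ∧ ∀ i, i ≤ B → i = 0 ∨ ∃ q, d = i * q := by
  refine ind (m := 0) (fun M w => ∃ d : M, ¬ d = 0 ∧ ∀ i, i ≤ w 0 → i = 0 ∨ ∃ q, d = i * q) ![] ?_ ?_ B
  · refine ⟨1, one_ne_zero', fun i hi => Or.inl (le_antisymm hi (zero_le' i))⟩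
  · rintro B ⟨d, h0, h⟩
    refine ⟨d * (B + 1), ?_, fun i hi => ?_⟩
    · exact mul_ne_zero h0 (add_one_ne B)
    · have hi : i ≤ B + 1 := hi
      rcases hi.lt_or_eq with h1 | rfl
      · rcases h i ((lt_add_one_iff' _ _).1 h1) with h2 | ⟨q, rfl⟩
        · exact Or.inl h2
        · exact Or.inr ⟨q * (B + 1), by ring⟩
      · exact Or.inr ⟨d, by ring⟩

/-- `e` is an element of the finite set coded by `l`. -/
def mem (e l : M) : Prop :=
  ∃ s, s ≤ l ∧ ∃ d, d ≤ l ∧ ∃ b, b ≤ l ∧ l = J s (J d b) ∧ e < b ∧ ∃ c, c ≤ s ∧ s = (1 + (e+1)*d) * c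

theorem mem_lt {e l : M} (h : mem e l) : e < l := by
  obtain ⟨s, _, d, _, b, hb, _, h, _⟩ := h
  exact h.trans_le hb

theorem mem_J {e s d b : M} : mem e (J s (J d b)) ↔ e < b ∧ 1 + (e+1)*d ∣ s := by
  constructor
  · rintro ⟨s', _, d', _, b', _, h, h1, c, _, h2⟩
    simp only [J_eq_iff] at h
    obtain ⟨rfl, rfl, rfl⟩ := h
    exact ⟨h1, c, h2⟩
  · rintro ⟨h1, c, h2⟩
    refine ⟨s, (lt_J_left _ _).le, d, (((lt_J_left _ _).trans (lt_J_right _ _)).le), b, ((lt_J_right _ _).trans (lt_J_right _ _)).le, rfl, h1, ?_⟩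
    refine ⟨c, ?_, h2⟩
    rw [h2]
    calc c ≤ c + (e+1)*d*c := le_self_add
      _ = _ := by ring

theorem comprehension {m : ℕ} (R : Rel (m+1)) [hR : Df R] (v : Fin m → M) (B : M) :
    ∃ l : M, ∀ e, mem e l ↔ e < B ∧ R M (Fin.cons e v) := by
  obtain ⟨d, h0, hd⟩ := exists_mult B
  have key := ind (fun M (w : Fin (m+3) → M) => w 0 ≤ w 1 → ∃ s, ∀ e, e < w 1 →
    ((∃ c, s = (1 + (e+1)*(w 2))*c) ↔ e < w 0 ∧ R M (Fin.cons e (fun i => w i.succ.succ.succ))))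
    (Fin.cons B (Fin.cons d v)) ?_ ?_ B le_rfl
  · obtain ⟨s, hs⟩ := key
    refine ⟨J s (J d B), fun e => ?_⟩
    rw [mem_J]
    constructor
    · rintro ⟨h1, h2⟩
      exact (hs e h1).1 h2
    · rintro ⟨h1, h2⟩
      exact ⟨h1, (hs e h1).2 ⟨h1, h2⟩⟩
  · intro _
    refine ⟨1, fun e he => ?_⟩
    constructor
    · rintro ⟨c, hc⟩
      exfalso
      have hc : 1 = (1 + (e+1)*d)*c := hc
      have h1 : c ≠ 0 := by rintro rfl; simp at hc
      obtain h2 | ⟨c', rfl⟩ := zero_or_succ c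
      · exact h1 h2
      · have : 1 + 0 = 1 + (c' + (e+1)*d + (e+1)*d*c') := by
          rw [add_zero]; nth_rewrite 1 [hc]; ring
        have := add_left_cancel this
        have h3 : (e+1)*d ≤ 0 := by
          rw [this]
          exact le_add_self.trans le_self_add
        exact mul_ne_zero (add_one_ne e) h0 (le_antisymm h3 (zero_le' _))
    · rintro ⟨h, _⟩
      exact absurd h (not_lt.2 (zero_le' e))
  · intro C ih hC
    have hC : C + 1 ≤ B := hC
    obtain ⟨s, hs⟩ := ih ((le_self_add).trans hC)
    have hs : ∀ e, e < B → ((1 + (e+1)*d ∣ s) ↔ e < C ∧ R M (Fin.cons e v)) := hs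
    by_cases hRC : R M (Fin.cons C v)
    · refine ⟨s * (1 + (C+1)*d), fun e he => ?_⟩
      show (1 + (e+1)*d ∣ s * (1 + (C+1)*d)) ↔ e < C + 1 ∧ R M (Fin.cons e v)
      have he : e < B := he
      by_cases heC : e = C
      · subst heC
        exact ⟨fun _ => ⟨(lt_add_one_iff' _ _).2 le_rfl, hRC⟩, fun _ => Dvd.intro_left s rfl⟩
      · have : (1 + (e+1)*d ∣ s * (1 + (C+1)*d)) ↔ 1 + (e+1)*d ∣ s := by
          refine ⟨fun h => ?_, fun h => Dvd.dvd.mul_right h _⟩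
          rcases lt_or_gt_of_ne heC with h1 | h1
          · obtain ⟨k, rfl⟩ := exists_add_of_le h1.le
            have hk : k ≤ B := le_add_self.trans (le_self_add.trans hC)
            rcases hd k hk with rfl | ⟨q, hq⟩
            · simp at heC
            · refine coprime_step (C := 0) hq (dvd_cancel (x := s * (1 + (e+1)*d)) ?_ (Dvd.intro_left s rfl))
              convert h using 1; ring
          · obtain ⟨k, rfl⟩ := exists_add_of_le h1.le
            have hk : k ≤ B := le_add_self.trans he.le
            rcases hd k hk with rfl | ⟨q, hq⟩
            · simp at heC
            · refine coprime_step (C := 0) hq (dvd_cancel (x := s * (1 + (C+1)*d)) ?_ h)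
              exact ⟨s, by ring⟩
        rw [this, hs e he, lt_add_one_iff']
        constructor
        · rintro ⟨a, b⟩; exact ⟨a.le, b⟩
        · rintro ⟨a, b⟩; exact ⟨lt_of_le_of_ne a heC, b⟩
    · refine ⟨s, fun e he => ?_⟩
      show (1 + (e+1)*d ∣ s) ↔ e < C + 1 ∧ R M (Fin.cons e v)
      rw [hs e he, lt_add_one_iff']
      constructor
      · rintro ⟨a, b⟩; exact ⟨a.le, b⟩
      · rintro ⟨a, b⟩
        refine ⟨lt_of_le_of_ne a ?_, b⟩
        rintro rfl
        exact hRC b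
end J

instance D0.mem {m : ℕ} (t u : Fnc m) [h : TD t] [h' : TD u] : D0 (fun M v => mem (t M v) (u M v)) := by
  unfold Guaspari.mem; infer_instance

section J
variable {M : PAM}
/-- `l ∪ l' ∪ {x}` -/
theorem exists_union (l l' x : M) : ∃ k : M, ∀ e, mem e k ↔ mem e l ∨ mem e l' ∨ e = x := by
  obtain ⟨k, hk⟩ := comprehension (m := 3) (fun M w => mem (w 0) (w 1) ∨ mem (w 0) (w 2) ∨ w 0 = w 3) ![l, l', x] (l + l' + x + 1)
  refine ⟨k, fun e => ?_⟩
  rw [hk]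
  constructor
  · exact fun h => h.2
  · intro h
    refine ⟨?_, h⟩
    rw [lt_add_one_iff']
    rcases h with h | h | rfl
    · exact (mem_lt h).le.trans (le_self_add.trans le_self_add)
    · exact (mem_lt h).le.trans (le_add_self.trans le_self_add)
    · exact le_add_self
theorem exists_empty : ∃ k : M, ∀ e, ¬ mem e k := by
  obtain ⟨k, hk⟩ := comprehension (m := 0) (fun M w => False) ![] (0:M)
  exact ⟨k, fun e h => ((hk e).1 h).2⟩
end J

/-! ### Part D: Σ₁ relations, self-justifying sets and the universal predicate -/

/-- `Σ₁` relations as a class. -/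
class S1 {m : ℕ} (R : Rel m) : Prop where
  out : Sg 1 R

instance (priority := low) S1.ofD0 {m : ℕ} (R : Rel m) [h : D0 R] : S1 R := ⟨Sg.ofD0 1⟩
instance S1.and {m : ℕ} (P Q : Rel m) [h : S1 P] [h' : S1 Q] : S1 (fun M v => P M v ∧ Q M v) :=
  ⟨(sgPkg 1).and h.1 h'.1⟩
instance S1.or {m : ℕ} (P Q : Rel m) [h : S1 P] [h' : S1 Q] : S1 (fun M v => P M v ∨ Q M v) :=
  ⟨(sgPkg 1).or h.1 h'.1⟩
instance S1.ex {m : ℕ} (P : ∀ M : PAM, (Fin m → M) → M → Prop)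
    [h' : S1 (fun M (w : Fin (m+1) → M) => P M (fun i => w i.succ) (w 0))] :
    S1 (fun M v => ∃ x, P M v x) := ⟨Sg.exH h'.1⟩
instance S1.ball {m : ℕ} (t : Fnc m) [TD t] (P : ∀ M : PAM, (Fin m → M) → M → Prop)
    [h' : S1 (fun M (w : Fin (m+1) → M) => P M (fun i => w i.succ) (w 0))] :
    S1 (fun M v => ∀ x, x ≤ t M v → P M v x) := ⟨Sg.ballH t h'.1⟩
theorem S1.congr {m : ℕ} {R S : Rel m} (h : S1 R) (e : ∀ M v, R M v ↔ S M v) : S1 S := ⟨h.1.congr e⟩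
theorem S1.subst {m : ℕ} (R : Rel m) [h : S1 R] {m' : ℕ} (ts : Fin m → Fnc m') (hs : ∀ i, TD (ts i)) :
    S1 (fun M v => R M (fun i => ts i M v)) := ⟨h.1.subst ts hs⟩
instance S1.weak {m m' : ℕ} (R : Rel m) [h : S1 R] (ρ : Fin m → Fin m') :
    S1 (fun M v => R M (fun i => v (ρ i))) := S1.subst R (fun i M v => v (ρ i)) (fun i => inferInstance)
instance S1.sub1 {m m' : ℕ} (R : Rel (m+1)) [hR : S1 R] (t : Fnc m') [h : TD t] (ρ : Fin m → Fin m') :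
    S1 (fun M v => R M (Fin.cons (t M v) (fun i => v (ρ i)))) := ⟨hR.1.sub1 t ρ⟩
instance (priority := low) Df.ofS1 {m : ℕ} (R : Rel m) [h : S1 R] : Df R := h.1.toDf

/-- `l` is a self-justifying set with respect to `Q`. -/
def Just {M : PAM} (Q : M → M → Prop) (l : M) : Prop := ∀ e, e ≤ l → ¬ mem e l ∨ Q e l
/-- `e` belongs to a self-justifying set. -/
def Lfp {M : PAM} (Q : M → M → Prop) (e : M) : Prop := ∃ l, Just Q l ∧ mem e l
/-- monotonicity -/
def Mono {M : PAM} (Q : M → M → Prop) : Prop := ∀ e l l', (∀ x, mem x l → mem x l') → Q e l → Q e l'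

section lfp
variable {M : PAM} {Q : M → M → Prop}
theorem just_iff {l : M} : Just Q l ↔ ∀ e, mem e l → Q e l := by
  constructor
  · intro h e he
    exact (h e (mem_lt he).le).resolve_left (fun h => h he)
  · intro h e _
    by_cases he : mem e l
    · exact Or.inr (h e he)
    · exact Or.inl he
theorem lfp_elim {e : M} (h : Lfp Q e) : ∃ l, Just Q l ∧ Q e l := by
  obtain ⟨l, h, he⟩ := h
  exact ⟨l, h, just_iff.1 h e he⟩
theorem just_merge (hQ : Mono Q) {l l' : M} (h : Just Q l) (h' : Just Q l') :
    ∃ k, Just Q k ∧ ∀ x, mem x l ∨ mem x l' → mem x k := by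
  by_cases hl : ∃ x, mem x l
  · obtain ⟨x, hx⟩ := hl
    obtain ⟨k, hk⟩ := exists_union l l' x
    refine ⟨k, just_iff.2 fun e he => ?_, fun x hx => (hk x).2 (by tauto)⟩
    have he : mem e l ∨ mem e l' := by
      rcases (hk e).1 he with h | h | rfl <;> tauto
    rcases he with he | he
    · exact hQ e l k (fun x hx => (hk x).2 (Or.inl hx)) (just_iff.1 h e he)
    · exact hQ e l' k (fun x hx => (hk x).2 (Or.inr (Or.inl hx))) (just_iff.1 h' e he)
  · push Not at hl
    refine ⟨l', h', fun x hx => ?_⟩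
    rcases hx with hx | hx
    · exact absurd hx (hl x)
    · exact hx
theorem just_insert (hQ : Mono Q) {l e : M} (h : Just Q l) (he : Q e l) :
    ∃ k, Just Q k ∧ mem e k ∧ ∀ x, mem x l → mem x k := by
  obtain ⟨k, hk⟩ := exists_union l l e
  have hs : ∀ x, mem x l → mem x k := fun x hx => (hk x).2 (Or.inl hx)
  refine ⟨k, just_iff.2 fun e' he' => ?_, (hk e).2 (by tauto), hs⟩
  rcases (hk e').1 he' with h1 | h1 | rfl
  · exact hQ e' l k hs (just_iff.1 h e' h1)
  · exact hQ e' l k hs (just_iff.1 h e' h1)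
  · exact hQ e' l k hs he
theorem lfp_intro (hQ : Mono Q) {l e : M} (h : Just Q l) (he : Q e l) : Lfp Q e := by
  obtain ⟨k, h1, h2, _⟩ := just_insert hQ h he
  exact ⟨k, h1, h2⟩
theorem just_empty : ∃ l : M, Just Q l := by
  obtain ⟨l, hl⟩ := exists_empty (M := M)
  exact ⟨l, just_iff.2 fun e he => absurd he (hl e)⟩
end lfp

instance S1.just {m : ℕ} (Q : ∀ M : PAM, (Fin m → M) → M → M → Prop)
    [h : S1 (fun M (w : Fin (m+2) → M) => Q M (fun i => w i.succ.succ) (w 0) (w 1))] (t : Fnc m) [ht : TD t] :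
    S1 (fun M v => Just (Q M v) (t M v)) := by
  unfold Just
  have h2 : S1 (fun M (w : Fin (m+1) → M) => Q M (fun i => w i.succ) (w 0) (t M (fun i => w i.succ))) := by
    have := h.1.sub2 (m' := m+1) (fun M w => w 0) (fun M w => t M (fun i => w i.succ)) (fun i => i.succ)
    exact ⟨this.congr (fun M v => by simp)⟩
  infer_instance

/-- codes -/
def cod {A : Type} [Add A] [Mul A] [One A] [NatCast A] (k : ℕ) (p q : A) : A := J (k : A) (J p q)
instance TD.cod {m : ℕ} (k : ℕ) (t u : Fnc m) [h : TD t] [h' : TD u] : TD (fun M v => cod k (t M v) (u M v)) := by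
  unfold Guaspari.cod; infer_instance
theorem cod_eq_iff {M : PAM} {k k' : ℕ} {x y x' y' : M} : cod k x y = cod k' x' y' ↔ k = k' ∧ x = x' ∧ y = y' := by
  simp [cod]
theorem cast_J {M : PAM} (x y : ℕ) : ((J x y : ℕ) : M) = J (x : M) (y : M) := by simp [J]
theorem cast_cod {M : PAM} (k x y : ℕ) : ((cod k x y : ℕ) : M) = cod k (x : M) (y : M) := by
  simp [cod, cast_J]

/-- The clauses of the truth definition. -/
def TQ {M : PAM} (e l : M) : Prop :=
  ∃ t u a x y : M,
    e = J (cod 0 0 0) (J 0 a) ∨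
    e = J (cod 1 0 0) (J x (J x a)) ∨
    (e = J (cod 2 t 0) (J x (J y a)) ∧ mem (J t (J x a)) l) ∨
    (e = J (cod 3 t 0) (J (x+1) a) ∧ mem (J t (J x a)) l) ∨
    (e = J (cod 4 t u) (J (x+y) a) ∧ mem (J t (J x a)) l ∧ mem (J u (J y a)) l) ∨
    (e = J (cod 5 t u) (J (x*y) a) ∧ mem (J t (J x a)) l ∧ mem (J u (J y a)) l) ∨
    (e = J (cod 6 t u) a ∧ mem (J t (J x a)) l ∧ mem (J u (J y a)) l ∧ x ≤ y) ∨
    (e = J (cod 7 t u) a ∧ mem (J t a) l ∧ mem (J u a) l) ∨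
    (e = J (cod 8 t u) a ∧ (mem (J t a) l ∨ mem (J u a) l)) ∨
    (e = J (cod 9 t u) a ∧ mem (J t (J x a)) l ∧ ∀ z, z ≤ x → mem (J u (J z a)) l) ∨
    (e = J (cod 10 t 0) a ∧ mem (J t (J x a)) l)

/-- universal truth predicate -/
def SatD {M : PAM} (e : M) : Prop := Lfp TQ e

set_option synthInstance.maxHeartbeats 0 in
set_option synthInstance.maxSize 100000 in
instance S1.just_TQ {m : ℕ} (t : Fnc m) [ht : TD t] : S1 (fun M v => Just TQ (t M v)) := by
  refine @S1.just m (fun M v e l => TQ e l) ?_ t ht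
  unfold TQ
  infer_instance
instance S1.satD {m : ℕ} (t : Fnc m) [ht : TD t] : S1 (fun M v => SatD (t M v)) := by
  unfold SatD Lfp; infer_instance

section sat
variable {M : PAM}
theorem mono_TQ : Mono (TQ (M := M)) := by
  intro e l l' h hq
  obtain ⟨t, u, a, x, y, hq⟩ := hq
  refine ⟨t, u, a, x, y, ?_⟩
  rcases hq with h0|h0|⟨h0,h1⟩|⟨h0,h1⟩|⟨h0,h1,h2⟩|⟨h0,h1,h2⟩|⟨h0,h1,h2,h3⟩|⟨h0,h1,h2⟩|⟨h0,h1|h1⟩|⟨h0,h1,h2⟩|⟨h0,h1⟩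
  · exact Or.inl h0
  · exact Or.inr (Or.inl h0)
  · exact Or.inr (Or.inr (Or.inl ⟨h0, h _ h1⟩))
  · exact Or.inr (Or.inr (Or.inr (Or.inl ⟨h0, h _ h1⟩)))
  · exact Or.inr (Or.inr (Or.inr (Or.inr (Or.inl ⟨h0, h _ h1, h _ h2⟩))))
  · exact Or.inr (Or.inr (Or.inr (Or.inr (Or.inr (Or.inl ⟨h0, h _ h1, h _ h2⟩)))))
  · exact Or.inr (Or.inr (Or.inr (Or.inr (Or.inr (Or.inr (Or.inl ⟨h0, h _ h1, h _ h2, h3⟩))))))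
  · exact Or.inr (Or.inr (Or.inr (Or.inr (Or.inr (Or.inr (Or.inr (Or.inl ⟨h0, h _ h1, h _ h2⟩)))))))
  · exact Or.inr (Or.inr (Or.inr (Or.inr (Or.inr (Or.inr (Or.inr (Or.inr (Or.inl ⟨h0, Or.inl (h _ h1)⟩))))))))
  · exact Or.inr (Or.inr (Or.inr (Or.inr (Or.inr (Or.inr (Or.inr (Or.inr (Or.inl ⟨h0, Or.inr (h _ h1)⟩))))))))
  · exact Or.inr (Or.inr (Or.inr (Or.inr (Or.inr (Or.inr (Or.inr (Or.inr (Or.inr (Or.inl ⟨h0, h _ h1, fun z hz => h _ (h2 z hz)⟩)))))))))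
  · exact Or.inr (Or.inr (Or.inr (Or.inr (Or.inr (Or.inr (Or.inr (Or.inr (Or.inr (Or.inr ⟨h0, h _ h1⟩)))))))))

theorem sat_two {e e' : M} (h : SatD e) (h' : SatD e') : ∃ l, Just TQ l ∧ mem e l ∧ mem e' l := by
  obtain ⟨l, h1, h2⟩ := h
  obtain ⟨l', h1', h2'⟩ := h'
  obtain ⟨k, hk, hk'⟩ := just_merge mono_TQ h1 h1'
  exact ⟨k, hk, hk' _ (Or.inl h2), hk' _ (Or.inr h2')⟩

theorem sat_zero {x a : M} : SatD (J (cod 0 0 0) (J x a)) ↔ x = 0 := by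
  constructor
  · intro h
    obtain ⟨l, hl, t, u, b, x', y', h⟩ := lfp_elim h
    simp [cod_eq_iff] at h
    exact h.1
  · rintro rfl
    obtain ⟨l, hl⟩ := just_empty (M := M) (Q := TQ)
    exact lfp_intro mono_TQ hl ⟨0, 0, a, 0, 0, Or.inl rfl⟩
theorem sat_v0 {x y a : M} : SatD (J (cod 1 0 0) (J x (J y a))) ↔ x = y := by
  constructor
  · intro h
    obtain ⟨l, hl, t, u, b, x', y', h⟩ := lfp_elim h
    simp [cod_eq_iff] at h
    rw [h.1, h.2.1]
  · rintro rfl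
    obtain ⟨l, hl⟩ := just_empty (M := M) (Q := TQ)
    exact lfp_intro mono_TQ hl ⟨0, 0, a, x, 0, by simp⟩
theorem sat_vs {t x y a : M} : SatD (J (cod 2 t 0) (J x (J y a))) ↔ SatD (J t (J x a)) := by
  constructor
  · intro h
    obtain ⟨l, hl, t, u, b, x', y', h⟩ := lfp_elim h
    simp [cod_eq_iff] at h
    obtain ⟨⟨rfl, rfl, rfl, rfl⟩, h⟩ := h
    exact ⟨l, hl, h⟩
  · rintro ⟨l, hl, h⟩
    exact lfp_intro mono_TQ hl ⟨t, 0, a, x, y, by simp [h]⟩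
theorem sat_succ {t x a : M} : SatD (J (cod 3 t 0) (J x a)) ↔ ∃ y, x = y + 1 ∧ SatD (J t (J y a)) := by
  constructor
  · intro h
    obtain ⟨l, hl, t, u, b, x', y', h⟩ := lfp_elim h
    simp [cod_eq_iff] at h
    obtain ⟨⟨rfl, rfl, rfl⟩, h⟩ := h
    exact ⟨x', rfl, l, hl, h⟩
  · rintro ⟨y, rfl, l, hl, h⟩
    exact lfp_intro mono_TQ hl ⟨t, 0, a, y, y, by simp [h]⟩
theorem sat_add {t u x a : M} : SatD (J (cod 4 t u) (J x a)) ↔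
    ∃ y z, x = y + z ∧ SatD (J t (J y a)) ∧ SatD (J u (J z a)) := by
  constructor
  · intro h
    obtain ⟨l, hl, t, u, b, x', y', h⟩ := lfp_elim h
    simp [cod_eq_iff] at h
    obtain ⟨⟨⟨rfl, rfl⟩, rfl, rfl⟩, h1, h2⟩ := h
    exact ⟨x', y', rfl, ⟨l, hl, h1⟩, ⟨l, hl, h2⟩⟩
  · rintro ⟨y, z, rfl, h1, h2⟩
    obtain ⟨l, hl, h1, h2⟩ := sat_two h1 h2
    exact lfp_intro mono_TQ hl ⟨t, u, a, y, z, by simp [h1, h2]⟩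
theorem sat_mul {t u x a : M} : SatD (J (cod 5 t u) (J x a)) ↔
    ∃ y z, x = y * z ∧ SatD (J t (J y a)) ∧ SatD (J u (J z a)) := by
  constructor
  · intro h
    obtain ⟨l, hl, t, u, b, x', y', h⟩ := lfp_elim h
    simp [cod_eq_iff] at h
    obtain ⟨⟨⟨rfl, rfl⟩, rfl, rfl⟩, h1, h2⟩ := h
    exact ⟨x', y', rfl, ⟨l, hl, h1⟩, ⟨l, hl, h2⟩⟩
  · rintro ⟨y, z, rfl, h1, h2⟩
    obtain ⟨l, hl, h1, h2⟩ := sat_two h1 h2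
    exact lfp_intro mono_TQ hl ⟨t, u, a, y, z, by simp [h1, h2]⟩
theorem sat_le {t u a : M} : SatD (J (cod 6 t u) a) ↔
    ∃ y z, y ≤ z ∧ SatD (J t (J y a)) ∧ SatD (J u (J z a)) := by
  constructor
  · intro h
    obtain ⟨l, hl, t, u, b, x', y', h⟩ := lfp_elim h
    simp [cod_eq_iff] at h
    obtain ⟨⟨⟨rfl, rfl⟩, rfl⟩, h1, h2, h3⟩ := h
    exact ⟨x', y', h3, ⟨l, hl, h1⟩, ⟨l, hl, h2⟩⟩
  · rintro ⟨y, z, h3, h1, h2⟩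
    obtain ⟨l, hl, h1, h2⟩ := sat_two h1 h2
    exact lfp_intro mono_TQ hl ⟨t, u, a, y, z, by simp [h1, h2, h3]⟩
theorem sat_and {t u a : M} : SatD (J (cod 7 t u) a) ↔ SatD (J t a) ∧ SatD (J u a) := by
  constructor
  · intro h
    obtain ⟨l, hl, t, u, b, x', y', h⟩ := lfp_elim h
    simp [cod_eq_iff] at h
    obtain ⟨⟨⟨rfl, rfl⟩, rfl⟩, h1, h2⟩ := h
    exact ⟨⟨l, hl, h1⟩, ⟨l, hl, h2⟩⟩
  · rintro ⟨h1, h2⟩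
    obtain ⟨l, hl, h1, h2⟩ := sat_two h1 h2
    exact lfp_intro mono_TQ hl ⟨t, u, a, 0, 0, by simp [h1, h2]⟩
theorem sat_or {t u a : M} : SatD (J (cod 8 t u) a) ↔ SatD (J t a) ∨ SatD (J u a) := by
  constructor
  · intro h
    obtain ⟨l, hl, t, u, b, x', y', h⟩ := lfp_elim h
    simp [cod_eq_iff] at h
    obtain ⟨⟨⟨rfl, rfl⟩, rfl⟩, h1 | h1⟩ := h
    · exact Or.inl ⟨l, hl, h1⟩
    · exact Or.inr ⟨l, hl, h1⟩
  · rintro (⟨l, hl, h1⟩ | ⟨l, hl, h1⟩)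
    · exact lfp_intro mono_TQ hl ⟨t, u, a, 0, 0, by simp [h1]⟩
    · exact lfp_intro mono_TQ hl ⟨t, u, a, 0, 0, by simp [h1]⟩
theorem sat_ex {t a : M} : SatD (J (cod 10 t 0) a) ↔ ∃ x, SatD (J t (J x a)) := by
  constructor
  · intro h
    obtain ⟨l, hl, t, u, b, x', y', h⟩ := lfp_elim h
    simp [cod_eq_iff] at h
    obtain ⟨⟨rfl, rfl⟩, h⟩ := h
    exact ⟨x', l, hl, h⟩
  · rintro ⟨x, l, hl, h⟩
    exact lfp_intro mono_TQ hl ⟨t, 0, a, x, 0, by simp [h]⟩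
theorem sat_ball {t u a : M} : SatD (J (cod 9 t u) a) ↔
    ∃ x, SatD (J t (J x a)) ∧ ∀ y, y ≤ x → SatD (J u (J y a)) := by
  constructor
  · intro h
    obtain ⟨l, hl, t, u, b, x', y', h⟩ := lfp_elim h
    simp [cod_eq_iff] at h
    obtain ⟨⟨⟨rfl, rfl⟩, rfl⟩, h1, h2⟩ := h
    exact ⟨x', ⟨l, hl, h1⟩, fun y hy => ⟨l, hl, h2 y hy⟩⟩
  · rintro ⟨x, h1, h2⟩
    have key := ind (m := 2) (fun M w => (∀ y, y ≤ w 0 → SatD (J (w 1) (J y (w 2)))) → ∃ l, Just TQ l ∧ ∀ y, y ≤ w 0 → mem (J (w 1) (J y (w 2))) l) ![u, a] ?_ ?_ x h2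
    · obtain ⟨l', hl', h2⟩ := key
      obtain ⟨l, hl, h1⟩ := h1
      obtain ⟨k, hk, hk'⟩ := just_merge mono_TQ hl hl'
      refine lfp_intro mono_TQ hk ⟨t, u, a, x, 0, ?_⟩
      have h3 := hk' _ (Or.inl h1)
      have h4 : ∀ z, z ≤ x → mem (J u (J z a)) k := fun z hz => hk' _ (Or.inr (h2 z hz))
      exact Or.inr (Or.inr (Or.inr (Or.inr (Or.inr (Or.inr (Or.inr (Or.inr (Or.inr (Or.inl ⟨rfl, h3, h4⟩)))))))))
    · intro h
      obtain ⟨l, hl, h⟩ := h 0 le_rfl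
      refine ⟨l, hl, fun y hy => ?_⟩
      obtain rfl : y = 0 := le_antisymm hy (zero_le' y)
      exact h
    · intro x ih h
      have h : ∀ y, y ≤ x + 1 → SatD (J u (J y a)) := h
      obtain ⟨l, hl, h1⟩ := ih (fun y hy => h y (le_trans hy le_self_add))
      have h1 : ∀ y, y ≤ x → mem (J u (J y a)) l := h1
      obtain ⟨l', hl', h1'⟩ := h (x+1) le_rfl
      obtain ⟨k, hk, hk'⟩ := just_merge mono_TQ hl hl'
      refine ⟨k, hk, fun y hy => ?_⟩
      have hy : y ≤ x + 1 := hy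
      show mem (J u (J y a)) k
      rcases hy.lt_or_eq with h2 | rfl
      · exact hk' _ (Or.inl (h1 y ((lt_add_one_iff' _ _).1 h2)))
      · exact hk' _ (Or.inr h1')
end sat

/-- coded tuple -/
def env {M : PAM} : ∀ {m : ℕ}, (Fin m → M) → M
  | 0, _ => 0
  | m+1, v => J (v 0) (env (fun i : Fin m => v i.succ))
theorem TD.env_aux : ∀ {m m' : ℕ} (ts : Fin m → Fnc m') (hs : ∀ i, TD (ts i)), TD (fun M v => env (fun i => ts i M v))
  | 0, m', ts, hs => TD.zero
  | m+1, m', ts, hs => by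
    unfold env
    have := hs 0
    have := TD.env_aux (fun i => ts i.succ) (fun i => hs _)
    infer_instance
theorem env_cons {M : PAM} {m : ℕ} (x : M) (v : Fin m → M) : env (Fin.cons x v : Fin (m+1) → M) = J x (env v) := by
  simp [env]

theorem term_code {m : ℕ} (τ : LA.Term (Empty ⊕ Fin m)) :
    ∃ c : ℕ, ∀ (M : PAM) (v : Fin m → M) (x : M), SatD (J (c : M) (J x (env v))) ↔ x = Tz τ M v := by
  induction τ with
  | var i =>
    rcases i with i | i
    · exact i.elim
    · have : ∀ {m : ℕ} (j : Fin m), ∃ c : ℕ, ∀ (M : PAM) (v : Fin m → M) (x : M), SatD (J (c : M) (J x (env v))) ↔ x = v j := by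
        intro m j
        induction m with
        | zero => exact j.elim0
        | succ m ih =>
          refine Fin.cases ?_ (fun j => ?_) j
          · refine ⟨cod 1 0 0, fun M v x => ?_⟩
            rw [cast_cod, env]; push_cast; exact sat_v0
          · obtain ⟨c, hc⟩ := ih j
            refine ⟨cod 2 c 0, fun M v x => ?_⟩
            rw [cast_cod, env]; push_cast; rw [sat_vs, hc]
      obtain ⟨c, hc⟩ := this i.rev
      exact ⟨c, fun M v x => by rw [hc]; rfl⟩
  | @func n f ts ih =>
    match n, f, ts, ih with
    | 0, f, ts, ih =>
      refine ⟨cod 0 0 0, fun M v x => ?_⟩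
      rw [cast_cod]; push_cast; rw [sat_zero]
      have : Tz (Term.func f ts) M v = 0 := by
        rw [← realize_zeroT (α := Empty) (Sum.elim default (fun i => v i.rev))]
        unfold Tz zeroT Constants.term
        congr 2
        exact Subsingleton.elim _ _
      rw [this]
    | 1, f, ts, ih =>
      obtain ⟨c, hc⟩ := ih 0
      refine ⟨cod 3 c 0, fun M v x => ?_⟩
      rw [cast_cod]; push_cast; rw [sat_succ]
      have : Tz (Term.func f ts) M v = Tz (ts 0) M v + 1 := by
        rw [← sc_eq]
        have : Term.func f ts = succT (ts 0) := by
          unfold succT Functions.apply₁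
          congr 1
          funext i; rw [Subsingleton.elim i 0]; rfl
        rw [this]
        exact realize_succT _ _
      rw [this]
      simp only [hc]
      constructor
      · rintro ⟨y, rfl, rfl⟩; rfl
      · rintro rfl; exact ⟨_, rfl, rfl⟩
    | 2, f, ts, ih =>
      obtain ⟨c, hc⟩ := ih 0
      obtain ⟨c', hc'⟩ := ih 1
      have hts : ts = ![ts 0, ts 1] := by funext i; fin_cases i <;> rfl
      match f with
      | false =>
        refine ⟨cod 4 c c', fun M v x => ?_⟩
        rw [cast_cod, sat_add]
        have : Tz (Term.func (L := LA) (l := 2) false ts) M v = Tz (ts 0) M v + Tz (ts 1) M v := by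
          have : Term.func (L := LA) (l := 2) false ts = addT (ts 0) (ts 1) := by
            unfold addT Functions.apply₂
            congr 1
          rw [this]
          exact realize_addT _ _ _
        simp only [hc, hc']
        constructor
        · rintro ⟨y, z, rfl, rfl, rfl⟩; exact this.symm
        · intro h; exact ⟨_, _, h.trans this, rfl, rfl⟩
      | true =>
        refine ⟨cod 5 c c', fun M v x => ?_⟩
        rw [cast_cod, sat_mul]
        have : Tz (Term.func (L := LA) (l := 2) true ts) M v = Tz (ts 0) M v * Tz (ts 1) M v := by
          have : Term.func (L := LA) (l := 2) true ts = mulT (ts 0) (ts 1) := by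
            unfold mulT Functions.apply₂
            congr 1
          rw [this]
          exact realize_mulT _ _ _
        simp only [hc, hc']
        constructor
        · rintro ⟨y, z, rfl, rfl, rfl⟩; exact this.symm
        · intro h; exact ⟨_, _, h.trans this, rfl, rfl⟩
    | n+3, f, ts, ih => exact Empty.elim f

theorem fml_code {m : ℕ} {φ : LA.BoundedFormula Empty m} (hφ : IsDelta0 φ) :
    ∃ c c' : ℕ, ∀ (M : PAM) (v : Fin m → M), (SatD (J (c : M) (env v)) ↔ Rz φ M v) ∧
      (SatD (J (c' : M) (env v)) ↔ ¬ Rz φ M v) := by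
  have nle : ∀ {M : PAM} (x y : M), ¬ x ≤ y ↔ y + 1 ≤ x := fun x y => by rw [not_le, lt_iff_add_one_le']
  have sle : ∀ {M : PAM} {t u a : M} {x y : M}, (∀ z, SatD (J t (J z a)) ↔ z = x) → (∀ z, SatD (J u (J z a)) ↔ z = y) →
      (SatD (J (cod 6 t u) a) ↔ x ≤ y) := by
    intro M t u a x y h1 h2
    rw [sat_le]
    simp only [h1, h2]
    constructor
    · rintro ⟨_, _, h, rfl, rfl⟩; exact h
    · intro h; exact ⟨_, _, h, rfl, rfl⟩
  have ssucc : ∀ {M : PAM} {t a : M} {x : M}, (∀ z, SatD (J t (J z a)) ↔ z = x) →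
      (∀ z, SatD (J (cod 3 t 0) (J z a)) ↔ z = x + 1) := by
    intro M t a x h1 z
    rw [sat_succ]
    simp only [h1]
    constructor
    · rintro ⟨_, h, rfl⟩; exact h
    · intro h; exact ⟨_, h, rfl⟩
  have sball : ∀ {M : PAM} {t u a : M} {x : M}, (∀ z, SatD (J t (J z a)) ↔ z = x) →
      (SatD (J (cod 9 t u) a) ↔ ∀ y, y ≤ x → SatD (J u (J y a))) := by
    intro M t u a x h1
    rw [sat_ball]
    simp only [h1]
    constructor
    · rintro ⟨_, rfl, h⟩; exact h
    · intro h; exact ⟨_, rfl, h⟩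
  have sbex : ∀ {M : PAM} {t u a : M} {x : M}, (∀ z, SatD (J t (J z a)) ↔ z = x) →
      (SatD (J (cod 10 (cod 7 (cod 6 (cod 1 0 0) (cod 2 t 0)) u) 0) a) ↔ ∃ y, y ≤ x ∧ SatD (J u (J y a))) := by
    intro M t u a x h1
    simp only [sat_ex, sat_and]
    refine exists_congr fun y => and_congr_left fun _ => ?_
    exact sle (fun z => sat_v0) (fun z => by rw [sat_vs, h1])
  induction hφ with
  | falsum =>
    refine ⟨cod 6 (cod 3 (cod 0 0 0) 0) (cod 0 0 0), cod 6 (cod 0 0 0) (cod 0 0 0), fun M v => ⟨?_, ?_⟩⟩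
    · simp only [cast_cod, Nat.cast_zero]
      rw [sle (ssucc (fun z => sat_zero)) (fun z => sat_zero), Rz_bot, ← nle]
      simp
    · simp only [cast_cod, Nat.cast_zero]
      rw [sle ((fun z => sat_zero)) (fun z => sat_zero), Rz_bot]
      simp
  | equal t u =>
    obtain ⟨c, hc⟩ := term_code t
    obtain ⟨d, hd⟩ := term_code u
    refine ⟨cod 7 (cod 6 c d) (cod 6 d c), cod 8 (cod 6 (cod 3 c 0) d) (cod 6 (cod 3 d 0) c), fun M v => ⟨?_, ?_⟩⟩
    · simp only [cast_cod]
      rw [sat_and, sle (hc M v) (hd M v), sle (hd M v) (hc M v), Rz_eq, le_antisymm_iff]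
    · simp only [cast_cod, Nat.cast_zero]
      rw [sat_or, sle (ssucc (hc M v)) (hd M v), sle (ssucc (hd M v)) (hc M v), Rz_eq, le_antisymm_iff, ← nle, ← nle]
      tauto
  | le t u =>
    obtain ⟨c, hc⟩ := term_code t
    obtain ⟨d, hd⟩ := term_code u
    refine ⟨(cod 6 c d), (cod 6 (cod 3 d 0) c), fun M v => ⟨?_, ?_⟩⟩
    · simp only [cast_cod]
      rw [sle (hc M v) (hd M v), Rz_le]
    · simp only [cast_cod, Nat.cast_zero]
      rw [sle (ssucc (hd M v)) (hc M v), Rz_le, ← nle]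
  | imp _ _ ih1 ih2 =>
    obtain ⟨c, c', h⟩ := ih1
    obtain ⟨d, d', h'⟩ := ih2
    refine ⟨cod 8 c' d, cod 7 c d', fun M v => ⟨?_, ?_⟩⟩
    · rw [cast_cod, sat_or, Rz_imp, (h M v).2, (h' M v).1]; tauto
    · rw [cast_cod, sat_and, Rz_imp, (h M v).1, (h' M v).2]; tauto
  | ball t _ ih =>
    obtain ⟨c, c', h⟩ := ih
    obtain ⟨d, hd⟩ := term_code t
    refine ⟨cod 9 d c, (cod 10 (cod 7 (cod 6 (cod 1 0 0) (cod 2 d 0)) c') 0), fun M v => ⟨?_, ?_⟩⟩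
    · simp only [cast_cod]
      rw [sball (hd M v), Rz_all]
      have h6 := fun y => (h M (Fin.cons y v)).1
      simp only [env_cons] at h6
      simp only [Rz_imp, Rz_le, Tz_last, Tz_lift, h6]
    · simp only [cast_cod, Nat.cast_zero]
      rw [sbex (hd M v), Rz_all]
      have h6 := fun y => (h M (Fin.cons y v)).2
      simp only [env_cons] at h6
      simp only [Rz_imp, Rz_le, Tz_last, Tz_lift, h6]
      push Not; rfl
  | bex t _ ih =>
    obtain ⟨c, c', h⟩ := ih
    obtain ⟨d, hd⟩ := term_code t
    refine ⟨(cod 10 (cod 7 (cod 6 (cod 1 0 0) (cod 2 d 0)) c) 0), cod 9 d c', fun M v => ⟨?_, ?_⟩⟩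
    · simp only [cast_cod, Nat.cast_zero]
      rw [sbex (hd M v), Rz_ex]
      have h6 := fun y => (h M (Fin.cons y v)).1
      simp only [env_cons] at h6
      simp only [Rz_inf, Rz_le, Tz_last, Tz_lift, h6]
    · simp only [cast_cod]
      rw [sball (hd M v), Rz_ex]
      have h6 := fun y => (h M (Fin.cons y v)).2
      simp only [env_cons] at h6
      simp only [Rz_inf, Rz_le, Tz_last, Tz_lift, h6]
      push Not; rfl

/-- universal `Σ_{k+1}` predicate -/
def UU {M : PAM} : ℕ → M → M → Prop
  | 0, q, a => SatD (J q a)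
  | k+1, q, a => ∃ x, ¬ UU k q (J x a)

theorem UU_Sg (k : ℕ) : ∀ {m : ℕ} (q a : Fnc m) [TD q] [TD a], Sg (k+1) (fun M v => UU k (q M v) (a M v)) := by
  induction k with
  | zero =>
    intro m q a _ _
    exact (inferInstance : S1 (fun M v => SatD (J (q M v) (a M v)))).out
  | succ k ih =>
    intro m q a _ _
    refine ⟨_, ih (m := m+1) (fun M w => q M (fun i => w i.succ)) (fun M w => J (w 0) (a M (fun i => w i.succ))), fun M v => ?_⟩
    simp [UU]

theorem UU_code (k : ℕ) : ∀ {m : ℕ} {R : Rel m}, Sg (k+1) R →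
    ∃ c : ℕ, ∀ (M : PAM) (v : Fin m → M), R M v ↔ UU k (c : M) (env v) := by
  induction k with
  | zero =>
    rintro m R ⟨P, hP, e⟩
    obtain ⟨φ, h0, h⟩ := D0.out (self := hP)
    obtain ⟨c, c', hc⟩ := fml_code h0
    refine ⟨cod 10 c' 0, fun M v => ?_⟩
    have h6 := fun y => (hc M (Fin.cons y v)).2
    simp only [env_cons] at h6
    simp only [UU, cast_cod, Nat.cast_zero, sat_ex, h6, h, e]
  | succ k ih =>
    rintro m R ⟨P, hP, e⟩
    obtain ⟨c, hc⟩ := ih hP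
    refine ⟨c, fun M v => ?_⟩
    have h6 := fun y => (hc M (Fin.cons y v))
    simp only [env_cons] at h6
    simp only [UU, ← h6, e]

/-! ### Part E: the standard model -/

/-- The standard structure. -/
@[reducible] def natStr : LA.Structure ℕ where
  funMap {n} f x := match n, f, x with
    | 0, _, _ => 0
    | 1, _, x => x 0 + 1
    | 2, false, x => x 0 + x 1
    | 2, true, x => x 0 * x 1
  RelMap {n} r x := match n, r, x with
    | 2, _, x => x 0 ≤ x 1

section
attribute [local instance] natStr
theorem nat_succT {α : Type} {m : ℕ} (v : α ⊕ Fin m → ℕ) (t : LA.Term (α ⊕ Fin m)) :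
    (succT t).realize v = t.realize v + 1 := Term.realize_functions_apply₁
theorem nat_zeroT {α : Type} {m : ℕ} (v : α ⊕ Fin m → ℕ) :
    (zeroT : LA.Term (α ⊕ Fin m)).realize v = 0 := rfl
theorem nat_addT {α : Type} {m : ℕ} (v : α ⊕ Fin m → ℕ) (t u : LA.Term (α ⊕ Fin m)) :
    (addT t u).realize v = t.realize v + u.realize v := Term.realize_functions_apply₂
theorem nat_mulT {α : Type} {m : ℕ} (v : α ⊕ Fin m → ℕ) (t u : LA.Term (α ⊕ Fin m)) :
    (mulT t u).realize v = t.realize v * u.realize v := Term.realize_functions_apply₂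
theorem nat_leF {α : Type} {m : ℕ} (v : α → ℕ) (xs : Fin m → ℕ) (t u : LA.Term (α ⊕ Fin m)) :
    (leF t u).Realize v xs ↔ t.realize (Sum.elim v xs) ≤ u.realize (Sum.elim v xs) :=
  BoundedFormula.realize_rel₂
theorem nat_vT {m : ℕ} (v : Empty → ℕ) (xs : Fin m → ℕ) (i : Fin m) :
    (vT i).realize (Sum.elim v xs) = xs i := rfl

theorem nat_model : ℕ ⊨ PAAx := by
  refine ⟨fun φ hφ => ?_⟩
  rcases hφ with hφ | ⟨m, φ, rfl⟩
  · simp only [Set.mem_insert_iff, Set.mem_singleton_iff] at hφ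
    rcases hφ with rfl | rfl | rfl | rfl | rfl | rfl | rfl <;>
    simp [Sentence.Realize, Formula.Realize, BoundedFormula.realize_all, BoundedFormula.realize_ex, Fin.snoc, nat_succT, nat_zeroT, nat_addT, nat_mulT, nat_leF, nat_vT]
    · intro a b; ring
    · intro a b; ring
    · intro a b
      rw [le_iff_exists_add]
      constructor
      · rintro ⟨c, rfl⟩; exact ⟨c, add_comm _ _⟩
      · rintro ⟨c, rfl⟩; exact ⟨c, add_comm _ _⟩
  · rw [indAxiom]
    simp only [Sentence.Realize, BoundedFormula.realize_alls]
    intro v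
    simp only [BoundedFormula.realize_imp, BoundedFormula.realize_inf, BoundedFormula.realize_all,
      BoundedFormula.realize_bdEqual]
    rintro ⟨h0, hs⟩ x
    induction x with
    | zero => exact h0 0 (by simp [nat_vT, nat_zeroT])
    | succ x ih =>
      have := hs x ih (x+1) (by simp [nat_vT, nat_succT])
      rw [BoundedFormula.realize_liftAt (by omega)] at this
      convert this using 1
      funext i
      refine Fin.lastCases ?_ (fun j => ?_) i
      · simp
      · simp
        rw [show (Fin.castAdd 1 (Fin.castSucc j)) = Fin.castSucc (Fin.castSucc j) from rfl]
        simp only [Fin.snoc_castSucc]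
end

theorem nn_aux (M : PAM) (f : ℕ → M) (h0 : f 0 = 0) (hs : ∀ k, f (k+1) = sc (f k)) (k : ℕ) : f k = (k : M) := by
  induction k with
  | zero => rw [h0, Nat.cast_zero]
  | succ k ih => rw [hs, ih, sc_eq, Nat.cast_succ]
theorem nn_exists : ∃ M : PAM, ∀ x : M, ∃ k : ℕ, x = (k : M) :=
  ⟨⟨ℕ, natStr, nat_model⟩, fun x => ⟨x, nn_aux ⟨ℕ, natStr, nat_model⟩ (fun k => k) rfl (fun k => rfl) x⟩⟩
/-- The standard model as a model of PA. -/
noncomputable def NN : PAM := nn_exists.choose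
theorem nn_std (x : NN) : ∃ k : ℕ, x = (k : NN) := nn_exists.choose_spec x

/-- standard tuples in a model -/
def cst {m : ℕ} (M : PAM) (v : Fin m → ℕ) : Fin m → M := fun i => (v i : M)
theorem cst_cons {m : ℕ} (M : PAM) (x : ℕ) (v : Fin m → ℕ) : cst M (Fin.cons x v) = Fin.cons (x : M) (cst M v) := by
  funext i; refine Fin.cases ?_ (fun j => ?_) i <;> simp [cst]
theorem le_nat {M : PAM} {x : M} {n : ℕ} (h : x ≤ (n : M)) : ∃ k : ℕ, k ≤ n ∧ x = (k : M) := by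
  induction n with
  | zero => exact ⟨0, le_rfl, by simpa using h⟩
  | succ n ih =>
    rcases h.lt_or_eq with h | h
    · rw [Nat.cast_succ, lt_add_one_iff'] at h
      obtain ⟨k, hk, e⟩ := ih h
      exact ⟨k, by omega, e⟩
    · exact ⟨n+1, le_rfl, h⟩

theorem Tz_nat {m : ℕ} (τ : LA.Term (Empty ⊕ Fin m)) : ∀ v : Fin m → ℕ, ∃ k : ℕ, ∀ M : PAM, Tz τ M (cst M v) = (k : M) := by
  intro v
  induction τ with
  | var i =>
    rcases i with i | i
    · exact i.elim
    · exact ⟨v i.rev, fun M => rfl⟩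
  | @func n f ts ih =>
    match n, f, ts, ih with
    | 0, f, ts, ih =>
      refine ⟨0, fun M => ?_⟩
      simp only [Nat.cast_zero]
      rw [← realize_zeroT (α := Empty) (Sum.elim default (fun i => cst M v i.rev))]
      unfold Tz zeroT Constants.term
      congr 2
      exact Subsingleton.elim _ _
    | 1, f, ts, ih =>
      obtain ⟨c, hc⟩ := ih 0
      refine ⟨c+1, fun M => ?_⟩
      rw [Nat.cast_succ, ← hc M, ← sc_eq]
      have : Term.func f ts = succT (ts 0) := by
        unfold succT Functions.apply₁
        congr 1
        funext i; rw [Subsingleton.elim i 0]; rfl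
      rw [this]
      exact realize_succT _ _
    | 2, f, ts, ih =>
      obtain ⟨c, hc⟩ := ih 0
      obtain ⟨c', hc'⟩ := ih 1
      have hts : ts = ![ts 0, ts 1] := by funext i; fin_cases i <;> rfl
      match f with
      | false =>
        refine ⟨c + c', fun M => ?_⟩
        rw [Nat.cast_add, ← hc M, ← hc' M]
        have : Term.func (L := LA) (l := 2) false ts = addT (ts 0) (ts 1) := by
          unfold addT Functions.apply₂
          congr 1
        rw [this]
        exact realize_addT _ _ _
      | true =>
        refine ⟨c * c', fun M => ?_⟩
        rw [Nat.cast_mul, ← hc M, ← hc' M]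
        have : Term.func (L := LA) (l := 2) true ts = mulT (ts 0) (ts 1) := by
          unfold mulT Functions.apply₂
          congr 1
        rw [this]
        exact realize_mulT _ _ _
    | n+3, f, ts, ih => exact Empty.elim f

/-- Absoluteness of bounded formulas. -/
theorem D0_abs {m : ℕ} {R : Rel m} (hR : D0 R) (v : Fin m → ℕ) (M M' : PAM) :
    R M (cst M v) ↔ R M' (cst M' v) := by
  obtain ⟨φ, h0, h⟩ := hR
  rw [← h, ← h]
  clear h R
  induction h0 generalizing M M' with
  | falsum => simp [Rz_bot]
  | equal t u =>
    obtain ⟨a, ha⟩ := Tz_nat t v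
    obtain ⟨b, hb⟩ := Tz_nat u v
    simp [Rz_eq, ha, hb]
  | le t u =>
    obtain ⟨a, ha⟩ := Tz_nat t v
    obtain ⟨b, hb⟩ := Tz_nat u v
    simp [Rz_le, ha, hb]
  | imp _ _ ih1 ih2 => rw [Rz_imp, Rz_imp, ih1 v M M', ih2 v M M']
  | @ball _ t χ _ ih =>
    obtain ⟨a, ha⟩ := Tz_nat t v
    have : ∀ M M' : PAM, Rz (∀' (leF (vT (Fin.last _)) (t.relabel (Sum.map id Fin.castSucc)) ⟹ χ)) M (cst M v) → Rz (∀' (leF (vT (Fin.last _)) (t.relabel (Sum.map id Fin.castSucc)) ⟹ χ)) M' (cst M' v) := by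
      intro M M' h
      rw [Rz_all] at h ⊢
      simp only [Rz_imp, Rz_le, Tz_last, Tz_lift, ha] at h ⊢
      intro x hx
      obtain ⟨k, hk, rfl⟩ := le_nat hx
      rw [← cst_cons, ih _ M' M, cst_cons]
      exact h _ (by exact_mod_cast hk)
    exact ⟨this M M', this M' M⟩
  | @bex _ t χ _ ih =>
    obtain ⟨a, ha⟩ := Tz_nat t v
    have : ∀ M M' : PAM, Rz (∃' (leF (vT (Fin.last _)) (t.relabel (Sum.map id Fin.castSucc)) ⊓ χ)) M (cst M v) → Rz (∃' (leF (vT (Fin.last _)) (t.relabel (Sum.map id Fin.castSucc)) ⊓ χ)) M' (cst M' v) := by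
      intro M M' h
      rw [Rz_ex] at h ⊢
      simp only [Rz_inf, Rz_le, Tz_last, Tz_lift, ha] at h ⊢
      obtain ⟨x, hx, h⟩ := h
      obtain ⟨k, hk, rfl⟩ := le_nat hx
      rw [← cst_cons, ih _ M M', cst_cons] at h
      exact ⟨_, (by exact_mod_cast hk), h⟩
    exact ⟨this M M', this M' M⟩

/-- `Σ₁` completeness. -/
theorem S1_up {m : ℕ} {R : Rel m} (hR : Sg 1 R) (v : Fin m → ℕ) (h : R NN (cst NN v)) (M : PAM) :
    R M (cst M v) := by
  obtain ⟨P, hP, e⟩ := hR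
  rw [e] at h ⊢
  obtain ⟨x, h⟩ := h
  obtain ⟨k, rfl⟩ := nn_std x
  refine ⟨(k : M), ?_⟩
  rw [← cst_cons] at h ⊢
  rwa [D0_abs hP _ M NN]

/-! ### Σ₁ relations on the natural numbers -/

/-- `Σ₁` relations on the natural numbers -/
class S1N {m : ℕ} (R : (Fin m → ℕ) → Prop) : Prop where
  out : ∃ S : Rel m, Sg 1 S ∧ ∀ v, R v ↔ S NN (cst NN v)

theorem S1N.of {m : ℕ} {R : (Fin m → ℕ) → Prop} (S : Rel m) (hS : S1 S) (h : ∀ v, R v ↔ S NN (cst NN v)) : S1N R :=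
  ⟨S, hS.1, h⟩
theorem S1N.congr {m : ℕ} {R S : (Fin m → ℕ) → Prop} (h : S1N R) (e : ∀ v, R v ↔ S v) : S1N S := by
  obtain ⟨P, h1, h2⟩ := h
  exact ⟨P, h1, fun v => by rw [← e, h2]⟩
instance S1N.and {m : ℕ} (R S : (Fin m → ℕ) → Prop) [hR : S1N R] [hS : S1N S] : S1N (fun v => R v ∧ S v) := by
  obtain ⟨P, h1, h2⟩ := hR
  obtain ⟨Q, h1', h2'⟩ := hS
  exact ⟨_, (sgPkg 1).and h1 h1', fun v => by rw [h2, h2']⟩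
instance S1N.or {m : ℕ} (R S : (Fin m → ℕ) → Prop) [hR : S1N R] [hS : S1N S] : S1N (fun v => R v ∨ S v) := by
  obtain ⟨P, h1, h2⟩ := hR
  obtain ⟨Q, h1', h2'⟩ := hS
  exact ⟨_, (sgPkg 1).or h1 h1', fun v => by rw [h2, h2']⟩
instance S1N.ex {m : ℕ} (P : (Fin m → ℕ) → ℕ → Prop)
    [h : S1N (fun w : Fin (m+1) → ℕ => P (fun i => w i.succ) (w 0))] : S1N (fun v => ∃ x, P v x) := by
  obtain ⟨Q, h1, h2⟩ := h
  refine ⟨_, Sg.ex h1, fun v => ?_⟩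
  constructor
  · rintro ⟨x, hx⟩
    refine ⟨(x : NN), ?_⟩
    rw [← cst_cons, ← h2]; simpa using hx
  · rintro ⟨x, hx⟩
    obtain ⟨x, rfl⟩ := nn_std x
    rw [← cst_cons, ← h2] at hx
    exact ⟨x, by simpa using hx⟩
theorem S1N.ball0 {m : ℕ} (j : Fin m) (P : (Fin m → ℕ) → ℕ → Prop)
    [h : S1N (fun w : Fin (m+1) → ℕ => P (fun i => w i.succ) (w 0))] : S1N (fun v => ∀ x, x ≤ v j → P v x) := by
  obtain ⟨Q, h1, h2⟩ := h
  refine ⟨_, (sgPkg 1).ball (fun M v => v j) Q h1, fun v => ?_⟩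
  constructor
  · intro h x hx
    obtain ⟨x, rfl⟩ := nn_std x
    rw [← cst_cons, ← h2]
    have hx : (x : NN) ≤ (v j : NN) := hx
    simpa using h x (by exact_mod_cast hx)
  · intro h x hx
    have := h (x : NN) (show (x : NN) ≤ (v j : NN) by exact_mod_cast hx)
    rw [← cst_cons, ← h2] at this
    simpa using this
instance S1N.weak {m m' : ℕ} (R : (Fin m → ℕ) → Prop) [h : S1N R] (ρ : Fin m → Fin m') :
    S1N (fun v : Fin m' → ℕ => R (fun i => v (ρ i))) := by
  obtain ⟨P, h1, h2⟩ := h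
  exact ⟨_, h1.weak ρ, fun v => h2 _⟩

/-- functions with `Σ₁` graph -/
class FN {m : ℕ} (f : (Fin m → ℕ) → ℕ) : Prop where
  out : S1N (fun w : Fin (m+1) → ℕ => w 0 = f (fun i => w i.succ))

theorem S1N.weak' {m m' : ℕ} {R : (Fin m → ℕ) → Prop} (h : S1N R) (ρ : Fin m → Fin m') {S : (Fin m' → ℕ) → Prop}
    (e : ∀ v, S v ↔ R (fun i => v (ρ i))) : S1N S := (S1N.weak R ρ).congr (fun v => (e v).symm)

theorem FN.eqv {m : ℕ} (j : Fin m) (f : (Fin m → ℕ) → ℕ) [h : FN f] : S1N (fun v => v j = f v) :=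
  h.out.weak' (fun i => Fin.cases j (fun i => i) i) (fun v => by simp)
theorem FN.weak {m m' : ℕ} (f : (Fin m → ℕ) → ℕ) [h : FN f] (ρ : Fin m → Fin m') :
    FN (fun v : Fin m' → ℕ => f (fun i => v (ρ i))) :=
  ⟨h.out.weak' (fun i => Fin.cases 0 (fun i => (ρ i).succ) i) (fun v => by simp)⟩
attribute [instance] FN.weak

theorem S1N.comp1 {P : ℕ → Prop} (h : S1N (fun v : Fin 1 → ℕ => P (v 0))) {m : ℕ} (t : (Fin m → ℕ) → ℕ) [ht : FN t] :
    S1N (fun v => P (t v)) := by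
  have h1 : S1N (fun w : Fin (m+1) → ℕ => P (w 0)) := h.weak' (fun _ => 0) (fun v => Iff.rfl)
  have h2 := ht.out
  have : S1N (fun v : Fin m → ℕ => ∃ x, x = t v ∧ P x) := inferInstance
  exact this.congr (fun v => by simp)
theorem S1N.comp2 {P : ℕ → ℕ → Prop} (h : S1N (fun v : Fin 2 → ℕ => P (v 0) (v 1))) {m : ℕ}
    (t u : (Fin m → ℕ) → ℕ) [ht : FN t] [hu : FN u] : S1N (fun v => P (t v) (u v)) := by
  have h1 : S1N (fun w : Fin (m+2) → ℕ => P (w 1) (w 0)) := h.weak' ![1, 0] (fun v => Iff.rfl)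
  have h2 : S1N (fun w : Fin (m+2) → ℕ => w 1 = t (fun i => w i.succ.succ)) := FN.eqv 1 _
  have h3 : S1N (fun w : Fin (m+2) → ℕ => w 0 = u (fun i => w i.succ.succ)) := FN.eqv 0 _
  have : S1N (fun v : Fin m → ℕ => ∃ x y, x = t v ∧ y = u v ∧ P x y) := by
    refine @S1N.ex _ _ (@S1N.ex _ _ ?_)
    exact @S1N.and _ _ _ h2 (@S1N.and _ _ _ h3 h1)
  exact this.congr (fun v => by simp)
theorem S1N.comp3 {P : ℕ → ℕ → ℕ → Prop} (h : S1N (fun v : Fin 3 → ℕ => P (v 0) (v 1) (v 2))) {m : ℕ}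
    (t u s : (Fin m → ℕ) → ℕ) [ht : FN t] [hu : FN u] [hs : FN s] : S1N (fun v => P (t v) (u v) (s v)) := by
  have h1 : S1N (fun w : Fin (m+3) → ℕ => P (w 2) (w 1) (w 0)) := h.weak' ![2, 1, 0] (fun v => Iff.rfl)
  have h2 : S1N (fun w : Fin (m+3) → ℕ => w 2 = t (fun i => w i.succ.succ.succ)) := FN.eqv 2 _
  have h3 : S1N (fun w : Fin (m+3) → ℕ => w 1 = u (fun i => w i.succ.succ.succ)) := FN.eqv 1 _
  have h4 : S1N (fun w : Fin (m+3) → ℕ => w 0 = s (fun i => w i.succ.succ.succ)) := FN.eqv 0 _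
  have : S1N (fun v : Fin m → ℕ => ∃ x y z, x = t v ∧ y = u v ∧ z = s v ∧ P x y z) := by
    refine @S1N.ex _ _ (@S1N.ex _ _ (@S1N.ex _ _ ?_))
    exact @S1N.and _ _ _ h2 (@S1N.and _ _ _ h3 (@S1N.and _ _ _ h4 h1))
  exact this.congr (fun v => by simp)

theorem FN.ofTD {m : ℕ} {f : (Fin m → ℕ) → ℕ} (t : Fnc m) (ht : TD t) (h : ∀ v, (f v : NN) = t NN (cst NN v)) : FN f := by
  refine ⟨S1N.of (fun M w => w 0 = t M (fun i => w i.succ)) inferInstance (fun w => ?_)⟩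
  show _ ↔ (w 0 : NN) = t NN (cst NN (fun i => w i.succ))
  rw [← h]; exact Nat.cast_inj.symm
instance FN.var {m : ℕ} (j : Fin m) : FN (fun v => v j) := FN.ofTD (fun M v => v j) inferInstance (fun v => rfl)
instance FN.const {m : ℕ} (c : ℕ) : FN (m := m) (fun v => c) := FN.ofTD (fun M v => (c : M)) inferInstance (fun v => rfl)
theorem FN.comp1 {g : ℕ → ℕ} (h : FN (fun v : Fin 1 → ℕ => g (v 0))) {m : ℕ} (t : (Fin m → ℕ) → ℕ) [ht : FN t] :
    FN (fun v => g (t v)) := by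
  refine ⟨?_⟩
  have h2 : S1N (fun v : Fin 2 → ℕ => v 0 = g (v 1)) := h.out
  exact S1N.comp2 (P := fun x y => x = g y) h2 (fun w : Fin (m+1) → ℕ => w 0) (fun w => t (fun i => w i.succ))
theorem FN.comp2 {g : ℕ → ℕ → ℕ} (h : FN (fun v : Fin 2 → ℕ => g (v 0) (v 1))) {m : ℕ} (t u : (Fin m → ℕ) → ℕ)
    [ht : FN t] [hu : FN u] : FN (fun v => g (t v) (u v)) := by
  refine ⟨?_⟩
  have h2 : S1N (fun v : Fin 3 → ℕ => v 0 = g (v 1) (v 2)) := h.out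
  exact S1N.comp3 (P := fun x y z => x = g y z) h2 (fun w : Fin (m+1) → ℕ => w 0) (fun w => t (fun i => w i.succ)) (fun w => u (fun i => w i.succ))
instance FN.add {m : ℕ} (t u : (Fin m → ℕ) → ℕ) [ht : FN t] [hu : FN u] : FN (fun v => t v + u v) :=
  FN.comp2 (g := fun x y => x + y) (FN.ofTD (fun M v => v 0 + v 1) inferInstance (fun v => by simp [cst])) t u
instance FN.mul {m : ℕ} (t u : (Fin m → ℕ) → ℕ) [ht : FN t] [hu : FN u] : FN (fun v => t v * u v) :=
  FN.comp2 (g := fun x y => x * y) (FN.ofTD (fun M v => v 0 * v 1) inferInstance (fun v => by simp [cst])) t u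
instance FN.J {m : ℕ} (t u : (Fin m → ℕ) → ℕ) [ht : FN t] [hu : FN u] : FN (fun v => J (t v) (u v)) :=
  FN.comp2 (g := fun x y => Guaspari.J x y) (FN.ofTD (fun M v => Guaspari.J (v 0) (v 1)) inferInstance (fun v => by simp [cst, cast_J])) t u
instance S1N.eq {m : ℕ} (t u : (Fin m → ℕ) → ℕ) [ht : FN t] [hu : FN u] : S1N (fun v => t v = u v) :=
  S1N.comp2 (P := fun x y => x = y) (S1N.of (fun M v => v 0 = v 1) inferInstance (fun v => by simp [cst])) t u
instance S1N.le {m : ℕ} (t u : (Fin m → ℕ) → ℕ) [ht : FN t] [hu : FN u] : S1N (fun v => t v ≤ u v) :=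
  S1N.comp2 (P := fun x y => x ≤ y) (S1N.of (fun M v => v 0 ≤ v 1) inferInstance (fun v => by simp [cst])) t u
instance S1N.lt {m : ℕ} (t u : (Fin m → ℕ) → ℕ) [ht : FN t] [hu : FN u] : S1N (fun v => t v < u v) :=
  S1N.comp2 (P := fun x y => x < y) (S1N.of (fun M v => v 0 < v 1) inferInstance (fun v => by simp [cst])) t u
instance S1N.ne {m : ℕ} (t u : (Fin m → ℕ) → ℕ) [ht : FN t] [hu : FN u] : S1N (fun v => t v ≠ u v) :=
  S1N.comp2 (P := fun x y => x ≠ y) (S1N.of (fun M v => v 0 ≠ v 1) inferInstance (fun v => by simp [cst])) t u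
instance S1N.ball {m : ℕ} (t : (Fin m → ℕ) → ℕ) [ht : FN t] (P : (Fin m → ℕ) → ℕ → Prop)
    [h : S1N (fun w : Fin (m+1) → ℕ => P (fun i => w i.succ) (w 0))] : S1N (fun v => ∀ x, x ≤ t v → P v x) := by
  have h1 : S1N (fun w : Fin (m+1) → ℕ => ∀ x, x ≤ w 0 → P (fun i => w i.succ) x) := by
    refine @S1N.ball0 (m+1) 0 (fun w x => P (fun i => w i.succ) x) ?_
    exact h.weak' (fun i => Fin.cases 0 (fun i => i.succ.succ) i) (fun v => by simp)
  have : S1N (fun v : Fin m → ℕ => ∃ b, b = t v ∧ ∀ x, x ≤ b → P v x) := by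
    refine @S1N.ex _ _ ?_
    exact @S1N.and _ _ _ inferInstance h1
  exact this.congr (fun v => by simp)
instance S1N.balllt {m : ℕ} (t : (Fin m → ℕ) → ℕ) [ht : FN t] (P : (Fin m → ℕ) → ℕ → Prop)
    [h : S1N (fun w : Fin (m+1) → ℕ => P (fun i => w i.succ) (w 0))] : S1N (fun v => ∀ x, x < t v → P v x) := by
  have h1 : S1N (fun w : Fin (m+1) → ℕ => ∀ x, x ≤ w 0 → P (fun i => w i.succ) x) := by
    refine @S1N.ball0 (m+1) 0 (fun w x => P (fun i => w i.succ) x) ?_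
    exact h.weak' (fun i => Fin.cases 0 (fun i => i.succ.succ) i) (fun v => by simp)
  have : S1N (fun v : Fin m → ℕ => t v = 0 ∨ ∃ b, b + 1 = t v ∧ ∀ x, x ≤ b → P v x) := by
    refine @S1N.or _ _ _ inferInstance (@S1N.ex _ _ ?_)
    exact @S1N.and _ _ _ inferInstance h1
  refine this.congr (fun v => ?_)
  constructor
  · rintro (h | ⟨b, hb, h⟩) x hx
    · omega
    · exact h x (by omega)
  · intro h
    rcases Nat.eq_zero_or_pos (t v) with h0 | h0
    · exact Or.inl h0
    · exact Or.inr ⟨t v - 1, by omega, fun x hx => h x (by omega)⟩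
instance FN.pair {m : ℕ} (t u : (Fin m → ℕ) → ℕ) [ht : FN t] [hu : FN u] : FN (fun v => Nat.pair (t v) (u v)) := by
  refine FN.comp2 (g := fun x y => Nat.pair x y) ⟨?_⟩ t u
  have : S1N (fun w : Fin 3 → ℕ => (w 1 < w 2 ∧ w 0 = w 2 * w 2 + w 1) ∨ (w 2 ≤ w 1 ∧ w 0 = w 1 * w 1 + w 1 + w 2)) := inferInstance
  refine this.congr (fun w => ?_)
  show _ ↔ w 0 = Nat.pair (w 1) (w 2)
  unfold Nat.pair
  split_ifs <;> omega

/-- least fixed points -/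
theorem S1N.lfp (R : ℕ → ℕ → ℕ → Prop) (hR : S1N (fun v : Fin 3 → ℕ => R (v 0) (v 1) (v 2))) (D : ℕ → Prop)
    (hD : ∀ S : ℕ → Prop, (∀ e, S e → e = 0 ∨ ∃ p q, R e p q ∧ S p ∧ S q) → ∀ e, S e → D e)
    (hD' : ∀ S : ℕ → Prop, S 0 → (∀ e p q, R e p q → S p → S q → S e) → ∀ e, D e → S e) :
    S1N (fun v : Fin 1 → ℕ => D (v 0)) := by
  obtain ⟨P, hP, h⟩ := hR
  have hP' : S1 P := ⟨hP⟩
  have hh : ∀ a b c : ℕ, R a b c ↔ P NN ![(a : NN), (b : NN), (c : NN)] := by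
    intro a b c
    rw [show (![(a : NN), (b : NN), (c : NN)] : Fin 3 → NN) = cst NN ![a, b, c] by
      funext i; fin_cases i <;> rfl, ← h]
    rfl
  let Q : ∀ M : PAM, M → M → Prop := fun M e l => e = 0 ∨ ∃ p q, P M ![e, p, q] ∧ mem p l ∧ mem q l
  have hQ : ∀ M, Mono (Q M) := by
    intro M e l l' h hq
    rcases hq with h0 | ⟨p, q, h1, h2, h3⟩
    · exact Or.inl h0
    · exact Or.inr ⟨p, q, h1, h _ h2, h _ h3⟩
  have h4 : S1 (fun M (w : Fin 4 → M) => P M ![w 2, w 1, w 0]) :=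
    (S1.weak P (![2, 1, 0] : Fin 3 → Fin 4)).congr (fun M v => by
      rw [show (fun i => v ((![2, 1, 0] : Fin 3 → Fin 4) i)) = ![v 2, v 1, v 0] by funext i; fin_cases i <;> rfl])
  have h5 : S1 (fun M (w : Fin 2 → M) => Q M (w 0) (w 1)) := by
    refine @S1.or _ _ _ inferInstance (@S1.ex _ _ (@S1.ex _ _ ?_))
    exact @S1.and _ _ _ h4 inferInstance
  have h5' : S1 (fun M (w : Fin 4 → M) => Q M (w 0) (w 1)) := by
    have := h5
    exact (S1.weak (fun M (w : Fin 2 → M) => Q M (w 0) (w 1)) (![0, 1] : Fin 2 → Fin 4))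
  have h6 : S1 (fun M (w : Fin 1 → M) => Lfp (Q M) (w 0)) := by
    unfold Lfp
    have : S1 (fun M (w : Fin 2 → M) => Just (Q M) (w 0)) := @S1.just 2 (fun M v => Q M) h5' (fun M w => w 0) inferInstance
    refine @S1.ex _ _ (@S1.and _ _ _ this inferInstance)
  refine S1N.of _ h6 (fun v => ?_)
  constructor
  · intro hv
    refine hD' (fun k => Lfp (Q NN) (k : NN)) ?_ ?_ _ hv
    · obtain ⟨l, hl⟩ := just_empty (Q := Q NN)
      exact lfp_intro (hQ _) hl (Or.inl (by simp))
    · rintro e p q hr ⟨l1, h1, h1'⟩ ⟨l2, h2, h2'⟩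
      obtain ⟨k, hk, hk'⟩ := just_merge (hQ _) h1 h2
      exact lfp_intro (hQ _) hk (Or.inr ⟨p, q, (hh _ _ _).1 hr, hk' _ (Or.inl h1'), hk' _ (Or.inr h2')⟩)
  · rintro ⟨l, hl, h7⟩
    refine hD (fun k => mem (k : NN) l) ?_ _ h7
    intro e he
    rcases just_iff.1 hl _ he with h0 | ⟨p, q, h1, h2, h3⟩
    · exact Or.inl (by exact_mod_cast h0)
    · obtain ⟨p, rfl⟩ := nn_std p
      obtain ⟨q, rfl⟩ := nn_std q
      exact Or.inr ⟨p, q, (hh _ _ _).2 h1, h2, h3⟩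

/-- Partial recursive functions have `Σ₁` graphs. -/
theorem S1N.partrec {f : ℕ →. ℕ} (hf : Nat.Partrec f) : S1N (fun v : Fin 2 → ℕ => v 0 ∈ f (v 1)) := by
  induction hf with
  | zero => exact (inferInstance : S1N (fun v : Fin 2 → ℕ => v 0 = 0)).congr (fun v => by simp [pure, PFun.pure])
  | succ => exact (inferInstance : S1N (fun v : Fin 2 → ℕ => v 0 = v 1 + 1)).congr (fun v => by simp)
  | left =>
    refine (inferInstance : S1N (fun v : Fin 2 → ℕ => ∃ b, v 1 = Nat.pair (v 0) b)).congr (fun v => ?_)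
    simp only [PFun.coe_val, Part.mem_some_iff]
    constructor
    · rintro ⟨b, h⟩; rw [h]; simp
    · intro h; exact ⟨(v 1).unpair.2, by rw [h, Nat.pair_unpair]⟩
  | right =>
    refine (inferInstance : S1N (fun v : Fin 2 → ℕ => ∃ b, v 1 = Nat.pair b (v 0))).congr (fun v => ?_)
    simp only [PFun.coe_val, Part.mem_some_iff]
    constructor
    · rintro ⟨b, h⟩; rw [h]; simp
    · intro h; exact ⟨(v 1).unpair.1, by rw [h, Nat.pair_unpair]⟩
  | @pair f g _ _ h1 h2 =>
    have h1' : ∀ (m : ℕ) (t u : (Fin m → ℕ) → ℕ) [FN t] [FN u], S1N (fun v => t v ∈ f (u v)) := fun m t u _ _ => S1N.comp2 (P := fun x y => x ∈ f y) h1 t u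
    have h2' : ∀ (m : ℕ) (t u : (Fin m → ℕ) → ℕ) [FN t] [FN u], S1N (fun v => t v ∈ g (u v)) := fun m t u _ _ => S1N.comp2 (P := fun x y => x ∈ g y) h2 t u
    refine (inferInstance : S1N (fun v : Fin 2 → ℕ => ∃ a b, a ∈ f (v 1) ∧ b ∈ g (v 1) ∧ v 0 = Nat.pair a b)).congr (fun v => ?_)
    simp [Seq.seq]
    constructor
    · rintro ⟨a, h, b, h', e⟩; exact ⟨a, h, b, h', e.symm⟩
    · rintro ⟨a, h, b, h', e⟩; exact ⟨a, h, b, h', e.symm⟩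
  | @comp f g _ _ h1 h2 =>
    have h1' : ∀ (m : ℕ) (t u : (Fin m → ℕ) → ℕ) [FN t] [FN u], S1N (fun v => t v ∈ f (u v)) := fun m t u _ _ => S1N.comp2 (P := fun x y => x ∈ f y) h1 t u
    have h2' : ∀ (m : ℕ) (t u : (Fin m → ℕ) → ℕ) [FN t] [FN u], S1N (fun v => t v ∈ g (u v)) := fun m t u _ _ => S1N.comp2 (P := fun x y => x ∈ g y) h2 t u
    refine (inferInstance : S1N (fun v : Fin 2 → ℕ => ∃ a, a ∈ g (v 1) ∧ v 0 ∈ f a)).congr (fun v => ?_)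
    exact Part.mem_bind_iff.symm
  | @prec f g _ _ h1 h2 =>
    have h1' : ∀ (m : ℕ) (t u : (Fin m → ℕ) → ℕ) [FN t] [FN u], S1N (fun v => t v ∈ f (u v)) := fun m t u _ _ => S1N.comp2 (P := fun x y => x ∈ f y) h1 t u
    have h2' : ∀ (m : ℕ) (t u : (Fin m → ℕ) → ℕ) [FN t] [FN u], S1N (fun v => t v ∈ g (u v)) := fun m t u _ _ => S1N.comp2 (P := fun x y => x ∈ g y) h2 t u
    let F : ℕ → ℕ → Part ℕ := fun a n => n.rec (f a) fun y IH => IH >>= fun i => g (Nat.pair a (Nat.pair y i))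
    have hF : ∀ y a n, y ∈ F a (n+1) ↔ ∃ i, i ∈ F a n ∧ y ∈ g (Nat.pair a (Nat.pair n i)) := by
      intro y a n; simp [F]
    have key : S1N (fun v : Fin 1 → ℕ => v 0 = 0 ∨ ∃ a n y, v 0 = Nat.pair (Nat.pair a n) y + 1 ∧ y ∈ F a n) := by
      refine S1N.lfp (fun e p q => ∃ a n y i, (p = 0 ∧ q = 0 ∧ e = Nat.pair (Nat.pair a 0) y + 1 ∧ y ∈ f a) ∨
        (q = 0 ∧ p = Nat.pair (Nat.pair a n) i + 1 ∧ e = Nat.pair (Nat.pair a (n+1)) y + 1 ∧ y ∈ g (Nat.pair a (Nat.pair n i))))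
        inferInstance (fun e => e = 0 ∨ ∃ a n y, e = Nat.pair (Nat.pair a n) y + 1 ∧ y ∈ F a n) ?_ ?_
      · intro S hS e he
        have : ∀ n a y, S (Nat.pair (Nat.pair a n) y + 1) → y ∈ F a n := by
          intro n
          induction n with
          | zero =>
            intro a y h
            rcases hS _ h with h0 | ⟨p, q, ⟨a', n', y', i, h | h⟩, _⟩
            · omega
            · obtain ⟨_, _, h, h'⟩ := h
              simp [Nat.pair_eq_pair] at h
              rw [h.1, h.2]; exact h'
            · obtain ⟨_, _, h, h'⟩ := h
              simp [Nat.pair_eq_pair] at h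
          | succ n ih =>
            intro a y h
            rcases hS _ h with h0 | ⟨p, q, ⟨a', n', y', i, h | h⟩, hp, _⟩
            · omega
            · obtain ⟨_, _, h, h'⟩ := h
              simp [Nat.pair_eq_pair] at h
            · obtain ⟨_, rfl, h, h'⟩ := h
              simp [Nat.pair_eq_pair] at h
              obtain ⟨⟨rfl, rfl⟩, rfl⟩ := h
              rw [hF]
              exact ⟨i, ih _ _ hp, h'⟩
        rcases hS e he with h0 | ⟨p, q, ⟨a', n', y', i, h | h⟩, _⟩
        · exact Or.inl h0
        · obtain ⟨_, _, rfl, _⟩ := h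
          exact Or.inr ⟨_, _, _, rfl, this _ _ _ he⟩
        · obtain ⟨_, _, rfl, _⟩ := h
          exact Or.inr ⟨_, _, _, rfl, this _ _ _ he⟩
      · intro S h0 hS e he
        rcases he with rfl | ⟨a, n, y, rfl, hy⟩
        · exact h0
        · induction n generalizing y with
          | zero => exact hS _ 0 0 ⟨a, 0, y, 0, Or.inl ⟨rfl, rfl, rfl, hy⟩⟩ h0 h0
          | succ n ih =>
            rw [hF] at hy
            obtain ⟨i, hi, hy⟩ := hy
            exact hS _ _ 0 ⟨a, n, y, i, Or.inr ⟨rfl, rfl, rfl, hy⟩⟩ (ih i hi) h0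
    have key' := fun m t a => S1N.comp1 (P := fun e => e = 0 ∨ ∃ a n y, e = Nat.pair (Nat.pair a n) y + 1 ∧ y ∈ F a n) key (m := m) t (ht := a)
    refine (key' 2 (fun v => Nat.pair (v 1) (v 0) + 1) inferInstance).congr (fun v => ?_)
    constructor
    · rintro (h | ⟨a, n, y, h, h'⟩)
      · omega
      · simp [Nat.pair_eq_pair] at h
        rw [h.1, h.2]
        simpa [Nat.unpaired, F] using h'
    · intro h
      refine Or.inr ⟨(v 1).unpair.1, (v 1).unpair.2, v 0, by simp, ?_⟩
      simpa [Nat.unpaired, F] using h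
  | @rfind f _ h1 =>
    have h1' : ∀ (m : ℕ) (t u : (Fin m → ℕ) → ℕ) [FN t] [FN u], S1N (fun v => t v ∈ f (u v)) := fun m t u _ _ => S1N.comp2 (P := fun x y => x ∈ f y) h1 t u
    refine (inferInstance : S1N (fun v : Fin 2 → ℕ => 0 ∈ f (Nat.pair (v 1) (v 0)) ∧ ∀ n, n < v 0 → ∃ z, z ∈ f (Nat.pair (v 1) n) ∧ z ≠ 0)).congr (fun v => ?_)
    refine Iff.trans ?_ (Nat.mem_rfind (p := fun n => Part.map (fun m => decide (m = 0)) (f (Nat.pair (v 1) n)))).symm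
    constructor
    · rintro ⟨h, h'⟩
      refine ⟨Part.mem_map_iff _ |>.2 ⟨0, h, by simp⟩, fun {n} hn => ?_⟩
      obtain ⟨z, hz, hz'⟩ := h' n hn
      exact Part.mem_map_iff _ |>.2 ⟨z, hz, by simpa using hz'⟩
    · rintro ⟨h, h'⟩
      refine ⟨?_, fun n hn => ?_⟩
      · obtain ⟨z, hz, hz'⟩ := (Part.mem_map_iff _).1 h
        simp at hz'; rwa [← hz']
      · obtain ⟨z, hz, hz'⟩ := (Part.mem_map_iff _).1 (h' hn)
        exact ⟨z, hz, by simpa using hz'⟩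

theorem S1N.re {P : ℕ → Prop} (h : REPred P) : S1N (fun v : Fin 1 → ℕ => P (v 0)) := by
  have h : Partrec fun a => Part.assert (P a) fun _ => Part.some () := h
  have h2 := S1N.partrec h
  have : S1N (fun v : Fin 1 → ℕ => ∃ x, x ∈ (Part.bind (Part.some (v 0)) fun a => (Part.assert (P a) fun _ => Part.some ()).map Encodable.encode)) := by
    refine @S1N.ex _ _ ?_
    exact h2.weak' (ρ := ![0, 1]) (fun v => by simp)
  refine this.congr (fun v => ?_)
  simp
theorem FN.comput {f : ℕ → ℕ} (h : Computable f) : FN (fun v : Fin 1 → ℕ => f (v 0)) := by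
  have h2 := S1N.partrec (Partrec.nat_iff.1 h)
  exact ⟨h2.congr (fun v => by simp)⟩

/-! ### Provability is Σ₁ -/

/-- triple codes -/
def c3 (k p q : ℕ) : ℕ := Nat.pair k (Nat.pair p q) + 1
def k0 (n : ℕ) : ℕ := (n - 1).unpair.1
def k1 (n : ℕ) : ℕ := (n - 1).unpair.2.unpair.1
def k2 (n : ℕ) : ℕ := (n - 1).unpair.2.unpair.2
@[simp] theorem k0_c3 (k p q : ℕ) : k0 (c3 k p q) = k := by simp [k0, c3]
@[simp] theorem k1_c3 (k p q : ℕ) : k1 (c3 k p q) = p := by simp [k1, c3]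
@[simp] theorem k2_c3 (k p q : ℕ) : k2 (c3 k p q) = q := by simp [k2, c3]
@[simp] theorem c3_ne (k p q : ℕ) : c3 k p q ≠ 0 := by simp [c3]
@[simp] theorem c3_ne' (k p q : ℕ) : 0 ≠ c3 k p q := by simp [c3]
@[simp] theorem c3_inj (k p q k' p' q' : ℕ) : c3 k p q = c3 k' p' q' ↔ k = k' ∧ p = p' ∧ q = q' := by
  simp [c3, Nat.pair_eq_pair]
theorem k1_lt {n : ℕ} (h : n ≠ 0) : k1 n < n := by
  have h1 := Nat.unpair_right_le (n - 1)
  have h2 := Nat.unpair_left_le (n - 1).unpair.2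
  unfold k1; omega
theorem k2_lt {n : ℕ} (h : n ≠ 0) : k2 n < n := by
  have h1 := Nat.unpair_right_le (n - 1)
  have h2 := Nat.unpair_right_le (n - 1).unpair.2
  unfold k2; omega
instance FN.c3 {m : ℕ} (s t u : (Fin m → ℕ) → ℕ) [hs : FN s] [ht : FN t] [hu : FN u] : FN (fun v => c3 (s v) (t v) (u v)) :=
  (inferInstance : FN (fun v => Nat.pair (s v) (Nat.pair (t v) (u v)) + 1))

/-- codes of terms -/
def ownT {m : ℕ} : LA.Term (Empty ⊕ Fin m) → ℕ
  | Term.var (Sum.inl i) => i.elim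
  | Term.var (Sum.inr j) => c3 0 j.rev 0
  | @Term.func _ _ 0 _ _ => 0
  | @Term.func _ _ 1 _ ts => c3 3 (ownT (ts 0)) (ownT (ts 0))
  | @Term.func _ _ 2 f ts => c3 (cond (f : Bool) 2 1) (ownT (ts 0)) (ownT (ts 1))
  | @Term.func _ _ (_ + 3) f _ => (f : Empty).elim
/-- codes of formulas -/
def own : {m : ℕ} → LA.BoundedFormula Empty m → ℕ
  | _, BoundedFormula.falsum => 0
  | _, BoundedFormula.equal t u => c3 2 (ownT t) (ownT u)
  | _, @BoundedFormula.rel _ _ _ 0 R _ => (R : Empty).elim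
  | _, @BoundedFormula.rel _ _ _ 1 R _ => (R : Empty).elim
  | _, @BoundedFormula.rel _ _ _ 2 _ ts => c3 3 (ownT (ts 0)) (ownT (ts 1))
  | _, @BoundedFormula.rel _ _ _ (_ + 3) R _ => (R : Empty).elim
  | _, BoundedFormula.imp f g => c3 0 (own f) (own g)
  | _, BoundedFormula.all f => c3 1 (own f) 0

theorem term_ind {m : ℕ} {P : LA.Term (Empty ⊕ Fin m) → Prop} (hv : ∀ j, P (vT j)) (h0 : P zeroT)
    (hs : ∀ t, P t → P (succT t)) (ha : ∀ t u, P t → P u → P (addT t u)) (hm : ∀ t u, P t → P u → P (mulT t u))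
    (t : LA.Term (Empty ⊕ Fin m)) : P t := by
  induction t with
  | var i =>
    rcases i with i | i
    · exact i.elim
    · exact hv i
  | @func n f ts ih =>
    match n, f, ts, ih with
    | 0, f, ts, ih =>
      have : Term.func f ts = zeroT := by
        unfold zeroT Constants.term
        congr 1
        exact Subsingleton.elim _ _
      rw [this]; exact h0
    | 1, f, ts, ih =>
      have : Term.func f ts = succT (ts 0) := by
        unfold succT Functions.apply₁
        congr 1
        funext i; rw [Subsingleton.elim i 0]; rfl
      rw [this]; exact hs _ (ih 0)
    | 2, f, ts, ih =>
      have hts : ts = ![ts 0, ts 1] := by funext i; fin_cases i <;> rfl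
      match f with
      | false =>
        have : Term.func (L := LA) (l := 2) false ts = addT (ts 0) (ts 1) := by
          unfold addT Functions.apply₂
          congr 1
        rw [this]; exact ha _ _ (ih 0) (ih 1)
      | true =>
        have : Term.func (L := LA) (l := 2) true ts = mulT (ts 0) (ts 1) := by
          unfold mulT Functions.apply₂
          congr 1
        rw [this]; exact hm _ _ (ih 0) (ih 1)
    | (n+3), f, ts, ih => exact (f : Empty).elim
theorem fml_ind {P : ∀ {m : ℕ}, LA.BoundedFormula Empty m → Prop} (hb : ∀ {m}, P (⊥ : LA.BoundedFormula Empty m))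
    (he : ∀ {m} (t u : LA.Term (Empty ⊕ Fin m)), P (t =' u)) (hl : ∀ {m} (t u : LA.Term (Empty ⊕ Fin m)), P (leF t u))
    (hi : ∀ {m} (f g : LA.BoundedFormula Empty m), P f → P g → P (f ⟹ g))
    (ha : ∀ {m} (f : LA.BoundedFormula Empty (m+1)), P f → P (∀' f))
    {m : ℕ} (f : LA.BoundedFormula Empty m) : P f := by
  induction f with
  | falsum => exact hb
  | equal t u => exact he t u
  | @rel m l R ts =>
    match l, R, ts with
    | 0, R, ts => exact (R : Empty).elim
    | 1, R, ts => exact (R : Empty).elim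
    | 2, R, ts =>
      have : BoundedFormula.rel R ts = leF (ts 0) (ts 1) := by
        unfold leF Relations.boundedFormula₂ Relations.boundedFormula
        congr 1
        funext i; fin_cases i <;> rfl
      rw [this]; exact hl _ _
    | (n+3), R, ts => exact (R : Empty).elim
  | imp f g h1 h2 => exact hi _ _ h1 h2
  | all f h => exact ha _ h
theorem ownT_v {m : ℕ} (j : Fin m) : ownT (vT j) = c3 0 j.rev 0 := by simp [vT, ownT]
theorem ownT_z {m : ℕ} : ownT (m := m) zeroT = 0 := by simp [zeroT, Constants.term, ownT]
theorem ownT_s {m : ℕ} (t : LA.Term (Empty ⊕ Fin m)) : ownT (succT t) = c3 3 (ownT t) (ownT t) := by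
  simp [succT, Functions.apply₁, ownT]
theorem ownT_a {m : ℕ} (t u : LA.Term (Empty ⊕ Fin m)) : ownT (addT t u) = c3 1 (ownT t) (ownT u) := by
  simp [addT, Functions.apply₂, ownT]
theorem ownT_m {m : ℕ} (t u : LA.Term (Empty ⊕ Fin m)) : ownT (mulT t u) = c3 2 (ownT t) (ownT u) := by
  simp [mulT, Functions.apply₂, ownT]
theorem own_bot {m : ℕ} : own (⊥ : LA.BoundedFormula Empty m) = 0 := by
  show own BoundedFormula.falsum = 0
  simp [own]
theorem own_eq {m : ℕ} (t u : LA.Term (Empty ⊕ Fin m)) : own (t =' u) = c3 2 (ownT t) (ownT u) := by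
  simp [Term.bdEqual, own]
theorem own_le {m : ℕ} (t u : LA.Term (Empty ⊕ Fin m)) : own (leF t u) = c3 3 (ownT t) (ownT u) := by
  simp [leF, Relations.boundedFormula₂, Relations.boundedFormula, own]
theorem own_imp {m : ℕ} (f g : LA.BoundedFormula Empty m) : own (f ⟹ g) = c3 0 (own f) (own g) := by
  simp [own]
theorem own_all {m : ℕ} (f : LA.BoundedFormula Empty (m+1)) : own (∀' f) = c3 1 (own f) 0 := by
  simp [own]

/-- stream cons -/
def scons {A : Type} (x : A) (e : ℕ → A) : ℕ → A := fun n => Nat.casesOn n x e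
@[simp] theorem scons_zero {A : Type} (x : A) (e : ℕ → A) : scons x e 0 = x := rfl
@[simp] theorem scons_succ {A : Type} (x : A) (e : ℕ → A) (n : ℕ) : scons x e (n+1) = e n := rfl

section sem
variable {M : PAM}
/-- the operations -/
noncomputable def opM (b : ℕ) (x y : M) : M := if b = 0 then x + y else if b = 1 then x * y else x + 1
/-- the relations -/
def relM (b : ℕ) (x y : M) : Prop := if b = 0 then x = y else x ≤ y
/-- value of a coded term -/
noncomputable def vl (n : ℕ) (e : ℕ → M) : M :=
  if h : n = 0 then 0 else if k0 n = 0 then e (k1 n) else opM (k0 n - 1) (vl (k1 n) e) (vl (k2 n) e)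
termination_by n
decreasing_by
  · exact k1_lt h
  · exact k2_lt h
/-- truth of a coded formula -/
def St (n : ℕ) (e : ℕ → M) : Prop :=
  if h : n = 0 then False else if k0 n = 0 then (St (k1 n) e → St (k2 n) e) else
    if k0 n = 1 then ∀ x : M, St (k1 n) (scons x e) else relM (k0 n - 2) (vl (k1 n) e) (vl (k2 n) e)
termination_by n
decreasing_by
  · exact k1_lt h
  · exact k2_lt h
  · exact k1_lt h
open Classical in
/-- interpretation of elements and assignments -/
noncomputable def Ip (M : PAM) (n : ℕ) : ℕ → M :=
  if h : n = 0 then fun _ => 0 else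
  if k0 n = 0 then scons (Ip M (k1 n) 0) (Ip M (k2 n)) else
  if k0 n = 1 then fun _ => vl (k1 n) (Ip M (k2 n)) else
  if k0 n = 2 then fun _ => @Classical.epsilon M ⟨0⟩ (fun x => ¬ St (k1 n) (scons x (Ip M (k2 n)))) else
  if k0 n = 3 then fun _ => (k1 n : M) else
  fun _ => opM (k0 n - 4) (Ip M (k1 n) 0) (Ip M (k2 n) 0)
termination_by n
decreasing_by
  all_goals first | exact k1_lt h | exact k2_lt h
/-- the induced valuation -/
def Vv (M : PAM) (i : ℕ) : Prop :=
  if k0 i = 0 then St (k1 i) (Ip M (k2 i)) else relM (k0 i - 1) (Ip M (k1 i) 0) (Ip M (k2 i) 0)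

theorem vl_zero (e : ℕ → M) : vl 0 e = 0 := by rw [vl]; simp
theorem vl_var (i z : ℕ) (e : ℕ → M) : vl (c3 0 i z) e = e i := by rw [vl]; simp
theorem vl_op (b t u : ℕ) (e : ℕ → M) : vl (c3 (b+1) t u) e = opM b (vl t e) (vl u e) := by rw [vl]; simp
theorem St_zero (e : ℕ → M) : ¬ St 0 e := by rw [St]; simp
theorem St_imp (f g : ℕ) (e : ℕ → M) : St (c3 0 f g) e ↔ (St f e → St g e) := by rw [St]; simp
theorem St_all (f z : ℕ) (e : ℕ → M) : St (c3 1 f z) e ↔ ∀ x, St f (scons x e) := by rw [St]; simp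
theorem St_rel (b t u : ℕ) (e : ℕ → M) : St (c3 (b+2) t u) e ↔ relM b (vl t e) (vl u e) := by rw [St]; simp
theorem Ip_zero (i : ℕ) : Ip M 0 i = 0 := by rw [Ip]; simp
theorem Ip_cons (d a : ℕ) : Ip M (c3 0 d a) = scons (Ip M d 0) (Ip M a) := by rw [Ip]; simp
theorem Ip_el (t a i : ℕ) : Ip M (c3 1 t a) i = vl t (Ip M a) := by rw [Ip]; simp
theorem Ip_wit (f a i : ℕ) (h : ∃ x, ¬ St f (scons x (Ip M a))) : ¬ St f (scons (Ip M (c3 2 f a) i) (Ip M a)) := by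
  rw [Ip]; simp
  exact @Classical.epsilon_spec_aux M ⟨0⟩ (fun x => ¬ St f (scons x (Ip M a))) h
theorem Ip_num (k z i : ℕ) : Ip M (c3 3 k z) i = (k : M) := by rw [Ip]; simp
theorem Ip_op (b x y i : ℕ) : Ip M (c3 (b+4) x y) i = opM b (Ip M x 0) (Ip M y 0) := by rw [Ip]; simp
theorem Vv_F (f a : ℕ) : Vv M (c3 0 f a) ↔ St f (Ip M a) := by simp [Vv]
theorem Vv_R (b x y : ℕ) : Vv M (c3 (b+1) x y) ↔ relM b (Ip M x 0) (Ip M y 0) := by simp [Vv]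

theorem vl_own {m : ℕ} (t : LA.Term (Empty ⊕ Fin m)) (v : Fin m → M) (e : ℕ → M) (h : ∀ i : Fin m, e i = v i) :
    vl (ownT t) e = Tz t M v := by
  induction t using term_ind with
  | hv j => rw [ownT_v, vl_var, h]; rfl
  | h0 => rw [ownT_z, vl_zero]; exact (realize_zeroT _).symm
  | hs t ih => rw [ownT_s, vl_op, ih]; simp only [opM, Tz, realize_succT, sc_eq]; simp
  | ha t u h1 h2 => rw [ownT_a, vl_op, h1, h2]; simp only [opM, Tz, realize_addT]; simp
  | hm t u h1 h2 => rw [ownT_m, vl_op, h1, h2]; simp only [opM, Tz, realize_mulT]; simp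
theorem St_own {m : ℕ} (f : LA.BoundedFormula Empty m) : ∀ (v : Fin m → M) (e : ℕ → M) (h : ∀ i : Fin m, e i = v i),
    St (own f) e ↔ Rz f M v := by
  induction f using fml_ind with
  | hb => intro v e h; rw [own_bot, Rz_bot]; simp [St_zero]
  | he t u => intro v e h; rw [own_eq, Rz_eq, St_rel, vl_own t v e h, vl_own u v e h]; simp [relM]
  | hl t u => intro v e h; rw [own_le, Rz_le, St_rel, vl_own t v e h, vl_own u v e h]; simp [relM]
  | hi f g h1 h2 => intro v e h; rw [own_imp, Rz_imp, St_imp, h1 v e h, h2 v e h]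
  | ha f ih =>
    intro v e h; rw [own_all, Rz_all, St_all]
    refine forall_congr' (fun x => ih _ _ (fun i => ?_))
    refine Fin.cases ?_ (fun i => ?_) i
    · simp
    · simp [h]
end sem

/-- conflicting triples of literals -/
def Cf (Ax : ℕ → Prop) (ψ k p q r : ℕ) : Prop := ∃ b x y z w,
  (p = 2 * c3 1 x x + 1 ∧ q = p ∧ r = p) ∨
  (p = 2 * c3 1 x y ∧ q = 2 * c3 (b+1) x z ∧ r = 2 * c3 (b+1) y z + 1) ∨
  (p = 2 * c3 1 x y ∧ q = 2 * c3 (b+1) z x ∧ r = 2 * c3 (b+1) z y + 1) ∨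
  (p = 2 * c3 1 x y ∧ q = p ∧ r = 2 * c3 1 (c3 (b+4) x z) (c3 (b+4) y z) + 1) ∨
  (p = 2 * c3 1 x y ∧ q = p ∧ r = 2 * c3 1 (c3 (b+4) z x) (c3 (b+4) z y) + 1) ∨
  (p = 2 * c3 1 (c3 1 (c3 0 0 0) (c3 0 x y)) x + 1 ∧ q = p ∧ r = p) ∨
  (p = 2 * c3 1 (c3 1 (c3 0 (z+1) 0) (c3 0 x y)) (c3 1 (c3 0 z 0) y) + 1 ∧ q = p ∧ r = p) ∨
  (p = 2 * c3 1 (c3 1 0 x) 0 + 1 ∧ q = p ∧ r = p) ∨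
  (p = 2 * c3 1 (c3 1 (c3 (b+1) x y) z) (c3 (b+4) (c3 1 x z) (c3 1 y z)) + 1 ∧ q = p ∧ r = p) ∨
  (p = 2 * c3 0 (c3 (b+2) x y) z ∧ q = p ∧ r = 2 * c3 (b+1) (c3 1 x z) (c3 1 y z) + 1) ∨
  (p = 2 * c3 0 (c3 (b+2) x y) z + 1 ∧ q = p ∧ r = 2 * c3 (b+1) (c3 1 x z) (c3 1 y z)) ∨
  (p = 2 * c3 0 0 x ∧ q = p ∧ r = p) ∨
  (p = 2 * c3 0 (c3 0 x y) z ∧ q = 2 * c3 0 x z ∧ r = 2 * c3 0 y z + 1) ∨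
  (p = 2 * c3 0 (c3 0 x y) z + 1 ∧ q = p ∧ r = 2 * c3 0 x z + 1) ∨
  (p = 2 * c3 0 (c3 0 x y) z + 1 ∧ q = p ∧ r = 2 * c3 0 y z) ∨
  (p = 2 * c3 0 (c3 1 x 0) z ∧ q = p ∧ r = 2 * c3 0 x (c3 0 w z) + 1) ∨
  (p = 2 * c3 0 (c3 1 x 0) z + 1 ∧ q = p ∧ r = 2 * c3 0 x (c3 0 (c3 2 x z) z)) ∨
  (Ax x ∧ p = 2 * c3 0 x 0 + 1 ∧ q = p ∧ r = p) ∨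
  (p = 2 * c3 0 ψ (c3 0 (c3 3 k 0) 0) ∧ q = p ∧ r = p) ∨
  (p = 2 * c3 1 (c3 3 0 0) 0 + 1 ∧ q = p ∧ r = p) ∨
  (p = 2 * c3 1 (c3 3 (x+1) 0) (c3 6 (c3 3 x 0) (c3 3 x 0)) + 1 ∧ q = p ∧ r = p)
/-- truth of literals -/
def Tl (s : ℕ → Prop) (l : ℕ) : Prop := ∃ i, (l = 2 * i ∧ s i) ∨ (l = 2 * i + 1 ∧ ¬ s i)
theorem Tl_pos (s : ℕ → Prop) (i : ℕ) : Tl s (2 * i) ↔ s i := by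
  constructor
  · rintro ⟨j, ⟨h, h'⟩ | ⟨h, h'⟩⟩
    · rwa [show i = j by omega]
    · omega
  · intro h; exact ⟨i, Or.inl ⟨rfl, h⟩⟩
theorem Tl_neg (s : ℕ → Prop) (i : ℕ) : Tl s (2 * i + 1) ↔ ¬ s i := by
  constructor
  · rintro ⟨j, ⟨h, h'⟩ | ⟨h, h'⟩⟩
    · omega
    · rwa [show i = j by omega]
  · intro h; exact ⟨i, Or.inr ⟨rfl, h⟩⟩
/-- no conflicts -/
def NC (Ax : ℕ → Prop) (ψ k : ℕ) (s : ℕ → Prop) : Prop := ∀ p q r, Cf Ax ψ k p q r → ¬ (Tl s p ∧ Tl s q ∧ Tl s r)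

theorem NC_sound (Ax : ℕ → Prop) (ψ k : ℕ) (M : PAM) (hA : ∀ x, Ax x → St x (Ip M 0))
    (hψ : ¬ St ψ (Ip M (c3 0 (c3 3 k 0) 0))) : NC Ax ψ k (Vv M) := by
  rintro p q r ⟨b, x, y, z, w, h⟩
  rcases h with h | h | h | h | h | h | h | h | h | h | h | h | h | h | h | h | h | h | h | h | h
  · obtain ⟨rfl, rfl, rfl⟩ := h
    simp only [Tl_pos, Tl_neg, Vv_F, Vv_R (b := 0)]; simp [relM]
  · obtain ⟨rfl, rfl, rfl⟩ := h
    simp only [Tl_pos, Tl_neg, Vv_F, Vv_R, Vv_R (b := 0)]; simp [relM]; intro h; simp [h]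
  · obtain ⟨rfl, rfl, rfl⟩ := h
    simp only [Tl_pos, Tl_neg, Vv_F, Vv_R, Vv_R (b := 0)]; simp [relM]; intro h; simp [h]
  · obtain ⟨rfl, rfl, rfl⟩ := h
    simp only [Tl_pos, Tl_neg, Vv_F, Vv_R, Vv_R (b := 0)]; simp [relM, Ip_op]; intro h; simp [h]
  · obtain ⟨rfl, rfl, rfl⟩ := h
    simp only [Tl_pos, Tl_neg, Vv_F, Vv_R, Vv_R (b := 0)]; simp [relM, Ip_op]; intro h; simp [h]
  · obtain ⟨rfl, rfl, rfl⟩ := h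
    simp only [Tl_pos, Tl_neg, Vv_F, Vv_R, Vv_R (b := 0)]; simp [relM, Ip_el, Ip_cons, vl_var]
  · obtain ⟨rfl, rfl, rfl⟩ := h
    simp only [Tl_pos, Tl_neg, Vv_F, Vv_R, Vv_R (b := 0)]; simp [relM, Ip_el, Ip_cons, vl_var]
  · obtain ⟨rfl, rfl, rfl⟩ := h
    simp only [Tl_pos, Tl_neg, Vv_F, Vv_R, Vv_R (b := 0)]; simp [relM, Ip_el, Ip_zero, vl_zero]
  · obtain ⟨rfl, rfl, rfl⟩ := h
    simp only [Tl_pos, Tl_neg, Vv_F, Vv_R, Vv_R (b := 0)]; simp [relM, Ip_el, Ip_op, vl_op]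
  · obtain ⟨rfl, rfl, rfl⟩ := h
    simp only [Tl_pos, Tl_neg, Vv_F, Vv_R]; simp [Ip_el, St_rel]
  · obtain ⟨rfl, rfl, rfl⟩ := h
    simp only [Tl_pos, Tl_neg, Vv_F, Vv_R]; simp [Ip_el, St_rel]
  · obtain ⟨rfl, rfl, rfl⟩ := h
    simp only [Tl_pos, Tl_neg, Vv_F, Vv_R]; simp [St_zero]
  · obtain ⟨rfl, rfl, rfl⟩ := h
    simp only [Tl_pos, Tl_neg, Vv_F, Vv_R, St_imp]; tauto
  · obtain ⟨rfl, rfl, rfl⟩ := h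
    simp only [Tl_pos, Tl_neg, Vv_F, Vv_R, St_imp]; tauto
  · obtain ⟨rfl, rfl, rfl⟩ := h
    simp only [Tl_pos, Tl_neg, Vv_F, Vv_R, St_imp]; tauto
  · obtain ⟨rfl, rfl, rfl⟩ := h
    simp only [Tl_pos, Tl_neg, Vv_F, Vv_R, St_all, Ip_cons]
    rintro ⟨h, _, h'⟩; exact h' (h _)
  · obtain ⟨rfl, rfl, rfl⟩ := h
    simp only [Tl_pos, Tl_neg, Vv_F, Vv_R, St_all, Ip_cons, not_forall]
    rintro ⟨h, _, h'⟩; exact Ip_wit _ _ _ h h'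
  · obtain ⟨h, rfl, rfl, rfl⟩ := h
    simp only [Tl_pos, Tl_neg, Vv_F, Vv_R]; simp [hA _ h]
  · obtain ⟨rfl, rfl, rfl⟩ := h
    simp only [Tl_pos, Tl_neg, Vv_F, Vv_R]; simp [hψ]
  · obtain ⟨rfl, rfl, rfl⟩ := h
    simp only [Tl_pos, Tl_neg, Vv_F, Vv_R (b := 0)]; simp [relM, Ip_num, Ip_zero]
  · obtain ⟨rfl, rfl, rfl⟩ := h
    simp only [Tl_pos, Tl_neg, Vv_F, Vv_R (b := 0)]; simp [relM, Ip_num, Ip_op (b := 2), opM]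

/-- the consequences of the absence of conflicts -/
structure NCs (Ax : ℕ → Prop) (ψ k : ℕ) (s : ℕ → Prop) : Prop where
  c1 : ∀ x, s (c3 1 x x)
  c2 : ∀ b x y z, s (c3 1 x y) → s (c3 (b+1) x z) → s (c3 (b+1) y z)
  c3' : ∀ b x y z, s (c3 1 x y) → s (c3 (b+1) z x) → s (c3 (b+1) z y)
  c4 : ∀ b x y z, s (c3 1 x y) → s (c3 1 (c3 (b+4) x z) (c3 (b+4) y z))
  c5 : ∀ b x y z, s (c3 1 x y) → s (c3 1 (c3 (b+4) z x) (c3 (b+4) z y))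
  c6 : ∀ x y, s (c3 1 (c3 1 (c3 0 0 0) (c3 0 x y)) x)
  c7 : ∀ x y z, s (c3 1 (c3 1 (c3 0 (z+1) 0) (c3 0 x y)) (c3 1 (c3 0 z 0) y))
  c8 : ∀ x, s (c3 1 (c3 1 0 x) 0)
  c9 : ∀ b x y z, s (c3 1 (c3 1 (c3 (b+1) x y) z) (c3 (b+4) (c3 1 x z) (c3 1 y z)))
  c10 : ∀ b x y z, s (c3 0 (c3 (b+2) x y) z) ↔ s (c3 (b+1) (c3 1 x z) (c3 1 y z))
  c12 : ∀ x, ¬ s (c3 0 0 x)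
  c13 : ∀ x y z, s (c3 0 (c3 0 x y) z) ↔ (s (c3 0 x z) → s (c3 0 y z))
  c16 : ∀ x z w, s (c3 0 (c3 1 x 0) z) → s (c3 0 x (c3 0 w z))
  c17 : ∀ x z, s (c3 0 x (c3 0 (c3 2 x z) z)) → s (c3 0 (c3 1 x 0) z)
  c18 : ∀ x, Ax x → s (c3 0 x 0)
  c19 : ¬ s (c3 0 ψ (c3 0 (c3 3 k 0) 0))
  c20 : s (c3 1 (c3 3 0 0) 0)
  c21 : ∀ x, s (c3 1 (c3 3 (x+1) 0) (c3 6 (c3 3 x 0) (c3 3 x 0)))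

theorem NC.spec {Ax : ℕ → Prop} {ψ k : ℕ} {s : ℕ → Prop} (h : NC Ax ψ k s) : NCs Ax ψ k s := by
  have h0 : ∀ p q r b x y z w, _ → ¬ (Tl s p ∧ Tl s q ∧ Tl s r) := fun p q r b x y z w hh => h p q r ⟨b, x, y, z, w, hh⟩
  clear h
  constructor
  · intro x
    have := h0 _ _ _ 0 x 0 0 0 (Or.inl ⟨rfl, rfl, rfl⟩)
    simpa [Tl_pos, Tl_neg] using this
  · intro b x y z
    have := h0 _ _ _ b x y z 0 (Or.inr <| Or.inl ⟨rfl, rfl, rfl⟩)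
    simpa [Tl_pos, Tl_neg] using this
  · intro b x y z
    have := h0 _ _ _ b x y z 0 (Or.inr <| Or.inr <| Or.inl ⟨rfl, rfl, rfl⟩)
    simpa [Tl_pos, Tl_neg] using this
  · intro b x y z
    have := h0 _ _ _ b x y z 0 (Or.inr <| Or.inr <| Or.inr <| Or.inl ⟨rfl, rfl, rfl⟩)
    simpa [Tl_pos, Tl_neg] using this
  · intro b x y z
    have := h0 _ _ _ b x y z 0 (Or.inr <| Or.inr <| Or.inr <| Or.inr <| Or.inl ⟨rfl, rfl, rfl⟩)
    simpa [Tl_pos, Tl_neg] using this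
  · intro x y
    have := h0 _ _ _ 0 x y 0 0 (Or.inr <| Or.inr <| Or.inr <| Or.inr <| Or.inr <| Or.inl ⟨rfl, rfl, rfl⟩)
    simpa [Tl_pos, Tl_neg] using this
  · intro x y z
    have := h0 _ _ _ 0 x y z 0 (Or.inr <| Or.inr <| Or.inr <| Or.inr <| Or.inr <| Or.inr <| Or.inl ⟨rfl, rfl, rfl⟩)
    simpa [Tl_pos, Tl_neg] using this
  · intro x
    have := h0 _ _ _ 0 x 0 0 0 (Or.inr <| Or.inr <| Or.inr <| Or.inr <| Or.inr <| Or.inr <| Or.inr <| Or.inl ⟨rfl, rfl, rfl⟩)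
    simpa [Tl_pos, Tl_neg] using this
  · intro b x y z
    have := h0 _ _ _ b x y z 0 (Or.inr <| Or.inr <| Or.inr <| Or.inr <| Or.inr <| Or.inr <| Or.inr <| Or.inr <| Or.inl ⟨rfl, rfl, rfl⟩)
    simpa [Tl_pos, Tl_neg] using this
  · intro b x y z
    have h1 := h0 _ _ _ b x y z 0 (Or.inr <| Or.inr <| Or.inr <| Or.inr <| Or.inr <| Or.inr <| Or.inr <| Or.inr <| Or.inr <| Or.inl ⟨rfl, rfl, rfl⟩)
    have h2 := h0 _ _ _ b x y z 0 (Or.inr <| Or.inr <| Or.inr <| Or.inr <| Or.inr <| Or.inr <| Or.inr <| Or.inr <| Or.inr <| Or.inr <| Or.inl ⟨rfl, rfl, rfl⟩)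
    simp only [Tl_pos, Tl_neg] at h1 h2
    tauto
  · intro x
    have h1 := h0 _ _ _ 0 x 0 0 0 (Or.inr <| Or.inr <| Or.inr <| Or.inr <| Or.inr <| Or.inr <| Or.inr <| Or.inr <| Or.inr <| Or.inr <| Or.inr <| Or.inl ⟨rfl, rfl, rfl⟩)
    simp only [Tl_pos, Tl_neg] at h1
    tauto
  · intro x y z
    have h1 := h0 _ _ _ 0 x y z 0 (Or.inr <| Or.inr <| Or.inr <| Or.inr <| Or.inr <| Or.inr <| Or.inr <| Or.inr <| Or.inr <| Or.inr <| Or.inr <| Or.inr <| Or.inl ⟨rfl, rfl, rfl⟩)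
    have h2 := h0 _ _ _ 0 x y z 0 (Or.inr <| Or.inr <| Or.inr <| Or.inr <| Or.inr <| Or.inr <| Or.inr <| Or.inr <| Or.inr <| Or.inr <| Or.inr <| Or.inr <| Or.inr <| Or.inl ⟨rfl, rfl, rfl⟩)
    have h3 := h0 _ _ _ 0 x y z 0 (Or.inr <| Or.inr <| Or.inr <| Or.inr <| Or.inr <| Or.inr <| Or.inr <| Or.inr <| Or.inr <| Or.inr <| Or.inr <| Or.inr <| Or.inr <| Or.inr <| Or.inl ⟨rfl, rfl, rfl⟩)
    simp only [Tl_pos, Tl_neg] at h1 h2 h3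
    tauto
  · intro x z w
    have h1 := h0 _ _ _ 0 x 0 z w (Or.inr <| Or.inr <| Or.inr <| Or.inr <| Or.inr <| Or.inr <| Or.inr <| Or.inr <| Or.inr <| Or.inr <| Or.inr <| Or.inr <| Or.inr <| Or.inr <| Or.inr <| Or.inl ⟨rfl, rfl, rfl⟩)
    simp only [Tl_pos, Tl_neg] at h1
    tauto
  · intro x z
    have h1 := h0 _ _ _ 0 x 0 z 0 (Or.inr <| Or.inr <| Or.inr <| Or.inr <| Or.inr <| Or.inr <| Or.inr <| Or.inr <| Or.inr <| Or.inr <| Or.inr <| Or.inr <| Or.inr <| Or.inr <| Or.inr <| Or.inr <| Or.inl ⟨rfl, rfl, rfl⟩)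
    simp only [Tl_pos, Tl_neg] at h1
    tauto
  · intro x hx
    have h1 := h0 _ _ _ 0 x 0 0 0 (Or.inr <| Or.inr <| Or.inr <| Or.inr <| Or.inr <| Or.inr <| Or.inr <| Or.inr <| Or.inr <| Or.inr <| Or.inr <| Or.inr <| Or.inr <| Or.inr <| Or.inr <| Or.inr <| Or.inr <| Or.inl ⟨hx, rfl, rfl, rfl⟩)
    simp only [Tl_pos, Tl_neg] at h1
    tauto
  · have h1 := h0 _ _ _ 0 0 0 0 0 (Or.inr <| Or.inr <| Or.inr <| Or.inr <| Or.inr <| Or.inr <| Or.inr <| Or.inr <| Or.inr <| Or.inr <| Or.inr <| Or.inr <| Or.inr <| Or.inr <| Or.inr <| Or.inr <| Or.inr <| Or.inr <| Or.inl ⟨rfl, rfl, rfl⟩)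
    simp only [Tl_pos, Tl_neg] at h1
    tauto
  · have h1 := h0 _ _ _ 0 0 0 0 0 (Or.inr <| Or.inr <| Or.inr <| Or.inr <| Or.inr <| Or.inr <| Or.inr <| Or.inr <| Or.inr <| Or.inr <| Or.inr <| Or.inr <| Or.inr <| Or.inr <| Or.inr <| Or.inr <| Or.inr <| Or.inr <| Or.inr <| Or.inl ⟨rfl, rfl, rfl⟩)
    simp only [Tl_pos, Tl_neg] at h1
    tauto
  · intro x
    have h1 := h0 _ _ _ 0 x 0 0 0 (Or.inr <| Or.inr <| Or.inr <| Or.inr <| Or.inr <| Or.inr <| Or.inr <| Or.inr <| Or.inr <| Or.inr <| Or.inr <| Or.inr <| Or.inr <| Or.inr <| Or.inr <| Or.inr <| Or.inr <| Or.inr <| Or.inr <| Or.inr ⟨rfl, rfl, rfl⟩)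
    simp only [Tl_pos, Tl_neg] at h1
    tauto

set_option maxHeartbeats 4000000 in
set_option synthInstance.maxHeartbeats 4000000 in
set_option synthInstance.maxSize 100000 in
theorem S1N.cf {Ax : ℕ → Prop} (hA : S1N (fun v : Fin 1 → ℕ => Ax (v 0))) (ψ : ℕ) :
    S1N (fun v : Fin 4 → ℕ => Cf Ax ψ (v 0) (v 1) (v 2) (v 3)) := by
  have hA' : ∀ (m : ℕ) (t : (Fin m → ℕ) → ℕ) [FN t], S1N (fun v => Ax (t v)) := fun m t _ => S1N.comp1 hA t
  unfold Cf
  infer_instance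

section quot
variable {Ax : ℕ → Prop} {ψ k : ℕ} {s : ℕ → Prop} (h : NCs Ax ψ k s)
/-- the equality of the term model -/
def NCs.setoid : Setoid ℕ where
  r x y := s (c3 1 x y)
  iseqv := ⟨h.c1, fun {x y} hxy => h.c2 0 x y x hxy (h.c1 x), fun {x y z} h1 h2 => h.c3' 0 y z x h2 h1⟩
/-- the term model -/
def NCs.Q : Type := Quotient h.setoid
def NCs.cl (x : ℕ) : h.Q := Quotient.mk h.setoid x
theorem NCs.cl_eq {x y : ℕ} : h.cl x = h.cl y ↔ s (c3 1 x y) :=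
  ⟨fun e => Quotient.exact (s := h.setoid) e, fun e => Quotient.sound (s := h.setoid) e⟩
theorem NCs.cl_surj (a : h.Q) : ∃ x, h.cl x = a := Quotient.exists_rep a
/-- operations -/
def NCs.op (b : ℕ) : h.Q → h.Q → h.Q :=
  Quotient.lift₂ (s₁ := h.setoid) (s₂ := h.setoid) (fun x y => h.cl (c3 (b+4) x y)) (by
    intro a1 b1 a2 b2 h1 h2
    exact ((h.cl_eq).2 (h.c4 b _ _ _ h1)).trans ((h.cl_eq).2 (h.c5 b _ _ _ h2)))
/-- order -/
def NCs.le : h.Q → h.Q → Prop :=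
  Quotient.lift₂ (s₁ := h.setoid) (s₂ := h.setoid) (fun x y => s (c3 2 x y)) (by
    intro a1 b1 a2 b2 h1 h2
    have h1' := h.setoid.symm h1
    have h2' := h.setoid.symm h2
    exact propext ⟨fun hh => h.c3' 1 _ _ _ h2 (h.c2 1 _ _ _ h1 hh), fun hh => h.c3' 1 _ _ _ h2' (h.c2 1 _ _ _ h1' hh)⟩)
theorem NCs.op_cl (b x y : ℕ) : h.op b (h.cl x) (h.cl y) = h.cl (c3 (b+4) x y) := rfl
theorem NCs.le_cl (x y : ℕ) : h.le (h.cl x) (h.cl y) ↔ s (c3 2 x y) := Iff.rfl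
/-- the structure -/
@[reducible] def NCs.str : LA.Structure h.Q where
  funMap := fun {n} f v => match n, f, v with
    | 0, _, _ => h.cl 0
    | 1, _, v => h.op 2 (v 0) (v 0)
    | 2, f, v => h.op (cond (f : Bool) 1 0) (v 0) (v 1)
    | (_ + 3), f, _ => (f : Empty).elim
  RelMap := fun {n} R v => match n, R, v with
    | 0, R, _ => (R : Empty).elim
    | 1, R, _ => (R : Empty).elim
    | 2, _, v => h.le (v 0) (v 1)
    | (_ + 3), R, _ => (R : Empty).elim

/-- codes of assignments -/
def acode : {m : ℕ} → (Fin m → ℕ) → ℕ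
  | 0, _ => 0
  | _ + 1, v => c3 0 (v 0) (acode (fun i => v i.succ))

theorem acode_succ {m : ℕ} (v : Fin (m+1) → ℕ) : acode v = c3 0 (v 0) (acode (fun i => v i.succ)) := rfl
theorem NCs.el_var {m : ℕ} (v : Fin m → ℕ) (i : Fin m) : h.cl (c3 1 (c3 0 i 0) (acode v)) = h.cl (v i) := by
  induction m with
  | zero => exact i.elim0
  | succ m ih =>
    rw [acode_succ]
    refine Fin.cases ?_ (fun i => ?_) i
    · exact h.cl_eq.2 (h.c6 _ _)
    · refine (h.cl_eq.2 (h.c7 _ _ _)).trans ?_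
      exact ih (fun i => v i.succ) i

theorem NCs.el_term {m : ℕ} (t : LA.Term (Empty ⊕ Fin m)) (v : Fin m → ℕ) :
    letI := h.str
    h.cl (c3 1 (ownT t) (acode v)) = t.realize (Sum.elim (default : Empty → h.Q) (fun i => h.cl (v i.rev))) := by
  letI := h.str
  induction t using term_ind with
  | hv j => rw [ownT_v, h.el_var]; rfl
  | h0 => rw [ownT_z]; exact h.cl_eq.2 (h.c8 _)
  | hs t ih =>
    rw [ownT_s, h.cl_eq.2 (h.c9 2 _ _ _), ← h.op_cl, ih]
    simp only [succT, Functions.apply₁, Term.realize]; rfl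
  | ha t u h1 h2 =>
    rw [ownT_a, h.cl_eq.2 (h.c9 0 _ _ _), ← h.op_cl, h1, h2]
    simp only [addT, Functions.apply₂, Term.realize]; rfl
  | hm t u h1 h2 =>
    rw [ownT_m, h.cl_eq.2 (h.c9 1 _ _ _), ← h.op_cl, h1, h2]
    simp only [mulT, Functions.apply₂, Term.realize]; rfl

theorem NCs.fml {m : ℕ} (f : LA.BoundedFormula Empty m) : ∀ (v : Fin m → ℕ),
    letI := h.str
    s (c3 0 (own f) (acode v)) ↔ f.Realize (default : Empty → h.Q) (fun i => h.cl (v i.rev)) := by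
  letI := h.str
  induction f using fml_ind with
  | hb => intro v; rw [own_bot]; simp [h.c12]
  | he t u =>
    intro v; rw [own_eq, h.c10 0, ← h.cl_eq, h.el_term, h.el_term]
    exact Iff.rfl
  | hl t u =>
    intro v; rw [own_le, h.c10 1, ← h.le_cl, h.el_term, h.el_term]
    exact Iff.rfl
  | hi f g h1 h2 => intro v; rw [own_imp, h.c13, h1, h2]; exact Iff.rfl
  | ha f ih =>
    intro v; rw [own_all]
    have key : ∀ x, s (c3 0 (own f) (c3 0 x (acode v))) ↔ f.Realize (default : Empty → h.Q) (Fin.snoc (fun i => h.cl (v i.rev)) (h.cl x)) := by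
      intro x
      have := ih (Fin.cons x v)
      rw [acode_succ] at this
      simp only [Fin.cons_zero, Fin.cons_succ] at this
      rw [this, snoc_rev (fun i => h.cl (v i))]
      refine iff_of_eq (congrArg _ ?_)
      funext i
      refine Fin.cases ?_ (fun j => ?_) i.rev <;> simp
    constructor
    · intro hs a
      obtain ⟨x, rfl⟩ := h.cl_surj a
      exact (key x).1 (h.c16 _ _ _ hs)
    · intro hs
      exact h.c17 _ _ ((key _).2 (hs _))
end quot

theorem Rz_cast (M : PAM) (f : ℕ → M) (h0 : f 0 = 0) (hs : ∀ k, f (k+1) = sc (f k)) (ψ : LA.BoundedFormula Empty 1) (k : ℕ)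
    (h : ¬ Rz ψ M (fun _ => f k)) : ¬ Rz ψ M (fun _ => (k : M)) := by
  have h4 : ∀ k : ℕ, (k : M) = f k := by
    intro k
    induction k with
    | zero => rw [Nat.cast_zero, h0]
    | succ k ih => rw [Nat.cast_succ, ih, hs, sc_eq]
  rwa [h4]

theorem NCs.model {T : Thy} (hT : ExtPA T) {ψ : LA.BoundedFormula Empty 1} {k : ℕ} {s : ℕ → Prop}
    (h : NCs (fun x => ∃ φ ∈ T, own φ = x) (own ψ) k s) : ∃ M : PAM, M ⊨ T ∧ ¬ Rz ψ M (fun _ => (k : M)) := by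
  letI := h.str
  have h1 : h.Q ⊨ T := by
    refine ⟨fun φ hφ => ?_⟩
    have := (h.fml φ (fun i => i.elim0)).1 (h.c18 _ ⟨φ, hφ, rfl⟩)
    unfold Sentence.Realize Formula.Realize
    convert this using 1
  haveI : Nonempty h.Q := ⟨h.cl 0⟩
  have h2 : h.Q ⊨ PAAx := ⟨fun φ hφ => (hT φ hφ).realize_sentence h.Q⟩
  have h3 := (h.fml ψ (fun _ => c3 3 k 0)).not.1 h.c19
  exact ⟨⟨h.Q, h.str, h2⟩, h1, Rz_cast ⟨h.Q, h.str, h2⟩ (fun k => h.cl (c3 3 k 0)) (h.cl_eq.2 h.c20) (fun k => h.cl_eq.2 (h.c21 k)) ψ k h3⟩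

theorem NC.model {T : Thy} (ψ : LA.BoundedFormula Empty 1) (k : ℕ) (M : PAM) (hM : M ⊨ T) (h : ¬ Rz ψ M (fun _ => (k : M))) :
    NC (fun x => ∃ φ ∈ T, own φ = x) (own ψ) k (Vv M) := by
  refine NC_sound _ _ _ M ?_ ?_
  · rintro x ⟨φ, hφ, rfl⟩
    rw [St_own φ (fun i => i.elim0) _ (fun i => i.elim0), Rz_sentence]
    exact hM.realize_of_mem φ hφ
  · rwa [St_own ψ (fun _ => (k : M)) _]
    intro i
    rw [Subsingleton.elim i 0, Ip_cons, Ip_num]; rfl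

/-- bits -/
def bitP (S i : ℕ) : Prop := S / 2 ^ i % 2 = 1
theorem NC.compact {Ax : ℕ → Prop} {ψ k : ℕ} : (∃ s, NC Ax ψ k s) ↔
    ¬ ∃ B, ∀ S, S < 2 ^ B → ∃ p q r, p < 2 * B ∧ q < 2 * B ∧ r < 2 * B ∧ Cf Ax ψ k p q r ∧ Tl (bitP S) p ∧ Tl (bitP S) q ∧ Tl (bitP S) r := by
  constructor
  · rintro ⟨s, hs⟩ ⟨B, hB⟩
    classical
    obtain ⟨p, q, r, hp, hq, hr, hc, h1, h2, h3⟩ := hB (Nat.ofBits (n := B) (fun i => decide (s i))) (Nat.ofBits_lt_two_pow _)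
    have key : ∀ l, l < 2 * B → Tl (bitP (Nat.ofBits (n := B) (fun i => decide (s i)))) l → Tl s l := by
      rintro l hl ⟨i, hi⟩
      have : bitP (Nat.ofBits (n := B) (fun i => decide (s i))) i ↔ s i := by
        have := Nat.testBit_ofBits_lt (fun i : Fin B => decide (s i)) i (by omega)
        rw [Nat.testBit_eq_decide_div_mod_eq] at this
        simpa [bitP] using this
      rw [this] at hi
      exact ⟨i, hi⟩
    exact hs p q r hc ⟨key _ hp h1, key _ hq h2, key _ hr h3⟩
  · intro h
    push Not at h
    choose S hS hS' using h
    refine ⟨fun i => ∀ᶠ B in (Filter.hyperfilter ℕ : Filter ℕ), bitP (S B) i, ?_⟩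
    rintro p q r hc ⟨h1, h2, h3⟩
    have key : ∀ l, Tl (fun i => ∀ᶠ B in (Filter.hyperfilter ℕ : Filter ℕ), bitP (S B) i) l →
        ∀ᶠ B in (Filter.hyperfilter ℕ : Filter ℕ), l < 2 * B ∧ Tl (bitP (S B)) l := by
      rintro l ⟨i, hi⟩
      have ha : ∀ᶠ B in (Filter.hyperfilter ℕ : Filter ℕ), l < 2 * B :=
        Nat.hyperfilter_le_atTop (Filter.eventually_atTop.2 ⟨l+1, fun b hb => by omega⟩)
      rcases hi with ⟨h, h'⟩ | ⟨h, h'⟩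
      · filter_upwards [ha, h'] with B h1 h2
        exact ⟨h1, i, Or.inl ⟨h, h2⟩⟩
      · have h' := Ultrafilter.eventually_not.2 h'
        filter_upwards [ha, h'] with B h1 h2
        exact ⟨h1, i, Or.inr ⟨h, h2⟩⟩
    obtain ⟨B, ⟨h1, h1'⟩, ⟨h2, h2'⟩, ⟨h3, h3'⟩⟩ := ((key _ h1).and ((key _ h2).and (key _ h3))).exists
    exact hS' B p q r h1 h2 h3 hc h1' h2' h3'

theorem FN.powF {m : ℕ} (t : (Fin m → ℕ) → ℕ) [ht : FN t] : FN (fun v => 2 ^ (t v)) := by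
  refine FN.comp1 (g := fun x => 2 ^ x) (FN.comput (f := fun x => 2 ^ x) ?_) t
  have : Primrec₂ (fun a b : ℕ => a ^ b) := Primrec₂.unpaired'.1 Nat.Primrec.pow
  exact (this.comp (Primrec.const 2) Primrec.id).to_comp
theorem FN.bitF {m : ℕ} (t u : (Fin m → ℕ) → ℕ) [ht : FN t] [hu : FN u] : FN (fun v => (t v) / 2 ^ (u v) % 2) := by
  have : FN (fun v : Fin 1 → ℕ => (fun n : ℕ => n.unpair.1 / 2 ^ n.unpair.2 % 2) (v 0)) := by
    refine FN.comput (f := fun n : ℕ => n.unpair.1 / 2 ^ n.unpair.2 % 2) ?_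
    have : Primrec₂ (fun a b : ℕ => a ^ b) := Primrec₂.unpaired'.1 Nat.Primrec.pow
    have h1 : Primrec (fun n : ℕ => 2 ^ n.unpair.2) := this.comp (Primrec.const 2) (Primrec.snd.comp Primrec.unpair)
    have h2 : Primrec (fun n : ℕ => n.unpair.1 / 2 ^ n.unpair.2) := Primrec.nat_div.comp (Primrec.fst.comp Primrec.unpair) h1
    exact (Primrec.nat_mod.comp h2 (Primrec.const 2)).to_comp
  have := FN.comp1 (g := fun n : ℕ => n.unpair.1 / 2 ^ n.unpair.2 % 2) this (fun v => Nat.pair (t v) (u v))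
  simpa using this
attribute [instance] FN.powF FN.bitF
instance S1N.tl {m : ℕ} (t u : (Fin m → ℕ) → ℕ) [ht : FN t] [hu : FN u] : S1N (fun v => Tl (bitP (t v)) (u v)) := by
  have : S1N (fun v => ∃ i, (u v = 2 * i ∧ t v / 2 ^ i % 2 = 1) ∨ (u v = 2 * i + 1 ∧ t v / 2 ^ i % 2 ≠ 1)) := inferInstance
  exact this

set_option maxHeartbeats 4000000 in
set_option synthInstance.maxHeartbeats 4000000 in
/-- provability in an r.e. theory is `Σ₁` -/
theorem S1N.prv {T : Thy} (hT : ExtPA T) (hA : S1N (fun v : Fin 1 → ℕ => ∃ φ ∈ T, own φ = v 0))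
    (ψ : LA.BoundedFormula Empty 1) :
    S1N (fun v : Fin 1 → ℕ => ∀ M : PAM, M ⊨ T → Rz ψ M (fun _ => (v 0 : M))) := by
  have h1 := S1N.cf (Ax := fun x => ∃ φ ∈ T, own φ = x) hA (own ψ)
  have h2 : S1N (fun w : Fin 6 → ℕ => Cf (fun x => ∃ φ ∈ T, own φ = x) (own ψ) (w 5) (w 2) (w 1) (w 0)) :=
    h1.weak' ![5, 2, 1, 0] (fun v => Iff.rfl)
  have h3 : S1N (fun v : Fin 1 → ℕ => ∃ B, ∀ S, S < 2 ^ B → ∃ p q r, p < 2 * B ∧ q < 2 * B ∧ r < 2 * B ∧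
      Cf (fun x => ∃ φ ∈ T, own φ = x) (own ψ) (v 0) p q r ∧ Tl (bitP S) p ∧ Tl (bitP S) q ∧ Tl (bitP S) r) := by
    refine @S1N.ex _ _ (@S1N.balllt _ _ inferInstance _ (@S1N.ex _ _ (@S1N.ex _ _ (@S1N.ex _ _ ?_))))
    refine @S1N.and _ _ _ inferInstance (@S1N.and _ _ _ inferInstance (@S1N.and _ _ _ inferInstance (@S1N.and _ _ _ ?_ inferInstance)))
    exact h2
  refine h3.congr (fun v => ?_)
  rw [← not_iff_not, ← NC.compact]
  push Not
  constructor
  · rintro ⟨s, hs⟩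
    exact NCs.model hT hs.spec
  · rintro ⟨M, hM, h⟩
    exact ⟨_, NC.model ψ _ M hM h⟩

/-- difference lists of tokens -/
def app : List ℕ → ℕ → ℕ
  | [], r => r
  | a :: t, r => Nat.pair a (app t r) + 1
theorem app_append (l l' : List ℕ) (r : ℕ) : app (l ++ l') r = app l (app l' r) := by
  induction l with
  | nil => rfl
  | cons a l ih => simp [app, ih]
theorem encode_list {α : Type} [Encodable α] (l : List α) : Encodable.encode l = app (l.map Encodable.encode) 0 := by
  induction l with
  | nil => rfl
  | cons a l ih => rw [Encodable.encode_list_cons, ih]; rfl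
/-- tokens of a term -/
def tokT {m : ℕ} (t : LA.Term (Empty ⊕ Fin m)) : List ℕ := t.listEncode.map Encodable.encode
/-- tokens of a formula -/
def tokF {m : ℕ} (f : LA.BoundedFormula Empty m) : List ℕ := f.listEncode.map Encodable.encode
theorem enc_term {m : ℕ} (t : LA.Term (Empty ⊕ Fin m)) : Encodable.encode t = app (tokT t) 0 := encode_list _
theorem gnum_eq (φ : Snt) : gnum φ = app (tokF φ) 0 := encode_list _

theorem tokT_v {m : ℕ} (j : Fin m) : tokT (vT j) = [2 * (2 * (j : ℕ) + 1)] := by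
  simp [tokT, vT, Term.listEncode]
  rfl
theorem tokT_z {m : ℕ} : tokT (m := m) zeroT = [2 * Nat.pair 0 0 + 1] := by
  simp [tokT, zeroT, Constants.term, Term.listEncode]
  rfl
theorem tokT_s {m : ℕ} (t : LA.Term (Empty ⊕ Fin m)) : tokT (succT t) = (2 * Nat.pair 1 0 + 1) :: tokT t := by
  simp [tokT, succT, Functions.apply₁, Term.listEncode]
  refine ⟨rfl, ?_⟩
  rw [show List.finRange 1 = [0] from rfl]
  simp
theorem tokT_a {m : ℕ} (t u : LA.Term (Empty ⊕ Fin m)) : tokT (addT t u) = (2 * Nat.pair 2 0 + 1) :: (tokT t ++ tokT u) := by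
  simp [tokT, addT, Functions.apply₂, Term.listEncode, List.finRange_succ]
  rfl
theorem tokT_m {m : ℕ} (t u : LA.Term (Empty ⊕ Fin m)) : tokT (mulT t u) = (2 * Nat.pair 2 1 + 1) :: (tokT t ++ tokT u) := by
  simp [tokT, mulT, Functions.apply₂, Term.listEncode, List.finRange_succ]
  rfl
theorem tokF_bot {m : ℕ} : tokF (⊥ : LA.BoundedFormula Empty m) = [2 * (2 * (m + 2) + 1) + 1] := by
  show tokF BoundedFormula.falsum = _
  simp [tokF, BoundedFormula.listEncode]
theorem tokF_eq {m : ℕ} (t u : LA.Term (Empty ⊕ Fin m)) :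
    tokF (t =' u) = [2 * Nat.pair m (app (tokT t) 0), 2 * Nat.pair m (app (tokT u) 0)] := by
  simp [tokF, Term.bdEqual, BoundedFormula.listEncode, enc_term]
theorem tokF_le {m : ℕ} (t u : LA.Term (Empty ⊕ Fin m)) :
    tokF (leF t u) = [2 * (2 * Nat.pair 2 0) + 1, 2 * (2 * m + 1) + 1, 2 * Nat.pair m (app (tokT t) 0), 2 * Nat.pair m (app (tokT u) 0)] := by
  simp [tokF, leF, Relations.boundedFormula₂, Relations.boundedFormula, BoundedFormula.listEncode, enc_term, List.finRange_succ]
  rfl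
theorem tokF_imp {m : ℕ} (f g : LA.BoundedFormula Empty m) : tokF (f ⟹ g) = (2 * (2 * 0 + 1) + 1) :: (tokF f ++ tokF g) := by
  simp [tokF, BoundedFormula.listEncode]
theorem tokF_all {m : ℕ} (f : LA.BoundedFormula Empty (m+1)) : tokF (∀' f) = (2 * (2 * 1 + 1) + 1) :: tokF f := by
  simp [tokF, BoundedFormula.listEncode]

theorem gnum_inj {φ ψ : Snt} (h : gnum φ = gnum ψ) : φ = ψ := by
  have h1 : (φ : LA.BoundedFormula Empty 0).listEncode = (ψ : LA.BoundedFormula Empty 0).listEncode := Encodable.encode_injective h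
  have h2 := BoundedFormula.listEncode_sigma_injective (L := LA) (α := Empty) (a₁ := ⟨0, φ⟩) (a₂ := ⟨0, ψ⟩) h1
  simpa using h2

/-- judgement codes -/
def jd (b c m l l' : ℕ) : ℕ := c3 b c (Nat.pair m (Nat.pair l l'))
/-- one token -/
def tk (a r : ℕ) : ℕ := Nat.pair a r + 1
instance FN.tk {m : ℕ} (t u : (Fin m → ℕ) → ℕ) [FN t] [FN u] : FN (fun v => tk (t v) (u v)) := by
  unfold Guaspari.tk; infer_instance
instance FN.jd {m : ℕ} (a b c d e : (Fin m → ℕ) → ℕ) [FN a] [FN b] [FN c] [FN d] [FN e] : FN (fun v => jd (a v) (b v) (c v) (d v) (e v)) := by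
  unfold Guaspari.jd; infer_instance
theorem jd_inj {b c m l l' b' c' m' k k' : ℕ} : jd b c m l l' = jd b' c' m' k k' ↔ b = b' ∧ c = c' ∧ m = m' ∧ l = k ∧ l' = k' := by
  simp [jd, Nat.pair_eq_pair]
theorem jd_ne {b c m l l' : ℕ} : jd b c m l l' ≠ 0 := by simp [jd]

/-- the rules for terms -/
def RT (e p q : ℕ) : Prop := ∃ c d m l l' r,
  (p = 0 ∧ q = 0 ∧ c + d + 1 = m ∧ e = jd 0 (c3 0 c 0) m (tk (2 * (2 * d + 1)) l) l) ∨
  (p = 0 ∧ q = 0 ∧ e = jd 0 0 m (tk (2 * Nat.pair 0 0 + 1) l) l) ∨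
  (p = jd 0 c m l r ∧ q = 0 ∧ e = jd 0 (c3 3 c c) m (tk (2 * Nat.pair 1 0 + 1) l) r) ∨
  (p = jd 0 c m l l' ∧ q = jd 0 d m l' r ∧ e = jd 0 (c3 1 c d) m (tk (2 * Nat.pair 2 0 + 1) l) r) ∨
  (p = jd 0 c m l l' ∧ q = jd 0 d m l' r ∧ e = jd 0 (c3 2 c d) m (tk (2 * Nat.pair 2 1 + 1) l) r)
/-- the rules for formulas -/
def RF (e p q : ℕ) : Prop := ∃ c d m l l' r,
  (p = 0 ∧ q = 0 ∧ e = jd 1 0 m (tk (2 * (2 * (m + 2) + 1) + 1) r) r) ∨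
  (p = jd 0 c m l 0 ∧ q = jd 0 d m l' 0 ∧ e = jd 1 (c3 2 c d) m (tk (2 * Nat.pair m l) (tk (2 * Nat.pair m l') r)) r) ∨
  (p = jd 0 c m l 0 ∧ q = jd 0 d m l' 0 ∧ e = jd 1 (c3 3 c d) m
    (tk (2 * (2 * Nat.pair 2 0) + 1) (tk (2 * (2 * m + 1) + 1) (tk (2 * Nat.pair m l) (tk (2 * Nat.pair m l') r)))) r) ∨
  (p = jd 1 c m l l' ∧ q = jd 1 d m l' r ∧ e = jd 1 (c3 0 c d) m (tk (2 * (2 * 0 + 1) + 1) l) r) ∨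
  (p = jd 1 c (m+1) l r ∧ q = 0 ∧ e = jd 1 (c3 1 c 0) m (tk (2 * (2 * 1 + 1) + 1) l) r)

set_option maxHeartbeats 4000000 in
set_option synthInstance.maxHeartbeats 4000000 in
set_option synthInstance.maxSize 100000 in
theorem S1N.rt : S1N (fun v : Fin 3 → ℕ => RT (v 0) (v 1) (v 2)) := by
  unfold RT; infer_instance
set_option maxHeartbeats 4000000 in
set_option synthInstance.maxHeartbeats 4000000 in
set_option synthInstance.maxSize 100000 in
theorem S1N.rf : S1N (fun v : Fin 3 → ℕ => RF (v 0) (v 1) (v 2)) := by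
  unfold RF; infer_instance

/-- semantics -/
def Jt (c m l l' : ℕ) : Prop := ∃ t : LA.Term (Empty ⊕ Fin m), ownT t = c ∧ l = app (tokT t) l'
def Jf (c m l l' : ℕ) : Prop := ∃ t : LA.BoundedFormula Empty m, own t = c ∧ l = app (tokF t) l'

theorem RT_sound {S : ℕ → Prop} (hS : ∀ e, S e → e = 0 ∨ ∃ p q, (RT e p q ∨ RF e p q) ∧ S p ∧ S q) :
    ∀ N c, c < N → ∀ m l r, S (jd 0 c m l r) → Jt c m l r := by
  intro N
  induction N with
  | zero => intro c hc; omega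
  | succ N ih =>
    intro c hc m l r h
    have lt1 : ∀ {k p q : ℕ}, c3 k p q < N + 1 → p < N ∧ q < N := by
      intro k p q h
      have h1 := k1_lt (c3_ne k p q)
      have h2 := k2_lt (c3_ne k p q)
      rw [k1_c3] at h1; rw [k2_c3] at h2; omega
    rcases hS _ h with h0 | ⟨p, q, h0 | h0, hp, hq⟩
    · exact absurd h0 jd_ne
    · obtain ⟨c', d, m', l', l'', r', h0⟩ := h0
      rcases h0 with ⟨rfl, rfl, h1, h2⟩ | ⟨rfl, rfl, h2⟩ | ⟨rfl, rfl, h2⟩ | ⟨rfl, rfl, h2⟩ | ⟨rfl, rfl, h2⟩ <;>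
        (rw [jd_inj] at h2; obtain ⟨-, rfl, rfl, rfl, rfl⟩ := h2)
      · refine ⟨vT ⟨d, by omega⟩, ?_, ?_⟩
        · rw [ownT_v]; simp [Fin.rev]; omega
        · rw [tokT_v]; rfl
      · exact ⟨zeroT, ownT_z, by rw [tokT_z]; rfl⟩
      · obtain ⟨t, rfl, rfl⟩ := ih _ (lt1 hc).1 _ _ _ hp
        exact ⟨succT t, ownT_s t, by rw [tokT_s]; rfl⟩
      · obtain ⟨t, rfl, rfl⟩ := ih _ (lt1 hc).1 _ _ _ hp
        obtain ⟨u, rfl, rfl⟩ := ih _ (lt1 hc).2 _ _ _ hq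
        exact ⟨addT t u, ownT_a t u, by rw [tokT_a, app, app_append]; rfl⟩
      · obtain ⟨t, rfl, rfl⟩ := ih _ (lt1 hc).1 _ _ _ hp
        obtain ⟨u, rfl, rfl⟩ := ih _ (lt1 hc).2 _ _ _ hq
        exact ⟨mulT t u, ownT_m t u, by rw [tokT_m, app, app_append]; rfl⟩
    · obtain ⟨c', d, m', l', l'', r', h0⟩ := h0
      rcases h0 with ⟨_, _, h2⟩ | ⟨_, _, h2⟩ | ⟨_, _, h2⟩ | ⟨_, _, h2⟩ | ⟨_, _, h2⟩ <;>
        (rw [jd_inj] at h2; exact absurd h2.1 (by decide))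

theorem RF_sound {S : ℕ → Prop} (hS : ∀ e, S e → e = 0 ∨ ∃ p q, (RT e p q ∨ RF e p q) ∧ S p ∧ S q) :
    ∀ N c, c < N → ∀ m l r, S (jd 1 c m l r) → Jf c m l r := by
  intro N
  induction N with
  | zero => intro c hc; omega
  | succ N ih =>
    intro c hc m l r h
    have lt1 : ∀ {k p q : ℕ}, c3 k p q < N + 1 → p < N ∧ q < N := by
      intro k p q h
      have h1 := k1_lt (c3_ne k p q)
      have h2 := k2_lt (c3_ne k p q)
      rw [k1_c3] at h1; rw [k2_c3] at h2; omega
    rcases hS _ h with h0 | ⟨p, q, h0 | h0, hp, hq⟩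
    · exact absurd h0 jd_ne
    · obtain ⟨c', d, m', l', l'', r', h0⟩ := h0
      rcases h0 with ⟨_, _, _, h2⟩ | ⟨_, _, h2⟩ | ⟨_, _, h2⟩ | ⟨_, _, h2⟩ | ⟨_, _, h2⟩ <;>
        (rw [jd_inj] at h2; exact absurd h2.1 (by decide))
    · obtain ⟨c', d, m', l', l'', r', h0⟩ := h0
      rcases h0 with ⟨rfl, rfl, h2⟩ | ⟨rfl, rfl, h2⟩ | ⟨rfl, rfl, h2⟩ | ⟨rfl, rfl, h2⟩ | ⟨rfl, rfl, h2⟩ <;>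
        (rw [jd_inj] at h2; obtain ⟨-, rfl, rfl, rfl, rfl⟩ := h2)
      · exact ⟨⊥, own_bot, by rw [tokF_bot]; rfl⟩
      · obtain ⟨t, rfl, rfl⟩ := RT_sound hS _ _ (Nat.lt_succ_self _) _ _ _ hp
        obtain ⟨u, rfl, rfl⟩ := RT_sound hS _ _ (Nat.lt_succ_self _) _ _ _ hq
        exact ⟨t =' u, own_eq t u, by rw [tokF_eq]; rfl⟩
      · obtain ⟨t, rfl, rfl⟩ := RT_sound hS _ _ (Nat.lt_succ_self _) _ _ _ hp
        obtain ⟨u, rfl, rfl⟩ := RT_sound hS _ _ (Nat.lt_succ_self _) _ _ _ hq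
        exact ⟨leF t u, own_le t u, by rw [tokF_le]; rfl⟩
      · obtain ⟨t, rfl, rfl⟩ := ih _ (lt1 hc).1 _ _ _ hp
        obtain ⟨u, rfl, rfl⟩ := ih _ (lt1 hc).2 _ _ _ hq
        exact ⟨t ⟹ u, own_imp t u, by rw [tokF_imp, app, app_append]; rfl⟩
      · obtain ⟨t, rfl, rfl⟩ := ih _ (lt1 hc).1 _ _ _ hp
        exact ⟨∀' t, own_all t, by rw [tokF_all]; rfl⟩

theorem RT_complete {S : ℕ → Prop} (h0 : S 0) (hS : ∀ e p q, (RT e p q ∨ RF e p q) → S p → S q → S e)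
    {m : ℕ} (t : LA.Term (Empty ⊕ Fin m)) : ∀ r, S (jd 0 (ownT t) m (app (tokT t) r) r) := by
  induction t using term_ind with
  | hv j =>
    intro r
    refine hS _ 0 0 (Or.inl ⟨(j.rev : ℕ), j, m, r, 0, 0, Or.inl ⟨rfl, rfl, ?_, ?_⟩⟩) h0 h0
    · simp [Fin.rev]; omega
    · rw [ownT_v, tokT_v]; rfl
  | h0 =>
    intro r
    refine hS _ 0 0 (Or.inl ⟨0, 0, m, r, 0, 0, Or.inr (Or.inl ⟨rfl, rfl, ?_⟩)⟩) h0 h0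
    rw [ownT_z, tokT_z]; rfl
  | hs t ih =>
    intro r
    refine hS _ _ 0 (Or.inl ⟨_, 0, m, _, 0, r, Or.inr (Or.inr (Or.inl ⟨rfl, rfl, ?_⟩))⟩) (ih r) h0
    rw [ownT_s, tokT_s]; rfl
  | ha t u h1 h2 =>
    intro r
    refine hS _ _ _ (Or.inl ⟨_, _, m, _, _, r, Or.inr (Or.inr (Or.inr (Or.inl ⟨rfl, rfl, ?_⟩)))⟩) (h1 _) (h2 r)
    rw [ownT_a, tokT_a, app, app_append]; rfl
  | hm t u h1 h2 =>
    intro r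
    refine hS _ _ _ (Or.inl ⟨_, _, m, _, _, r, Or.inr (Or.inr (Or.inr (Or.inr ⟨rfl, rfl, ?_⟩)))⟩) (h1 _) (h2 r)
    rw [ownT_m, tokT_m, app, app_append]; rfl

theorem RF_complete {S : ℕ → Prop} (h0 : S 0) (hS : ∀ e p q, (RT e p q ∨ RF e p q) → S p → S q → S e)
    {m : ℕ} (f : LA.BoundedFormula Empty m) : ∀ r, S (jd 1 (own f) m (app (tokF f) r) r) := by
  induction f using fml_ind with
  | @hb m =>
    intro r
    refine hS _ 0 0 (Or.inr ⟨0, 0, m, 0, 0, r, Or.inl ⟨rfl, rfl, ?_⟩⟩) h0 h0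
    rw [own_bot, tokF_bot]; rfl
  | @he m t u =>
    intro r
    refine hS _ _ _ (Or.inr ⟨_, _, m, _, _, r, Or.inr (Or.inl ⟨rfl, rfl, ?_⟩)⟩) (RT_complete h0 hS t 0) (RT_complete h0 hS u 0)
    rw [own_eq, tokF_eq]; rfl
  | @hl m t u =>
    intro r
    refine hS _ _ _ (Or.inr ⟨_, _, m, _, _, r, Or.inr (Or.inr (Or.inl ⟨rfl, rfl, ?_⟩))⟩) (RT_complete h0 hS t 0) (RT_complete h0 hS u 0)
    rw [own_le, tokF_le]; rfl
  | @hi m f g h1 h2 =>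
    intro r
    refine hS _ _ _ (Or.inr ⟨_, _, m, _, _, r, Or.inr (Or.inr (Or.inr (Or.inl ⟨rfl, rfl, ?_⟩)))⟩) (h1 _) (h2 r)
    rw [own_imp, tokF_imp, app, app_append]; rfl
  | @ha m f ih =>
    intro r
    refine hS _ _ 0 (Or.inr ⟨_, 0, m, _, 0, r, Or.inr (Or.inr (Or.inr (Or.inr ⟨rfl, rfl, ?_⟩)))⟩) (ih r) h0
    rw [own_all, tokF_all]; rfl

theorem S1N.match_code : S1N (fun v : Fin 1 → ℕ => v 0 = 0 ∨ ∃ b c m l r, v 0 = jd b c m l r ∧ ((b = 0 ∧ Jt c m l r) ∨ (b = 1 ∧ Jf c m l r))) := by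
  refine S1N.lfp (fun e p q => RT e p q ∨ RF e p q) (@S1N.or _ _ _ S1N.rt S1N.rf)
    (fun e => e = 0 ∨ ∃ b c m l r, e = jd b c m l r ∧ ((b = 0 ∧ Jt c m l r) ∨ (b = 1 ∧ Jf c m l r))) ?_ ?_
  · intro S hS e he
    rcases hS e he with h | ⟨p, q, h, hp, hq⟩
    · exact Or.inl h
    · right
      have : ∃ b c m l r, e = jd b c m l r ∧ (b = 0 ∨ b = 1) := by
        rcases h with ⟨c', d, m', l', l'', r', h0⟩ | ⟨c', d, m', l', l'', r', h0⟩
        · rcases h0 with ⟨_, _, _, h2⟩ | ⟨_, _, h2⟩ | ⟨_, _, h2⟩ | ⟨_, _, h2⟩ | ⟨_, _, h2⟩ <;> exact ⟨_, _, _, _, _, h2, by simp⟩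
        · rcases h0 with ⟨_, _, h2⟩ | ⟨_, _, h2⟩ | ⟨_, _, h2⟩ | ⟨_, _, h2⟩ | ⟨_, _, h2⟩ <;> exact ⟨_, _, _, _, _, h2, by simp⟩
      obtain ⟨b, c, m, l, r, rfl, rfl | rfl⟩ := this
      · exact ⟨_, _, _, _, _, rfl, Or.inl ⟨rfl, RT_sound hS _ _ (Nat.lt_succ_self _) _ _ _ he⟩⟩
      · exact ⟨_, _, _, _, _, rfl, Or.inr ⟨rfl, RF_sound hS _ _ (Nat.lt_succ_self _) _ _ _ he⟩⟩
  · intro S h0 hS e he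
    rcases he with rfl | ⟨b, c, m, l, r, rfl, ⟨rfl, t, rfl, rfl⟩ | ⟨rfl, f, rfl, rfl⟩⟩
    · exact h0
    · exact RT_complete h0 hS t r
    · exact RF_complete h0 hS f r

theorem S1N.gnum_own : S1N (fun v : Fin 2 → ℕ => ∃ φ : Snt, gnum φ = v 0 ∧ own φ = v 1) := by
  have h := S1N.comp1 (P := fun e => e = 0 ∨ ∃ b c m l r, e = jd b c m l r ∧ ((b = 0 ∧ Jt c m l r) ∨ (b = 1 ∧ Jf c m l r)))
    S1N.match_code (fun v : Fin 2 → ℕ => jd 1 (v 1) 0 (v 0) 0)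
  refine h.congr (fun v => ?_)
  constructor
  · rintro (h | ⟨b, c, m, l, r, h, h'⟩)
    · exact absurd h jd_ne
    · rw [jd_inj] at h
      obtain ⟨rfl, rfl, rfl, rfl, rfl⟩ := h
      rcases h' with ⟨h, _⟩ | ⟨_, f, h1, h2⟩
      · exact absurd h (by decide)
      · exact ⟨f, by rw [gnum_eq]; exact h2.symm, h1⟩
  · rintro ⟨f, h1, h2⟩
    exact Or.inr ⟨_, _, _, _, _, rfl, Or.inr ⟨rfl, f, h2, by rw [← h1, gnum_eq]⟩⟩

theorem S1N.axs {T : Thy} (hT : CompThy T) : S1N (fun v : Fin 1 → ℕ => ∃ φ ∈ T, own φ = v 0) := by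
  have h1 := S1N.re hT.to_re
  have h2 : S1N (fun w : Fin 2 → ℕ => ∃ φ ∈ T, gnum φ = w 0) := h1.weak' ![0] (fun v => Iff.rfl)
  have h3 := S1N.gnum_own
  have h4 : S1N (fun v : Fin 1 → ℕ => ∃ g, (fun w : Fin 2 → ℕ => (∃ φ ∈ T, gnum φ = w 0) ∧ (∃ φ : Snt, gnum φ = w 0 ∧ own φ = w 1)) (Fin.cons g v)) :=
    @S1N.ex _ _ (@S1N.and _ _ _ h2 h3)
  refine h4.congr (fun v => ?_)
  constructor
  · rintro ⟨g, ⟨φ, hφ, h1⟩, ψ, h2, h3⟩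
    have := gnum_inj (h2.trans h1.symm)
    subst this
    exact ⟨ψ, hφ, h3⟩
  · rintro ⟨φ, hφ, h⟩
    exact ⟨_, ⟨φ, hφ, rfl⟩, φ, rfl, h⟩

theorem PAM.prv {T : Thy} {φ : Snt} (h : Prv T φ) (M : PAM) (hM : M ⊨ T) : M ⊨ φ := by
  haveI : Nonempty M := ⟨(0 : M)⟩
  exact h.realize_sentence M
theorem prv_of {T : Thy} (hT : ExtPA T) {φ : Snt} (h : ∀ M : PAM, M ⊨ T → M ⊨ φ) : Prv T φ := by
  refine Theory.models_sentence_iff.2 (fun M => ?_)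
  have h2 : M ⊨ PAAx := ⟨fun φ hφ => (hT φ hφ).realize_sentence M⟩
  exact h ⟨M, inferInstance, h2⟩ (inferInstance : M ⊨ T)
theorem prv_iff {T : Thy} (hT : ExtPA T) {φ : Snt} : Prv T φ ↔ ∀ M : PAM, M ⊨ T → M ⊨ φ :=
  ⟨fun h M hM => M.prv h hM, prv_of hT⟩
theorem PAM.add {T : Thy} {φ : Snt} {M : PAM} (hM : M ⊨ T) (h : M ⊨ φ) : M ⊨ add T φ := by
  refine ⟨fun ψ hψ => ?_⟩
  rcases hψ with rfl | hψ
  · exact h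
  · exact hM.realize_of_mem ψ hψ
theorem prv_mem {T : Thy} {φ : Snt} (h : φ ∈ T) : Prv T φ :=
  Theory.models_sentence_iff.2 (fun M => Theory.realize_sentence_of_mem T h)
theorem ExtPA.mono {T T' : Thy} (hT : ExtPA T) (h : T ⊆ T') : ExtPA T' := by
  intro φ hφ
  refine Theory.models_sentence_iff.2 (fun M => ?_)
  haveI : M ⊨ T := (inferInstance : M ⊨ T').mono h
  exact (hT φ hφ).realize_sentence M
theorem ExtPA.pa : ExtPA PAAx := fun φ h => prv_mem h
theorem PAM.subthy {V T : Thy} (h : SubThy V T) {M : PAM} (hM : M ⊨ T) : M ⊨ V :=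
  ⟨fun φ hφ => M.prv (h.2 φ (prv_mem hφ)) hM⟩
theorem con_iff {T : Thy} (hT : ExtPA T) : Con T ↔ ∃ M : PAM, M ⊨ T := by
  unfold Con
  rw [prv_iff hT]
  push Not
  constructor
  · rintro ⟨M, h, _⟩; exact ⟨M, h⟩
  · rintro ⟨M, h⟩; exact ⟨M, h, fun h => h⟩

/-- relations without parameters -/
abbrev P0 := ∀ M : PAM, Prop
theorem exists_snt (R : PAM → Prop) [h : Df (m := 0) (fun M _ => R M)] : ∃ φ : Snt, ∀ M : PAM, M ⊨ φ ↔ R M := by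
  obtain ⟨φ, h⟩ := h
  exact ⟨φ, fun M => by rw [← h M (fun i => i.elim0), Rz_sentence]⟩

theorem compactness {T : Thy} (hT : ExtPA T) (R : ℕ → PAM → Prop) (hR : ∀ i, Df (m := 0) (fun M _ => R i M))
    (h : ∀ n, ∃ M : PAM, M ⊨ T ∧ ∀ i < n, R i M) : ∃ M : PAM, M ⊨ T ∧ ∀ i, R i M := by
  choose s hs using fun i => exists_snt (R i)
  have h1 : Theory.IsSatisfiable (⋃ n : ℕ, T ∪ s '' {i | i < n}) := by
    refine (Theory.isSatisfiable_directed_union_iff (T := fun n : ℕ => T ∪ s '' {i | i < n}) ?_).2 ?_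
    · refine (directed_of_isDirected_le (fun a b hab => ?_))
      exact Set.union_subset_union_right _ (Set.image_mono (fun i (hi : i < a) => lt_of_lt_of_le hi hab))
    · intro n
      obtain ⟨M, hM, h⟩ := h n
      haveI : Nonempty M := ⟨(0 : M)⟩
      haveI : M ⊨ T ∪ s '' {i | i < n} := by
        refine ⟨fun ψ hψ => ?_⟩
        rcases hψ with hψ | ⟨i, hi, rfl⟩
        · exact hM.realize_of_mem ψ hψ
        · exact (hs i M).2 (h i hi)
      exact Theory.Model.isSatisfiable M
  obtain ⟨M⟩ := h1
  have h2 : M ⊨ T := (inferInstance : M ⊨ (⋃ n : ℕ, T ∪ s '' {i | i < n})).mono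
    (fun x hx => Set.mem_iUnion.2 ⟨0, Or.inl hx⟩)
  have h3 : M ⊨ PAAx := ⟨fun φ hφ => (hT φ hφ).realize_sentence M⟩
  refine ⟨⟨M, inferInstance, h3⟩, h2, fun i => (hs i _).1 ?_⟩
  exact Theory.realize_sentence_of_mem (M := M) (⋃ n : ℕ, T ∪ s '' {i | i < n}) (Set.mem_iUnion.2 ⟨i+1, Or.inr ⟨i, Nat.lt_succ_self i, rfl⟩⟩)

theorem S1N.thm {T : Thy} (hT : GoodThy T) (R : Rel 1) [h : Df R] :
    S1N (fun v : Fin 1 → ℕ => ∀ M : PAM, M ⊨ T → R M (fun _ => (v 0 : M))) := by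
  obtain ⟨ψ, h⟩ := h
  refine (S1N.prv hT.2.2 (S1N.axs hT.1) ψ).congr (fun v => ?_)
  simp only [h]
theorem S1N.thm2 {T : Thy} (hT : GoodThy T) (R : Rel 2) [h : Df R] :
    S1N (fun v : Fin 2 → ℕ => ∀ M : PAM, M ⊨ T → R M ![(v 0 : M), (v 1 : M)]) := by
  have h0 : Df (m := 3) (fun M v => R M (fun i => v (![1, 0] i))) := Df.weak R _
  have h1 : Df (m := 1) (fun M v => ∃ a b, v 0 = J a b ∧ R M ![a, b]) := by
    refine @Df.ex _ _ (@Df.ex _ _ (@Df.and _ _ _ inferInstance (h0.congr (fun M v => ?_))))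
    apply iff_of_eq; congr 1; funext i; fin_cases i <;> rfl
  have h2 := S1N.comp1 (P := fun z => ∀ M : PAM, M ⊨ T → ∃ a b, (z : M) = J a b ∧ R M ![a, b])
    (S1N.thm hT (fun M v => ∃ a b, v 0 = J a b ∧ R M ![a, b])) (fun v : Fin 2 → ℕ => J (v 0) (v 1))
  refine h2.congr (fun v => ?_)
  refine forall_congr' fun M => imp_congr_right fun _ => ?_
  rw [cast_J]
  constructor
  · rintro ⟨a, b, h, h'⟩
    rw [J_eq_iff] at h
    rw [h.1, h.2]; exact h'
  · intro h
    exact ⟨_, _, rfl, h⟩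

instance Df.uu (k : ℕ) {m : ℕ} (q a : Fnc m) [TD q] [TD a] : Df (fun M v => UU k (q M v) (a M v)) := (UU_Sg k q a).toDf
/-- the implication coded by `z` -/
def CC (k : ℕ) {M : PAM} (z : M) : Prop := ∀ a, a ≤ z → ∀ b, b ≤ z → (z = J a b → UU k a 0 → UU k b 0)
theorem CC_J {k : ℕ} {M : PAM} (a b : M) : CC k (J a b) ↔ (UU k a 0 → UU k b 0) := by
  constructor
  · intro h; exact h a (lt_J_left a b).le b (lt_J_right a b).le rfl
  · intro h a' _ b' _ e
    rw [J_eq_iff] at e; rw [← e.1, ← e.2]; exact h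
theorem CC_zero {k : ℕ} {M : PAM} : CC k (0 : M) := by
  intro a _ b _ h; exact absurd h.symm (J_ne_zero a b)
instance Df.cc (k : ℕ) {m : ℕ} (t : Fnc m) [TD t] : Df (fun M v => CC k (t M v)) := by
  unfold CC; infer_instance
/-- `Σ`-elementary equivalence -/
def Eqv (k : ℕ) (M N : PAM) : Prop := ∀ a : ℕ, UU k (a : M) 0 ↔ UU k (a : N) 0
theorem Eqv.symm {k : ℕ} {M N : PAM} (h : Eqv k M N) : Eqv k N M := fun a => (h a).symm
theorem Sg.code0 {k : ℕ} {R : PAM → Prop} (h : Sg (k+1) (m := 0) (fun M _ => R M)) : ∃ a : ℕ, ∀ M : PAM, R M ↔ UU k (a : M) 0 := by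
  obtain ⟨c, hc⟩ := UU_code k h
  refine ⟨c, fun M => ?_⟩
  rw [hc M (fun i => i.elim0)]
  simp [env]
theorem Eqv.sg {k : ℕ} {M N : PAM} (h : Eqv k M N) {R : PAM → Prop} (hR : Sg (k+1) (m := 0) (fun M _ => R M)) : R M ↔ R N := by
  obtain ⟨a, ha⟩ := hR.code0
  rw [ha, ha, h a]
theorem Eqv.cc {k : ℕ} {M N : PAM} (h : Eqv k M N) (z : ℕ) : CC k (z : M) ↔ CC k (z : N) := by
  have key : ∀ {M N : PAM}, Eqv k M N → CC k (z : M) → CC k (z : N) := by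
    intro M N h hM a ha b hb e
    obtain ⟨a, ha', rfl⟩ := le_nat ha
    obtain ⟨b, hb', rfl⟩ := le_nat hb
    rw [← h a, ← h b]
    refine hM _ (Nat.cast_le.2 ha') _ (Nat.cast_le.2 hb') ?_
    rw [← cast_J, Nat.cast_inj] at e ⊢
    exact e
  exact ⟨key h, key h.symm⟩

theorem code_and (k n : ℕ) (s : ℕ → Prop) : ∃ A : ℕ, ∀ M : PAM, UU k (A : M) 0 ↔ ∀ a < n, s a → UU k (a : M) 0 := by
  have : Sg (k+1) (m := 0) (fun M _ => ∀ a < n, s a → UU k (a : M) 0) := by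
    induction n with
    | zero => exact Sg.congr (Sg.ofD0 (R := fun M v => ¬ False) (k+1)) (fun M v => by simp)
    | succ n ih =>
      have h1 : Sg (k+1) (m := 0) (fun M _ => s n → UU k (n : M) 0) := by
        by_cases hs : s n
        · exact Sg.congr (UU_Sg k (fun M v => (n : M)) (fun M v => (0 : M))) (fun M v => by simp [hs])
        · exact Sg.congr (Sg.ofD0 (R := fun M v => ¬ False) (k+1)) (fun M v => by simp [hs])
      refine Sg.congr ((sgPkg (k+1)).and ih h1) (fun M v => ?_)
      simp only [Nat.forall_lt_succ_right]
  obtain ⟨A, hA⟩ := this.code0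
  exact ⟨A, fun M => (hA M).symm⟩
theorem code_or (k n : ℕ) (s : ℕ → Prop) : ∃ A : ℕ, ∀ M : PAM, UU k (A : M) 0 ↔ ∃ a < n, s a ∧ UU k (a : M) 0 := by
  have : Sg (k+1) (m := 0) (fun M _ => ∃ a < n, s a ∧ UU k (a : M) 0) := by
    induction n with
    | zero => exact Sg.congr (Sg.ofD0 (R := fun M v => False) (k+1)) (fun M v => by simp)
    | succ n ih =>
      have h1 : Sg (k+1) (m := 0) (fun M _ => s n ∧ UU k (n : M) 0) := by
        by_cases hs : s n
        · exact Sg.congr (UU_Sg k (fun M v => (n : M)) (fun M v => (0 : M))) (fun M v => by simp [hs])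
        · exact Sg.congr (Sg.ofD0 (R := fun M v => False) (k+1)) (fun M v => by simp [hs])
      refine Sg.congr ((sgPkg (k+1)).or ih h1) (fun M v => ?_)
      simp only [Nat.exists_lt_succ_right]
  obtain ⟨A, hA⟩ := this.code0
  exact ⟨A, fun M => (hA M).symm⟩

theorem exists_eqv {k : ℕ} {T : Thy} (hT : ExtPA T) (R : PAM → Prop) [hR : Df (m := 0) (fun M _ => R M)] (K : PAM)
    (h : ∀ z : ℕ, (∀ M : PAM, M ⊨ T → R M → CC k (z : M)) → CC k (z : K)) :
    ∃ N : PAM, N ⊨ T ∧ R N ∧ Eqv k N K := by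
  obtain ⟨N, h1, h2⟩ := compactness hT (fun i M => R M ∧ (UU k (i : M) 0 ↔ UU k (i : K) 0)) (fun i => by
      by_cases hi : UU k (i : K) 0
      · simp only [hi, iff_true]; infer_instance
      · simp only [hi, iff_false]; infer_instance) (fun n => by
      obtain ⟨A, hA⟩ := code_and k n (fun a => UU k (a : K) 0)
      obtain ⟨B, hB⟩ := code_or k n (fun a => ¬ UU k (a : K) 0)
      by_contra hc
      push Not at hc
      have := h (J A B) (fun M hM hRM => by
        rw [cast_J, CC_J, hA, hB]
        intro h1
        obtain ⟨i, hi, h2⟩ := hc M hM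
        have h3 := h2 hRM
        by_cases hK : UU k (i : K) 0
        · have := h1 i hi hK; tauto
        · exact ⟨i, hi, hK, by tauto⟩)
      rw [cast_J, CC_J, hA, hB] at this
      obtain ⟨a, _, h4, h5⟩ := this (fun a _ h => h)
      exact h4 h5)
  exact ⟨N, h1, (h2 0).1, fun i => (h2 i).2⟩

theorem Eqv.bool {k : ℕ} {M N : PAM} (h : Eqv k M N) {γ : Snt} (hγ : IsBoolSigma (k+1) γ) : M ⊨ γ ↔ N ⊨ γ := by
  induction hγ with
  | @base φ hφ =>
    refine h.sg (R := fun M => M ⊨ φ) (Sg.congr (sigma_Sg hφ) (fun M v => Rz_sentence _ M v))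
  | not _ ih => simp only [Sentence.realize_not, ih]
  | imp _ _ h1 h2 =>
    have : ∀ (K : PAM) (φ ψ : Snt), K ⊨ (φ ⟹ ψ : Snt) ↔ (K ⊨ φ → K ⊨ ψ) := fun K φ ψ => BoundedFormula.realize_imp
    rw [this, this, h1, h2]
  | inf _ _ h1 h2 =>
    have : ∀ (K : PAM) (φ ψ : Snt), K ⊨ (φ ⊓ ψ : Snt) ↔ (K ⊨ φ ∧ K ⊨ ψ) := fun K φ ψ => BoundedFormula.realize_inf
    rw [this, this, h1, h2]
  | sup _ _ h1 h2 =>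
    have : ∀ (K : PAM) (φ ψ : Snt), K ⊨ (φ ⊔ ψ : Snt) ↔ (K ⊨ φ ∨ K ⊨ ψ) := fun K φ ψ => BoundedFormula.realize_sup
    rw [this, this, h1, h2]

theorem hcons_of {k : ℕ} {T : Thy} {φ : Snt} (h : ∀ K : PAM, ¬ K ⊨ φ → ∃ N : PAM, N ⊨ T ∧ N ⊨ φ ∧ Eqv k N K) :
    HConsIn (BSigmaS (k+1)) T φ := by
  intro V hV γ hγ hp
  refine prv_of hV.1 (fun K hK => ?_)
  by_cases hφ : K ⊨ φ
  · exact K.prv hp (PAM.add hK hφ)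
  · obtain ⟨N, h1, h2, h3⟩ := h K hφ
    exact (h3.bool hγ).1 (N.prv hp (PAM.add (PAM.subthy hV h1) h2))

/-- finite sets of standard numbers -/
theorem exists_setcode (n : ℕ) (s : ℕ → Prop) : ∃ l : ℕ, ∀ (M : PAM) (x : M), mem x (l : M) ↔ ∃ i : ℕ, x = (i : M) ∧ i < n ∧ s i := by
  have h0 : ∃ l : NN, ∀ x : NN, mem x l ↔ ∃ i : ℕ, x = (i : NN) ∧ i < n ∧ s i := by
    induction n with
    | zero =>
      obtain ⟨l, hl⟩ := exists_empty (M := NN)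
      exact ⟨l, fun x => by simp [hl]⟩
    | succ n ih =>
      obtain ⟨l, hl⟩ := ih
      by_cases hs : s n
      · obtain ⟨l', hl'⟩ := exists_union l l (n : NN)
        refine ⟨l', fun x => ?_⟩
        rw [hl', hl]
        constructor
        · rintro (⟨i, h1, h2, h3⟩ | ⟨i, h1, h2, h3⟩ | h)
          · exact ⟨i, h1, by omega, h3⟩
          · exact ⟨i, h1, by omega, h3⟩
          · exact ⟨n, h, by omega, hs⟩
        · rintro ⟨i, h1, h2, h3⟩
          rcases Nat.lt_succ_iff_lt_or_eq.1 h2 with h | rfl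
          · exact Or.inl ⟨i, h1, h, h3⟩
          · exact Or.inr (Or.inr h1)
      · refine ⟨l, fun x => ?_⟩
        rw [hl]
        constructor
        · rintro ⟨i, h1, h2, h3⟩
          exact ⟨i, h1, by omega, h3⟩
        · rintro ⟨i, h1, h2, h3⟩
          rcases Nat.lt_succ_iff_lt_or_eq.1 h2 with h | rfl
          · exact ⟨i, h1, h, h3⟩
          · exact absurd h3 hs
  obtain ⟨l, hl⟩ := h0
  obtain ⟨l, rfl⟩ := nn_std l
  have h1 : ∀ (M : PAM) (i : ℕ), mem (i : M) (l : M) ↔ i < n ∧ s i := by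
    intro M i
    have := D0_abs (R := fun M (v : Fin 2 → M) => mem (v 0) (v 1)) inferInstance ![i, l] M NN
    have e : mem (i : M) (l : M) ↔ mem (i : NN) (l : NN) := this
    rw [e, hl]
    constructor
    · rintro ⟨j, h1, h2⟩
      rw [Nat.cast_inj] at h1; rw [h1]; exact h2
    · intro h; exact ⟨i, rfl, h⟩
  refine ⟨l, fun M x => ?_⟩
  constructor
  · intro h
    obtain ⟨i, _, rfl⟩ := le_nat (mem_lt h).le
    exact ⟨i, rfl, (h1 M i).1 h⟩
  · rintro ⟨i, rfl, h⟩
    exact (h1 M i).2 h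

/-- all the implications coded by members of `l` -/
def CS (k : ℕ) {M : PAM} (l : M) : Prop := ∀ x, mem x l → CC k x
instance Df.cs (k : ℕ) {m : ℕ} (t : Fnc m) [TD t] : Df (fun M v => CS k (t M v)) := by
  unfold CS; infer_instance

theorem bool_cc (k z : ℕ) : ∃ β : Snt, IsBoolSigma (k+1) β ∧ ∀ M : PAM, M ⊨ β ↔ CC k (z : M) := by
  have hi : ∀ (K : PAM) (φ ψ : Snt), K ⊨ (φ ⟹ ψ : Snt) ↔ (K ⊨ φ → K ⊨ ψ) := fun K φ ψ => BoundedFormula.realize_imp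
  have key : ∀ a : ℕ, ∃ σ : Snt, IsBoolSigma (k+1) σ ∧ ∀ M : PAM, M ⊨ σ ↔ UU k (a : M) 0 := by
    intro a
    obtain ⟨⟨σ, h1, h2⟩, _⟩ := Sg_fml (UU_Sg k (m := 0) (fun M v => (a : M)) (fun M v => (0 : M)))
    exact ⟨σ, .base h1, fun M => by rw [← h2 M (fun i => i.elim0), Rz_sentence]⟩
  by_cases hz : ∃ a b : ℕ, z = J a b
  · obtain ⟨a, b, rfl⟩ := hz
    obtain ⟨σ, h1, h2⟩ := key a
    obtain ⟨τ, h3, h4⟩ := key b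
    exact ⟨σ ⟹ τ, .imp h1 h3, fun M => by rw [hi, h2, h4, cast_J, CC_J]⟩
  · obtain ⟨σ, h1, h2⟩ := key 0
    refine ⟨σ ⟹ σ, .imp h1 h1, fun M => ?_⟩
    rw [hi]
    refine iff_of_true id ?_
    intro a ha b hb e
    obtain ⟨a, ha', rfl⟩ := le_nat ha
    obtain ⟨b, hb', rfl⟩ := le_nat hb
    rw [← cast_J, Nat.cast_inj] at e
    exact absurd ⟨a, b, e⟩ hz

theorem bool_cs (k l : ℕ) : ∃ β : Snt, IsBoolSigma (k+1) β ∧ ∀ M : PAM, M ⊨ β ↔ CS k (l : M) := by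
  have hi : ∀ (K : PAM) (φ ψ : Snt), K ⊨ (φ ⊓ ψ : Snt) ↔ (K ⊨ φ ∧ K ⊨ ψ) := fun K φ ψ => BoundedFormula.realize_inf
  have key : ∀ (n : ℕ) (s : ℕ → Prop), ∃ β : Snt, IsBoolSigma (k+1) β ∧ ∀ M : PAM, M ⊨ β ↔ ∀ i < n, s i → CC k (i : M) := by
    intro n s
    induction n with
    | zero =>
      obtain ⟨β, h1, h2⟩ := bool_cc k 0
      exact ⟨β, h1, fun M => by rw [h2]; simp [CC_zero]⟩
    | succ n ih =>
      obtain ⟨β, h1, h2⟩ := ih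
      by_cases hs : s n
      · obtain ⟨γ, h3, h4⟩ := bool_cc k n
        exact ⟨β ⊓ γ, .inf h1 h3, fun M => by rw [hi, h2, h4, Nat.forall_lt_succ_right]; tauto⟩
      · exact ⟨β, h1, fun M => by rw [h2, Nat.forall_lt_succ_right]; exact ⟨fun h => ⟨h, fun h' => absurd h' hs⟩, And.left⟩⟩
  obtain ⟨β, h1, h2⟩ := key l (fun i => mem (i : NN) (l : NN))
  refine ⟨β, h1, fun M => ?_⟩
  rw [h2]
  have abs : ∀ i : ℕ, mem (i : NN) (l : NN) ↔ mem (i : M) (l : M) := fun i =>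
    D0_abs (R := fun M (v : Fin 2 → M) => mem (v 0) (v 1)) inferInstance ![i, l] NN M
  constructor
  · intro h x hx
    obtain ⟨i, _, rfl⟩ := le_nat (mem_lt hx).le
    have := mem_lt hx
    rw [Nat.cast_lt] at this
    exact h i this ((abs i).2 hx)
  · intro h i _ hi
    exact h _ ((abs i).1 hi)

theorem partG {k : ℕ} {T U : Thy} (hT : GoodThy T) (hU : GoodThy U) (h : CBpair (k+1) T U) :
    ∃ R : PAM → Prop, Sg 1 (m := 0) (fun M _ => R M) ∧ ¬ R NN ∧ ∃ M N : PAM, M ⊨ T ∧ N ⊨ U ∧ Eqv k M N ∧ R M ∧ R N := by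
  have hs : Sg 1 (m := 1) (fun M v => UU 0 (v 0) (J (v 0) 0)) := UU_Sg 0 _ _
  have hs2 : Df (m := 2) (fun M v => UU 0 (v 1) (J (v 1) 0)) := inferInstance
  have h1 : S1N (fun v : Fin 2 → ℕ => ∀ M : PAM, M ⊨ U → CS k (v 0 : M)) :=
    (S1N.thm hU (fun M v => CS k (v 0))).weak' ![0] (fun v => Iff.rfl)
  have h2 : S1N (fun v : Fin 2 → ℕ => ∀ M : PAM, M ⊨ T → CS k (v 0 : M) → ¬ UU 0 (v 1 : M) (J (v 1 : M) 0)) :=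
    (S1N.thm2 hT (fun M v => CS k (v 0) → ¬ UU 0 (v 1) (J (v 1) 0)))
  have h3 : S1N (fun v : Fin 1 → ℕ => ∃ l : ℕ, (fun w : Fin 2 → ℕ => (∀ M : PAM, M ⊨ U → CS k (w 0 : M)) ∧
      (∀ M : PAM, M ⊨ T → CS k (w 0 : M) → ¬ UU 0 (w 1 : M) (J (w 1 : M) 0))) (Fin.cons l v)) :=
    @S1N.ex _ _ (@S1N.and _ _ _ h1 h2)
  obtain ⟨S, hS, h4⟩ := h3
  obtain ⟨r, hr⟩ := UU_code 0 hS
  have h5 : (∃ l : ℕ, (∀ M : PAM, M ⊨ U → CS k (l : M)) ∧ (∀ M : PAM, M ⊨ T → CS k (l : M) → ¬ UU 0 (r : M) (J (r : M) 0))) ↔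
      UU 0 (r : NN) (J (r : NN) 0) := by
    have e := hr NN (cst NN ![r])
    have e' := h4 ![r]
    have e2 : env (cst NN ![r]) = J (r : NN) 0 := by simp [env, cst]
    rw [e2] at e
    rw [← e, ← e']
    rfl
  have hRs : Sg 1 (m := 0) (fun M _ => UU 0 (r : M) (J (r : M) 0)) := UU_Sg 0 _ _
  have h6 : ¬ UU 0 (r : NN) (J (r : NN) 0) := by
    intro hn
    obtain ⟨l, h7, h8⟩ := h5.2 hn
    obtain ⟨β, hβ, hβ'⟩ := bool_cs k l
    have hx : ExtPA (T ∪ ThIn (BSigmaS (k+1)) U) := hT.2.2.mono (fun x hx => Or.inl hx)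
    obtain ⟨M, hM⟩ := (con_iff hx).1 h
    have hMT : M ⊨ T := hM.mono (fun x hx => Or.inl hx)
    have : M ⊨ β := hM.realize_of_mem β (Or.inr ⟨hβ, prv_of hU.2.2 (fun N hN => (hβ' N).2 (h7 N hN))⟩)
    exact h8 M hMT ((hβ' M).1 this) (S1_up hRs (fun i => i.elim0) hn M)
  refine ⟨fun M => UU 0 (r : M) (J (r : M) 0), hRs, h6, ?_⟩
  have h7 := (not_congr h5).2 h6
  push Not at h7
  obtain ⟨M, hM, h8⟩ := compactness hT.2.2 (fun i M => UU 0 (r : M) (J (r : M) 0) ∧ ((∀ N : PAM, N ⊨ U → CC k (i : N)) → CC k (i : M)))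
    (fun i => by
      by_cases hi : ∀ N : PAM, N ⊨ U → CC k (i : N)
      · exact Df.congr (R := fun M _ => UU 0 (r : M) (J (r : M) 0) ∧ CC k (i : M)) inferInstance
          (fun M v => ⟨fun h => ⟨h.1, fun _ => h.2⟩, fun h => ⟨h.1, h.2 hi⟩⟩)
      · exact Df.congr (R := fun M _ => UU 0 (r : M) (J (r : M) 0)) inferInstance
          (fun M v => ⟨fun h => ⟨h, fun h' => absurd h' hi⟩, And.left⟩)) (fun n => by
      obtain ⟨l, hl⟩ := exists_setcode n (fun i => ∀ N : PAM, N ⊨ U → CC k (i : N))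
      obtain ⟨M, h9, h10, h11⟩ := h7 l (fun N hN x hx => by
        obtain ⟨i, rfl, _, h⟩ := (hl N x).1 hx
        exact h N hN)
      exact ⟨M, h9, fun i hi => ⟨h11, fun h => h10 _ ((hl M _).2 ⟨i, rfl, hi, h⟩)⟩⟩)
  obtain ⟨N, h9, _, h10⟩ := exists_eqv (k := k) hU.2.2 (fun _ => ¬ False) M (fun z hz => (h8 z).2 (fun N hN => hz N hN id))
  have h11 := (h8 0).1
  refine ⟨M, N, hM, h9, h10.symm, h11, (h10.sg (R := fun M => UU 0 (r : M) (J (r : M) 0)) ?_).2 h11⟩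
  have up : ∀ j, Sg (j+1) (m := 0) (fun M _ => UU 0 (r : M) (J (r : M) 0)) := by
    intro j
    induction j with
    | zero => exact hRs
    | succ j ih => exact ih.succ
  exact up k

theorem exists_W {R : PAM → Prop} (hR : Sg 1 (m := 0) (fun M _ => R M)) (hn : ¬ R NN) :
    ∃ W : ∀ M : PAM, M → Prop, D0 (m := 1) (fun M v => W M (v 0)) ∧ (∀ M y y', W M y → W M y' → y = y') ∧
      (∀ (M : PAM) (i : ℕ), ¬ W M (i : M)) ∧ ∀ M, R M → ∃ y, W M y := by
  obtain ⟨P, hP, e⟩ := hR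
  haveI : D0 P := hP
  have e' : ∀ M, R M ↔ ∃ x, ¬ P M (Fin.cons x (fun i => i.elim0)) := fun M => e M _
  have hP1 : D0 (m := 1) (fun M v => P M (fun i => v (![0] i))) := inferInstance
  have hP2 : D0 (m := 2) (fun M v => P M (fun i => v (![0] i))) := inferInstance
  have e1 : ∀ (M : PAM) (x : M), (Fin.cons x (fun i => i.elim0) : Fin 1 → M) = fun _ => x := by
    intro M x; funext i; obtain rfl : i = 0 := Fin.ext (by omega)
    rfl
  have hW : D0 (m := 1) (fun M v => ¬ P M (fun _ => v 0) ∧ ∀ y, y < v 0 → P M (fun _ => y)) := by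
    refine @D0.and _ _ _ (@D0.not _ _ (hP1.congr fun M v => ?_)) (@D0.balllt _ (fun M v => v 0) inferInstance _ (hP2.congr fun M v => ?_))
    · apply iff_of_eq; congr 1; funext i; obtain rfl : i = 0 := Fin.ext (by omega)
      rfl
    · apply iff_of_eq; congr 1; funext i; obtain rfl : i = 0 := Fin.ext (by omega)
      rfl
  refine ⟨fun M x => ¬ P M (fun _ => x) ∧ ∀ y, y < x → P M (fun _ => y), hW, ?_, ?_, ?_⟩
  · rintro M y y' ⟨h1, h2⟩ ⟨h3, h4⟩
    rcases lt_trichotomy y y' with h | h | h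
    · exact absurd (h4 _ h) h1
    · exact h
    · exact absurd (h2 _ h) h3
  · rintro M i ⟨h1, _⟩
    apply hn
    rw [e']
    refine ⟨(i : NN), ?_⟩
    have := D0_abs hP ![i] M NN
    have ea : ∀ K : PAM, cst K ![i] = fun _ => (i : K) := by
      intro K; funext j; rw [Subsingleton.elim j 0]; rfl
    rw [ea, ea] at this
    rw [e1, ← this]; exact h1
  · intro M hM
    rw [e'] at hM
    obtain ⟨x, hx⟩ := hM
    obtain ⟨y, h1, h2⟩ := lnp (m := 0) (fun M v => ¬ P M v) _ x hx
    rw [e1] at h1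
    refine ⟨y, h1, fun z hz => ?_⟩
    have := h2 z hz
    rw [e1] at this
    exact not_not.1 this

/-- relations that are both `Σ` and `Π` of level `k+2` -/
class Dl (k : ℕ) {m : ℕ} (R : Rel m) : Prop where
  pos : Sg (k+2) R
  neg : Sg (k+2) (fun M v => ¬ R M v)
instance (priority := low) Dl.ofD0 (k : ℕ) {m : ℕ} (R : Rel m) [h : D0 R] : Dl k R := ⟨Sg.ofD0 _, Sg.ofD0 _⟩
instance Dl.uu (k : ℕ) {m : ℕ} (q a : Fnc m) [TD q] [TD a] : Dl k (fun M v => UU k (q M v) (a M v)) :=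
  ⟨(UU_Sg k q a).succ, (UU_Sg k q a).neg⟩
instance Dl.not (k : ℕ) {m : ℕ} (P : Rel m) [h : Dl k P] : Dl k (fun M v => ¬ P M v) :=
  ⟨h.neg, h.pos.congr (fun M v => not_not.symm)⟩
instance Dl.and (k : ℕ) {m : ℕ} (P Q : Rel m) [h : Dl k P] [h' : Dl k Q] : Dl k (fun M v => P M v ∧ Q M v) :=
  ⟨(sgPkg _).and h.pos h'.pos, ((sgPkg _).or h.neg h'.neg).congr (fun M v => by tauto)⟩
instance Dl.imp (k : ℕ) {m : ℕ} (P Q : Rel m) [h : Dl k P] [h' : Dl k Q] : Dl k (fun M v => P M v → Q M v) :=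
  ⟨((sgPkg _).or h.neg h'.pos).congr (fun M v => by tauto), ((sgPkg _).and h.pos h'.neg).congr (fun M v => by tauto)⟩
instance Dl.bex (k : ℕ) {m : ℕ} (t : Fnc m) [TD t] (P : ∀ M : PAM, (Fin m → M) → M → Prop)
    [h : Dl k (fun M (w : Fin (m+1) → M) => P M (fun i => w i.succ) (w 0))] :
    Dl k (fun M v => ∃ x, x ≤ t M v ∧ P M v x) :=
  ⟨Sg.bexH t h.pos, (Sg.ballH (P := fun M v x => ¬ P M v x) t h.neg).congr (fun M v => by push Not; rfl)⟩
instance Dl.ball (k : ℕ) {m : ℕ} (t : Fnc m) [TD t] (P : ∀ M : PAM, (Fin m → M) → M → Prop)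
    [h : Dl k (fun M (w : Fin (m+1) → M) => P M (fun i => w i.succ) (w 0))] :
    Dl k (fun M v => ∀ x, x ≤ t M v → P M v x) :=
  ⟨Sg.ballH t h.pos, (Sg.bexH (P := fun M v x => ¬ P M v x) t h.neg).congr (fun M v => by push Not; rfl)⟩
instance Dl.cc (k : ℕ) {m : ℕ} (t : Fnc m) [TD t] : Dl k (fun M v => CC k (t M v)) := by
  unfold CC; infer_instance

/-- a monotone bounded-time approximation of a self-referential `Σ₁` relation -/
theorem exists_enum : ∃ En : ∀ M : PAM, M → M → M → Prop,
    (∀ {m : ℕ} (q z x : Fnc m) [TD q] [TD z] [TD x], D0 (fun M v => En M (q M v) (z M v) (x M v))) ∧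
    (∀ (M : PAM) (q z x x' : M), En M q z x → x ≤ x' → En M q z x') ∧
    (∀ (M : PAM) (q z x : M), En M q z x → UU 0 q (J z (J q 0))) ∧
    (∀ (M : PAM) (q z : M), UU 0 q (J z (J q 0)) → ∃ x, En M q z x) := by
  have h : Sg 1 (m := 2) (fun M v => UU 0 (v 0) (J (v 1) (J (v 0) 0))) := UU_Sg 0 _ _
  obtain ⟨P, hP, e⟩ := h
  haveI hP' : D0 P := hP
  have e' : ∀ (M : PAM) (q z : M), UU 0 q (J z (J q 0)) ↔ ∃ x, ¬ P M ![x, q, z] := fun M q z => e M ![q, z]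
  refine ⟨fun M q z x => ∃ y, y ≤ x ∧ ¬ P M ![y, q, z], ?_, ?_, ?_, ?_⟩
  · intro m q z x _ _ _
    have h1 : D0 (m := 3) (fun M v => ∃ y, y ≤ v 2 ∧ ¬ P M (fun i => (Fin.cons y v : Fin 4 → M) (![0, 1, 2] i))) := by
      refine @D0.bex 3 (fun M v => v 2) inferInstance (fun M v y => ¬ P M (fun i => (Fin.cons y v : Fin 4 → M) (![0, 1, 2] i))) ?_
      refine D0.congr (R := fun M (w : Fin 4 → M) => ¬ P M (fun i => w (![0, 1, 2] i))) (@D0.not 4 _ (@D0.weak 3 4 P hP' ![0, 1, 2])) (fun M w => ?_)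
      have : (Fin.cons (w 0) (fun i => w i.succ) : Fin 4 → M) = w := Fin.cons_self_tail w
      rw [this]
    have h2 := @D0.subst 3 _ h1 m ![q, z, x] (by
      intro i
      fin_cases i <;> simp <;> assumption)
    refine h2.congr (fun M v => ?_)
    apply exists_congr; intro y
    apply and_congr Iff.rfl
    apply not_congr; apply iff_of_eq; congr 1
    funext i; fin_cases i <;> rfl
  · rintro M q z x x' ⟨y, h1, h2⟩ h
    exact ⟨y, h1.trans h, h2⟩
  · rintro M q z x ⟨y, h1, h2⟩
    exact (e' M q z).2 ⟨y, h2⟩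
  · intro M q z h
    obtain ⟨y, h⟩ := (e' M q z).1 h
    exact ⟨y, y, le_rfl, h⟩

theorem Dl.delta {k : ℕ} {R : PAM → Prop} (h1 : Sg k (m := 0) (fun M _ => R M)) (h2 : Sg k (m := 0) (fun M _ => ¬ R M))
    {φ : Snt} (hφ : ∀ M : PAM, M ⊨ φ ↔ R M) : IsDeltaIn k PAAx φ := by
  have hi : ∀ (K : PAM) (φ ψ : Snt), K ⊨ (φ ⇔ ψ : Snt) ↔ (K ⊨ φ ↔ K ⊨ ψ) := fun K φ ψ => BoundedFormula.realize_iff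
  obtain ⟨⟨σ, a1, a2⟩, _⟩ := Sg_fml h1
  obtain ⟨_, π, b1, b2⟩ := Sg_fml h2
  refine ⟨⟨σ, a1, prv_of ExtPA.pa (fun M _ => ?_)⟩, π, b1, prv_of ExtPA.pa (fun M _ => ?_)⟩
  · rw [hi, hφ, ← a2 M (fun i => i.elim0), Rz_sentence]
  · rw [hi, hφ, ← Rz_sentence π M (fun i => i.elim0), b2, not_not]

theorem partH {k : ℕ} {T U : Thy} (hT : GoodThy T) (hU : GoodThy U) (h : CBpair (k+1) T U) :
    ∃ φ : Snt, IsDeltaIn (k+2) PAAx φ ∧ HConsIn (BSigmaS (k+1)) T φ ∧ HConsIn (BSigmaS (k+1)) U φ ∧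
      ¬ Prv T φ ∧ ¬ Prv U φ := by
  obtain ⟨R, hR, hRn, M0, N0, hM0, hN0, hMN, hRM, hRN⟩ := partG hT hU h
  obtain ⟨W, hW, Wuniq, Wstd, Wex⟩ := exists_W hR hRn
  obtain ⟨En, hEn, Emono, Esat, Eex⟩ := exists_enum
  have hW' : ∀ {m : ℕ} (t : Fnc m) [TD t], D0 (fun M v => W M (t M v)) := fun {m} t ht =>
    @D0.subst 1 _ hW m ![t] (by intro i; obtain rfl : i = 0 := Fin.ext (by omega)
                                exact ht)
  have Wbig : ∀ (M : PAM) (y : M) (i : ℕ), W M y → (i : M) ≤ y := by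
    intro M y i hy
    by_contra hc
    obtain ⟨j, _, rfl⟩ := le_nat (not_le.1 hc).le
    exact Wstd _ _ hy
  let D : ∀ M : PAM, M → M → Prop := fun M q y => ∃ x, x ≤ y ∧ ∃ z, z ≤ x ∧ (En M q z x ∧ (z ≠ 0 ∧ (¬ CC k z ∧ ¬ En M q 0 x)))
  let Φ : ∀ M : PAM, M → Prop := fun M q => ∀ y, W M y → D M q y
  have hDdl : ∀ {m : ℕ} (q y : Fnc m) [TD q] [TD y], Dl k (fun M v => D M (q M v) (y M v)) := by
    intro m q y _ _
    show Dl k (fun M v => ∃ x, x ≤ y M v ∧ ∃ z, z ≤ x ∧ (En M (q M v) z x ∧ (z ≠ 0 ∧ (¬ CC k z ∧ ¬ En M (q M v) 0 x))))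
    infer_instance
  have hΦ : ∀ {m : ℕ} (q : Fnc m) [TD q], Df (fun M v => Φ M (q M v)) := by
    intro m q _
    have hD : ∀ {m : ℕ} (q y : Fnc m) [TD q] [TD y], Df (fun M v => D M (q M v) (y M v)) := fun q y _ _ => (hDdl q y).pos.toDf
    show Df (fun M v => ∀ y, W M y → D M (q M v) y)
    infer_instance
  have hΨ : Df (m := 2) (fun M v => (v 0 = 0 ∧ Φ M (v 1)) ∨ (v 0 ≠ 0 ∧ (Φ M (v 1) → CC k (v 0)))) := inferInstance
  obtain ⟨S, hS, hS'⟩ := @S1N.or _ _ _ (S1N.thm2 hT (fun M v => (v 0 = 0 ∧ Φ M (v 1)) ∨ (v 0 ≠ 0 ∧ (Φ M (v 1) → CC k (v 0))))) (S1N.thm2 hU (fun M v => (v 0 = 0 ∧ Φ M (v 1)) ∨ (v 0 ≠ 0 ∧ (Φ M (v 1) → CC k (v 0)))))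
  obtain ⟨r, hr⟩ := UU_code 0 hS
  let Th' : ℕ → Prop := fun z => (∀ M : PAM, M ⊨ T → ((z : M) = 0 ∧ Φ M r) ∨ ((z : M) ≠ 0 ∧ (Φ M r → CC k (z : M)))) ∨
    (∀ M : PAM, M ⊨ U → ((z : M) = 0 ∧ Φ M r) ∨ ((z : M) ≠ 0 ∧ (Φ M r → CC k (z : M))))
  have hTh : ∀ z : ℕ, Th' z ↔ UU 0 (r : NN) (J (z : NN) (J (r : NN) 0)) := by
    intro z
    have e := hr NN (cst NN ![z, r])
    have e2 : env (cst NN ![z, r]) = J (z : NN) (J (r : NN) 0) := by simp [env, cst]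
    rw [e2] at e
    rw [← e, ← hS' ![z, r] ]
    rfl
  have Eabs : ∀ (M M' : PAM) (z x : ℕ), En M r z x ↔ En M' r z x := by
    intro M M' z x
    have := D0_abs (R := fun M (v : Fin 3 → M) => En M (v 0) (v 1) (v 2)) inferInstance ![r, z, x] M M'
    exact this
  have E1 : ∀ z : ℕ, Th' z → ∃ x : ℕ, ∀ M : PAM, En M r z x := by
    intro z hz
    obtain ⟨x, hx⟩ := Eex NN r z ((hTh z).1 hz)
    obtain ⟨x, rfl⟩ := nn_std x
    exact ⟨x, fun M => (Eabs NN M z x).1 hx⟩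
  have E2 : ∀ (M : PAM) (z x : ℕ), En M r z x → Th' z := fun M z x hx =>
    (hTh z).2 (Esat NN _ _ _ ((Eabs M NN z x).1 hx))
  have key : ∀ (M0 N0 : PAM), Eqv k M0 N0 → R M0 → R N0 →
      (∀ z : ℕ, z ≠ 0 → Th' z → ((Φ M0 r → CC k (z : M0)) ∨ (Φ N0 r → CC k (z : N0)))) → Th' 0 → ¬ Φ M0 r := by
    intro M0 N0 hMN hRM hRN hz h0 hP
    obtain ⟨x0, hx0⟩ := E1 0 h0
    obtain ⟨y, hy⟩ := Wex M0 hRM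
    obtain ⟨x, hxy, z, hzx, h1, h2, h3, h4⟩ := hP y hy
    have hx : x ≤ (x0 : M0) := by
      by_contra hc
      apply h4
      have := hx0 M0
      rw [Nat.cast_zero] at this
      exact Emono _ _ _ _ _ this (not_le.1 hc).le
    obtain ⟨x, _, rfl⟩ := le_nat hx
    obtain ⟨z, _, rfl⟩ := le_nat hzx
    have hz0 : z ≠ 0 := by rintro rfl; exact h2 Nat.cast_zero
    rcases hz z hz0 (E2 _ _ _ h1) with hc | hc
    · exact h3 (hc hP)
    · refine h3 ((hMN.cc z).2 (hc ?_))
      intro y' hy'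
      refine ⟨(x : N0), Wbig _ _ _ hy', (z : N0), ?_, (Eabs M0 N0 z x).1 h1, ?_, ?_, ?_⟩
      · rw [Nat.cast_le] at hzx ⊢; exact hzx
      · exact_mod_cast hz0
      · exact fun hc => h3 ((hMN.cc z).2 hc)
      · intro hc
        apply h4
        have := (Eabs N0 M0 0 x).1 (by rw [Nat.cast_zero]; exact hc)
        rw [Nat.cast_zero] at this; exact this
  have hz1 : ∀ z : ℕ, z ≠ 0 → Th' z → ((Φ M0 r → CC k (z : M0)) ∨ (Φ N0 r → CC k (z : N0))) := by
    rintro z hz (hz' | hz')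
    · left
      rcases hz' M0 hM0 with ⟨h, _⟩ | ⟨_, h⟩
      · exact absurd (by exact_mod_cast h) hz
      · exact h
    · right
      rcases hz' N0 hN0 with ⟨h, _⟩ | ⟨_, h⟩
      · exact absurd (by exact_mod_cast h) hz
      · exact h
  have hT0 : ¬ ∀ M : PAM, M ⊨ T → Φ M r := fun hp =>
    key M0 N0 hMN hRM hRN hz1 (Or.inl fun M hM => Or.inl ⟨Nat.cast_zero, hp M hM⟩) (hp M0 hM0)
  have hU0 : ¬ ∀ M : PAM, M ⊨ U → Φ M r := fun hp =>
    key N0 M0 hMN.symm hRN hRM (fun z h1 h2 => (hz1 z h1 h2).symm) (Or.inr fun M hM => Or.inl ⟨Nat.cast_zero, hp M hM⟩) (hp N0 hN0)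
  have hTh0 : ¬ Th' 0 := by
    rintro (hp | hp)
    · refine hT0 (fun M hM => ?_)
      rcases hp M hM with ⟨_, h⟩ | ⟨h, _⟩
      · exact h
      · exact absurd Nat.cast_zero h
    · refine hU0 (fun M hM => ?_)
      rcases hp M hM with ⟨_, h⟩ | ⟨h, _⟩
      · exact h
      · exact absurd Nat.cast_zero h
  have HC : ∀ K : PAM, ¬ Φ K r → ∀ z : ℕ, z ≠ 0 → Th' z → CC k (z : K) := by
    intro K hK z hz hz'
    by_contra hc
    obtain ⟨x, hx⟩ := E1 z hz'
    apply hK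
    intro y hy
    refine ⟨((max x z : ℕ) : K), Wbig _ _ _ hy, (z : K), Nat.cast_le.2 (le_max_right _ _),
      Emono _ _ _ _ _ (hx K) (Nat.cast_le.2 (le_max_left _ _)), by exact_mod_cast hz, hc, fun h0 => ?_⟩
    apply hTh0
    refine E2 K 0 (max x z) ?_
    rw [Nat.cast_zero]; exact h0
  have hΦ0 : Df (m := 0) (fun M _ => Φ M r) := hΦ (fun M _ => (r : M))
  obtain ⟨φ, hφ⟩ := exists_snt (fun M => Φ M r)
  refine ⟨φ, ?_, ?_, ?_, ?_, ?_⟩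
  · have p1 : Sg (k+2) (m := 0) (fun M _ => ∃ y, W M y ∧ D M r y) :=
      Sg.exH (P := fun M v y => W M y ∧ D M r y) ((sgPkg _).and (Sg.ofD0 _) (hDdl (fun M v => (r : M)) (fun M v => v 0)).pos)
    have p2 : Sg (k+2) (m := 0) (fun M _ => ∃ y, W M y ∧ ¬ D M r y) :=
      Sg.exH (P := fun M v y => W M y ∧ ¬ D M r y) ((sgPkg _).and (Sg.ofD0 _) (hDdl (fun M v => (r : M)) (fun M v => v 0)).neg)
    have p3' : Sg 1 (m := 0) (fun M _ => ∃ y, W M y) :=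
      Sg.exH (k := 0) (P := fun M v y => W M y) (Sg.ofD0 _)
    have up : ∀ j, Sg (j+1) (m := 0) (fun M _ => ∃ y, W M y) := by
      intro j
      induction j with
      | zero => exact p3'
      | succ j ih => exact ih.succ
    have p3 : Sg (k+2) (m := 0) (fun M _ => ¬ ∃ y, W M y) := (up k).neg
    refine Dl.delta (R := fun M => Φ M r) ?_ ?_ hφ
    · refine ((sgPkg _).or p3 p1).congr (fun M v => ?_)
      constructor
      · rintro (h | ⟨y, h1, h2⟩) y' hy'
        · exact absurd ⟨y', hy'⟩ h
        · rw [Wuniq M y' y hy' h1]; exact h2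
      · intro h
        by_cases hy : ∃ y, W M y
        · obtain ⟨y, hy⟩ := hy
          exact Or.inr ⟨y, hy, h y hy⟩
        · exact Or.inl hy
    · refine p2.congr (fun M v => ?_)
      show _ ↔ ¬ ∀ y, W M y → D M r y
      push Not; rfl
  · refine hcons_of (fun K hK => ?_)
    rw [hφ] at hK
    obtain ⟨N, h1, h2, h3⟩ := exists_eqv (k := k) hT.2.2 (fun M => Φ M r) K (fun z hz => by
      by_cases hz0 : z = 0
      · subst hz0; rw [Nat.cast_zero]; exact CC_zero
      · exact HC K hK z hz0 (Or.inl fun M hM => Or.inr ⟨by exact_mod_cast hz0, hz M hM⟩))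
    exact ⟨N, h1, (hφ N).2 h2, h3⟩
  · refine hcons_of (fun K hK => ?_)
    rw [hφ] at hK
    obtain ⟨N, h1, h2, h3⟩ := exists_eqv (k := k) hU.2.2 (fun M => Φ M r) K (fun z hz => by
      by_cases hz0 : z = 0
      · subst hz0; rw [Nat.cast_zero]; exact CC_zero
      · exact HC K hK z hz0 (Or.inr fun M hM => Or.inr ⟨by exact_mod_cast hz0, hz M hM⟩))
    exact ⟨N, h1, (hφ N).2 h2, h3⟩
  · exact fun hp => hT0 (fun M hM => (hφ M).1 (M.prv hp hM))
  · exact fun hp => hU0 (fun M hM => (hφ M).1 (M.prv hp hM))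

theorem partI {n : ℕ} {T U : Thy} (hT : ExtPA T) (hU : ExtPA U) {φ : Snt} (h : HConsIn (BSigmaS n) U φ) (hφ : ¬ Prv T φ) :
    CBpair n T U := by
  have hi : ∀ (K : PAM) (φ ψ : Snt), K ⊨ (φ ⟹ ψ : Snt) ↔ (K ⊨ φ → K ⊨ ψ) := fun K φ ψ => BoundedFormula.realize_imp
  rw [prv_iff hT] at hφ
  push Not at hφ
  obtain ⟨M, hM, hMφ⟩ := hφ
  refine (con_iff (hT.mono (fun x hx => Or.inl hx))).2 ⟨M, ⟨?_⟩⟩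
  rintro β (hβ | ⟨hβ, hUβ⟩)
  · exact hM.realize_of_mem β hβ
  have hV : ExtPA (add PAAx (φ ⟹ β)) := ExtPA.pa.mono (fun x hx => Or.inr hx)
  have hs : SubThy (add PAAx (φ ⟹ β)) U := by
    refine ⟨hV, fun ψ hψ => prv_of hU (fun N hN => N.prv hψ (PAM.add N.mod ((hi _ _ _).2 fun _ => N.prv hUβ hN)))⟩
  have h1 : Prv (add (add PAAx (φ ⟹ β)) φ) β := by
    refine prv_of (hV.mono (fun x hx => Or.inr hx)) (fun N hN => ?_)
    have a := hN.realize_of_mem φ (Or.inl rfl)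
    have b := hN.realize_of_mem (φ ⟹ β) (Or.inr (Or.inl rfl))
    exact (hi _ _ _).1 b a
  exact M.prv (h _ hs β hβ h1) (PAM.add M.mod ((hi _ _ _).2 fun h => absurd h hMφ))

/-- Theorem 7.3. -/
theorem stmt_15 (T U : Thy) (hT : GoodThy T) (hU : GoodThy U) (n : ℕ) (hn : 1 ≤ n) :
    List.TFAE
      [CBpair n T U,
       ∃ φ : Snt, IsDeltaIn (n + 1) PAAx φ ∧
         HConsIn (BSigmaS n) T φ ∧ HConsIn (BSigmaS n) U φ ∧ φ ∉ Th T ∪ Th U,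
       ∃ φ : Snt, HConsIn (BSigmaS n) T φ ∧ HConsIn (BSigmaS n) U φ ∧
         ∃ ψ : Snt, IsDeltaIn (n + 1) PAAx ψ ∧ Prv (add PAAx φ) ψ ∧ ¬ Prv T ψ ∧ ¬ Prv U ψ,
       ∃ φ : Snt, HConsIn (BSigmaS n) T φ ∧ HConsIn (BSigmaS n) U φ ∧ φ ∉ Th T ∪ Th U,
       ∃ φ : Snt, HConsIn (BSigmaS n) U φ ∧ φ ∉ Th T] := by
  obtain ⟨k, rfl⟩ : ∃ k, n = k + 1 := ⟨n - 1, by omega⟩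
  tfae_have 1 → 2 := by
    intro h
    obtain ⟨φ, h1, h2, h3, h4, h5⟩ := partH hT hU h
    exact ⟨φ, h1, h2, h3, fun hc => hc.elim h4 h5⟩
  tfae_have 2 → 3 := by
    rintro ⟨φ, h1, h2, h3, h4⟩
    exact ⟨φ, h2, h3, φ, h1, prv_mem (Or.inl rfl), fun h => h4 (Or.inl h), fun h => h4 (Or.inr h)⟩
  tfae_have 3 → 4 := by
    rintro ⟨φ, h1, h2, ψ, _, h3, h4, h5⟩
    have key : ∀ {X : Thy}, ExtPA X → Prv X φ → Prv X ψ := fun hX hp =>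
      prv_of hX (fun M hM => M.prv h3 (PAM.add M.mod (M.prv hp hM)))
    exact ⟨φ, h1, h2, fun hc => hc.elim (fun h => h4 (key hT.2.2 h)) (fun h => h5 (key hU.2.2 h))⟩
  tfae_have 4 → 5 := by
    rintro ⟨φ, _, h2, h3⟩
    exact ⟨φ, h2, fun h => h3 (Or.inl h)⟩
  tfae_have 5 → 1 := by
    rintro ⟨φ, h1, h2⟩
    exact partI hT.2.2 hU.2.2 h1 h2
  tfae_finish

end Guaspari
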